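/- arXiv:2006.13923 — 4 statements merged into one kernel-verified Lean document; each statement's English description precedes it below -/
import Mathlib

section
/- Let r ≥ 4 be an integer and Λ > 0. Let g ∈ ℝ[z_1,…,z_n] be a multi-affine real stable polynomial, g(z) = Σ_{A ⊆ [n]} a_A z^{A^c}. If all roots of the diagonalization ḡ lie in [−Λ, Λ], a_∅ = 1, and a_{{i}} = 0 for every i ∈ [n], then there exists a partition S_1,…,S_{r²} of [n] (parts possibly empty) such that for every i ∈ {1,…,r²}, every root of the diagonalization of ∂^{S_i^c} g has absolute value at most ((r−2)/(r(r−1)) + 2√((r−2)/(r(r−1)))) · Λ. -/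
open MvPolynomial Polynomial

/-- A polynomial with real coefficients is *real stable* if it does not vanish
when all variables have positive imaginary part. -/
def RealStable {n : ℕ} (p : MvPolynomial (Fin n) ℝ) : Prop :=
  ∀ z : Fin n → ℂ, (∀ i, 0 < (z i).im) →
    MvPolynomial.eval z (MvPolynomial.map (algebraMap ℝ ℂ) p) ≠ 0

/-- A polynomial is *multi-affine* if it has degree at most 1 in each variable. -/
def MultiAffine {n : ℕ} (p : MvPolynomial (Fin n) ℝ) : Prop :=
  ∀ i, p.degreeOf i ≤ 1

/-- The diagonalization `p̄(x) = p(x,…,x)` of a multivariate polynomial. -/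
noncomputable def diagPoly {n : ℕ} (p : MvPolynomial (Fin n) ℝ) : Polynomial ℝ :=
  MvPolynomial.aeval (fun _ => Polynomial.X) p

/-- The exponent of the multi-affine monomial `∏_{i ∈ A} z_i`. -/
noncomputable def expOf {n : ℕ} (A : Finset (Fin n)) : Fin n →₀ ℕ :=
  ∑ i ∈ A, Finsupp.single i 1

/-- `∂^S p = (∏_{i ∈ S} ∂/∂z_i) p`. -/
noncomputable def pderivs {n : ℕ} (S : Finset (Fin n)) (p : MvPolynomial (Fin n) ℝ) :
    MvPolynomial (Fin n) ℝ :=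
  S.toList.foldr (fun i q => MvPolynomial.pderiv i q) p

section IteratedDerivatives

variable {σ : Type*}

theorem pderiv_pderiv_comm (i j : σ) (p : MvPolynomial σ ℝ) :
    pderiv i (pderiv j p) = pderiv j (pderiv i p) := by
  classical
  ext m
  simp only [MvPolynomial.coeff_pderiv, Finsupp.add_apply, Finsupp.single_apply]
  by_cases h : i = j
  · subst h; rfl
  · have h' : j ≠ i := fun e => h e.symm
    simp only [h, h', if_false, add_zero, add_right_comm m (Finsupp.single i 1)]
    ring

/-- The mixed derivative `∏_{i ∈ S} ∂/∂z_i` of `p`. -/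
noncomputable def iterPderiv (S : Finset σ) (p : MvPolynomial σ ℝ) : MvPolynomial σ ℝ :=
  S.toList.foldr (fun i q => pderiv i q) p

instance : LeftCommutative (fun (i : σ) (q : MvPolynomial σ ℝ) => pderiv i q) :=
  ⟨fun i j q => pderiv_pderiv_comm i j q⟩

@[simp] theorem iterPderiv_empty (p : MvPolynomial σ ℝ) : iterPderiv ∅ p = p := by
  simp [iterPderiv]

theorem iterPderiv_insert [DecidableEq σ] {i : σ} {S : Finset σ} (h : i ∉ S)
    (p : MvPolynomial σ ℝ) : iterPderiv (insert i S) p = pderiv i (iterPderiv S p) := by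
  unfold iterPderiv
  rw [(Finset.toList_insert h).foldr_eq]
  rfl

@[simp] theorem iterPderiv_singleton (i : σ) (p : MvPolynomial σ ℝ) :
    iterPderiv {i} p = pderiv i p := by
  simp [iterPderiv]

theorem iterPderiv_pderiv (S : Finset σ) (i : σ) (p : MvPolynomial σ ℝ) :
    iterPderiv S (pderiv i p) = pderiv i (iterPderiv S p) := by
  classical
  induction S using Finset.induction_on with
  | empty => simp
  | insert a S ha ih => rw [iterPderiv_insert ha, iterPderiv_insert ha, ih, pderiv_pderiv_comm]

theorem iterPderiv_insert' [DecidableEq σ] {i : σ} {S : Finset σ} (h : i ∉ S)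
    (p : MvPolynomial σ ℝ) : iterPderiv (insert i S) p = iterPderiv S (pderiv i p) := by
  rw [iterPderiv_insert h, iterPderiv_pderiv]

theorem iterPderiv_union [DecidableEq σ] {S T : Finset σ} (h : Disjoint S T)
    (p : MvPolynomial σ ℝ) : iterPderiv (S ∪ T) p = iterPderiv S (iterPderiv T p) := by
  induction S using Finset.induction_on with
  | empty => simp
  | insert a S ha ih =>
    rw [Finset.disjoint_insert_left] at h
    rw [Finset.insert_union, iterPderiv_insert (by simp [ha, h.1]), iterPderiv_insert ha, ih h.2]

theorem iterPderiv_comm (S T : Finset σ) (p : MvPolynomial σ ℝ) :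
    iterPderiv S (iterPderiv T p) = iterPderiv T (iterPderiv S p) := by
  classical
  induction S using Finset.induction_on with
  | empty => simp
  | insert a S ha ih => rw [iterPderiv_insert ha, iterPderiv_insert ha, ih, iterPderiv_pderiv]

theorem iterPderiv_sum {ι : Type*} (S : Finset σ) (s : Finset ι) (f : ι → MvPolynomial σ ℝ) :
    iterPderiv S (∑ k ∈ s, f k) = ∑ k ∈ s, iterPderiv S (f k) := by
  classical
  induction S using Finset.induction_on with
  | empty => simp
  | insert a S ha ih => simp_rw [iterPderiv_insert ha, ih, map_sum]

@[simp] theorem iterPderiv_zero (S : Finset σ) :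
    iterPderiv S (0 : MvPolynomial σ ℝ) = 0 := by
  simpa using iterPderiv_sum S (∅ : Finset σ) (fun _ => 0)

/-- `p` is affine in each variable separately. -/
def SepAffine (p : MvPolynomial σ ℝ) : Prop := ∀ i, pderiv i (pderiv i p) = 0

protected theorem SepAffine.pderiv {p : MvPolynomial σ ℝ} (h : SepAffine p) (j : σ) :
    SepAffine (pderiv j p) := fun i => by
  rw [pderiv_pderiv_comm i j, pderiv_pderiv_comm i j, h i, map_zero]

protected theorem SepAffine.sum {ι : Type*} {s : Finset ι} {f : ι → MvPolynomial σ ℝ}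
    (h : ∀ k ∈ s, SepAffine (f k)) : SepAffine (∑ k ∈ s, f k) := fun i => by
  rw [map_sum, map_sum]
  exact Finset.sum_eq_zero fun k hk => h k hk i

protected theorem SepAffine.iterPderiv {p : MvPolynomial σ ℝ} (h : SepAffine p) (S : Finset σ) :
    SepAffine (iterPderiv S p) := fun i => by
  rw [← iterPderiv_pderiv, ← iterPderiv_pderiv, h i, iterPderiv_zero]

theorem SepAffine.iterPderiv_mem [DecidableEq σ] {p : MvPolynomial σ ℝ} (h : SepAffine p)
    {S : Finset σ} {i : σ} (hi : i ∈ S) : MvPolynomial.pderiv i (_root_.iterPderiv S p) = 0 := by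
  rw [← Finset.insert_erase hi, iterPderiv_insert (Finset.notMem_erase i S),
    h.iterPderiv (S.erase i) i]

section Expansion

variable [DecidableEq σ] {R : Type*} [CommRing R] [Algebra ℝ R]

private theorem aeval_update_monomial_of_eq_zero {m : σ →₀ ℕ} {j : σ} (hm : m j = 0) (c : ℝ)
    (w : σ → R) (s : R) :
    aeval (Function.update w j s) (MvPolynomial.monomial m c) =
      aeval w (MvPolynomial.monomial m c) := by
  rw [MvPolynomial.aeval_monomial, MvPolynomial.aeval_monomial]
  congr 1
  refine Finset.prod_congr rfl fun i hi => ?_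
  have : i ≠ j := by rintro rfl; simp [hm] at hi
  simp [this]

theorem aeval_update {p : MvPolynomial σ ℝ} {j : σ} (h : pderiv j (pderiv j p) = 0)
    (w : σ → R) (s : R) :
    aeval (Function.update w j s) p = aeval w p + (s - w j) * aeval w (pderiv j p) := by
  have hsupp : ∀ m ∈ p.support, m j ≤ 1 := by
    intro m hm
    by_contra! hlt
    obtain ⟨m', rfl⟩ : ∃ m', m = m' + Finsupp.single j 1 + Finsupp.single j 1 := by
      refine ⟨m - Finsupp.single j 2, ?_⟩
      ext i
      by_cases hi : i = j
      · subst hi; simp; omega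
      · have hi' : j ≠ i := fun e => hi e.symm
        simp [hi']
    have h1 := congrArg (MvPolynomial.coeff m') h
    simp only [MvPolynomial.coeff_pderiv, MvPolynomial.coeff_zero, mul_eq_zero] at h1
    rw [MvPolynomial.mem_support_iff] at hm
    rcases h1 with (h1 | h1) | h1
    · exact hm h1
    · norm_cast at h1
    · norm_cast at h1
  have hmon : ∀ m ∈ p.support, aeval (Function.update w j s) (MvPolynomial.monomial m (p.coeff m)) =
      aeval w (MvPolynomial.monomial m (p.coeff m)) +
        (s - w j) * aeval w (pderiv j (MvPolynomial.monomial m (p.coeff m))) := by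
    intro m hm
    rcases Nat.lt_or_ge (m j) 1 with h0 | h0
    · have h0 : m j = 0 := by omega
      rw [aeval_update_monomial_of_eq_zero h0, pderiv_monomial]
      simp [h0]
    · have h1 : m j = 1 := le_antisymm (hsupp m hm) h0
      obtain ⟨m', hm'⟩ : ∃ m', m = Finsupp.single j 1 + m' := by
        refine ⟨m - Finsupp.single j 1, ?_⟩
        rw [add_tsub_cancel_of_le]
        intro i
        by_cases hi : i = j
        · subst hi; simp [h1]
        · have hi' : j ≠ i := fun e => hi e.symm
          simp [hi']
      have hm0 : m' j = 0 := by
        have := h1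
        rw [hm'] at this
        simpa using this
      have : MvPolynomial.monomial m (p.coeff m) =
          MvPolynomial.X j * MvPolynomial.monomial m' (p.coeff m) := by
        rw [MvPolynomial.X, MvPolynomial.monomial_mul, one_mul, hm']
      rw [this, map_mul, map_mul, aeval_update_monomial_of_eq_zero hm0, pderiv_mul, pderiv_X_self,
        pderiv_monomial, hm0]
      simp
      ring
  conv_lhs => rw [p.as_sum]
  conv_rhs => rw [p.as_sum]
  simp only [map_sum, Finset.mul_sum, ← Finset.sum_add_distrib]
  exact Finset.sum_congr rfl hmon

theorem aeval_update_of_pderiv_eq_zero {p : MvPolynomial σ ℝ} {j : σ} (h : pderiv j p = 0)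
    (w : σ → R) (s : R) : aeval (Function.update w j s) p = aeval w p := by
  rw [aeval_update (by rw [h, map_zero]), h, map_zero, mul_zero, add_zero]

end Expansion

end IteratedDerivatives

section StableAffine

variable {σ : Type*}

open ComplexConjugate in
/-- A separately affine polynomial `p` such that each `∂ᵢp / p` maps the closed upper half plane to
the closed lower half plane, in a form that also covers the zeros of `p`. -/
def StableAffine (p : MvPolynomial σ ℝ) : Prop :=
  SepAffine p ∧ ∀ w : σ → ℂ, (∀ j, 0 ≤ (w j).im) →
    ∀ i, (aeval w (pderiv i p) * conj (aeval w p)).im ≤ 0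

theorem continuous_aeval_complex (p : MvPolynomial σ ℝ) :
    Continuous fun w : σ → ℂ => aeval w p := by
  have : (fun w : σ → ℂ => aeval w p) =
      fun w => MvPolynomial.eval w (MvPolynomial.map (algebraMap ℝ ℂ) p) := by
    ext w
    rw [MvPolynomial.eval_map, MvPolynomial.aeval_def]
  rw [this]
  exact MvPolynomial.continuous_eval _

theorem StableAffine.of_ne_zero {p : MvPolynomial σ ℝ} (hp : SepAffine p)
    (h : ∀ w : σ → ℂ, (∀ j, 0 < (w j).im) → aeval w p ≠ 0) : StableAffine p := by
  classical
  refine ⟨hp, fun w hw i => ?_⟩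
  have hopen : ∀ w : σ → ℂ, (∀ j, 0 < (w j).im) →
      (aeval w (pderiv i p) * (starRingEnd ℂ) (aeval w p)).im ≤ 0 := by
    intro w hw
    by_contra! hpos
    set A := aeval w (pderiv i p) with hA
    set B := aeval w p with hB
    have hA0 : A ≠ 0 := by rintro h0; simp [h0] at hpos
    refine h (Function.update w i (w i + -B / A)) (fun j => ?_) ?_
    · by_cases hj : j = i
      · subst hj
        have : 0 < (-B / A).im := by
          have hn : 0 < Complex.normSq A := Complex.normSq_pos.2 hA0
          rw [Complex.div_im]
          simp only [Complex.mul_im, Complex.conj_re, Complex.conj_im] at hpos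
          rw [← sub_div]
          apply div_pos _ hn
          simp only [Complex.neg_im, Complex.neg_re]
          linarith
        simpa using add_pos (hw j) this
      · simpa [hj] using hw j
    · rw [aeval_update (hp i), ← hA, ← hB]
      field_simp
      ring
  have hcont : Continuous fun ε : ℝ =>
      (aeval (fun j => w j + ε * Complex.I) (pderiv i p) *
        (starRingEnd ℂ) (aeval (fun j => w j + ε * Complex.I) p)).im := by
    have hw' : Continuous fun ε : ℝ => fun j => w j + ε * Complex.I := by fun_prop
    exact Complex.continuous_im.comp
      (((continuous_aeval_complex _).comp hw').mul
        (Complex.continuous_conj.comp ((continuous_aeval_complex _).comp hw')))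
  have ht := (hcont.tendsto 0).mono_left (nhdsWithin_le_nhds (s := Set.Ioi 0))
  simp only [Complex.ofReal_zero, zero_mul, add_zero] at ht
  refine le_of_tendsto ht ?_
  filter_upwards [self_mem_nhdsWithin] with ε hε
  exact hopen _ fun j => by simpa using add_pos_of_nonneg_of_pos (hw j) hε

protected theorem StableAffine.pderiv {p : MvPolynomial σ ℝ} (hp : StableAffine p) (v : σ) :
    StableAffine (pderiv v p) := by
  classical
  refine ⟨hp.1.pderiv v, fun w hw i => ?_⟩
  by_contra! hpos
  set A := aeval w (MvPolynomial.pderiv i p) with hA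
  set B := aeval w p with hB
  set a := aeval w (MvPolynomial.pderiv i (MvPolynomial.pderiv v p)) with ha
  set c := aeval w (MvPolynomial.pderiv v p) with hc
  have key : ∀ R : ℝ, 0 ≤ R → (A * (starRingEnd ℂ) B).im +
      R * (a.re * B.re + a.im * B.im - A.re * c.re - A.im * c.im) +
      R ^ 2 * (a * (starRingEnd ℂ) c).im ≤ 0 := by
    intro R hR
    have h := hp.2 (Function.update w v (w v + R * Complex.I)) (fun j => by
      by_cases hj : j = v
      · subst hj; simpa using add_nonneg (hw j) hR
      · simpa [hj] using hw j) i
    rw [aeval_update (hp.1 v), aeval_update ((hp.1.pderiv i) v), add_sub_cancel_left,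
      pderiv_pderiv_comm v i, ← hA, ← hB, ← ha, ← hc] at h
    simp only [Complex.mul_im, Complex.add_re, Complex.add_im, Complex.mul_re, Complex.conj_re,
      Complex.conj_im, Complex.ofReal_re, Complex.ofReal_im, Complex.I_re, Complex.I_im] at h ⊢
    nlinarith [h]
  set x := (a * (starRingEnd ℂ) c).im
  set y := a.re * B.re + a.im * B.im - A.re * c.re - A.im * c.im
  set z := (A * (starRingEnd ℂ) B).im
  have hR : 0 ≤ (|y| + |z| + 1) / x + 1 := by positivity
  have h1 := key _ hR
  have hx : x * ((|y| + |z| + 1) / x + 1) = |y| + |z| + 1 + x := by field_simp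
  set R := (|y| + |z| + 1) / x + 1
  have hR1 : 1 ≤ R := by simp only [R]; linarith [show 0 ≤ (|y| + |z| + 1) / x by positivity]
  have : R ^ 2 * x = R * (|y| + |z| + 1 + x) := by rw [← hx]; ring
  rw [this] at h1
  nlinarith [neg_abs_le y, neg_abs_le z, mul_nonneg hR (abs_nonneg z),
    mul_nonneg hR (by linarith [neg_abs_le y] : 0 ≤ y + |y|),
    mul_nonneg (sub_nonneg.2 hR1) (abs_nonneg z)]

protected theorem StableAffine.iterPderiv {p : MvPolynomial σ ℝ} (hp : StableAffine p)
    (S : Finset σ) :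
    StableAffine (iterPderiv S p) := by
  classical
  induction S using Finset.induction_on with
  | empty => simpa
  | insert a S ha ih => rw [iterPderiv_insert ha]; exact ih.pderiv a

theorem aeval_ofReal (z : σ → ℝ) (p : MvPolynomial σ ℝ) :
    aeval (fun j => (z j : ℂ)) p = ((aeval z p : ℝ) : ℂ) :=
  MvPolynomial.aeval_algebraMap_apply ℂ z p

theorem StableAffine.rayleigh {p : MvPolynomial σ ℝ} (hp : StableAffine p) (z : σ → ℝ) (i j : σ) :
    aeval z p * aeval z (MvPolynomial.pderiv i (MvPolynomial.pderiv j p)) ≤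
      aeval z (MvPolynomial.pderiv i p) * aeval z (MvPolynomial.pderiv j p) := by
  classical
  have h := hp.2 (Function.update (fun l => (z l : ℂ)) j (z j + Complex.I)) (fun l => by
      by_cases hj : l = j
      · subst hj; simp
      · simp [hj]) i
  rw [aeval_update (hp.1 j), aeval_update ((hp.1.pderiv i) j), add_sub_cancel_left,
      pderiv_pderiv_comm j i, aeval_ofReal, aeval_ofReal, aeval_ofReal, aeval_ofReal] at h
  simp only [Complex.mul_im, Complex.add_re, Complex.add_im, Complex.mul_re, Complex.conj_re,
      Complex.conj_im, Complex.ofReal_re, Complex.ofReal_im, Complex.I_re, Complex.I_im] at h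
  linarith

theorem StableAffine.aeval_update_eq_zero [DecidableEq σ] {p : MvPolynomial σ ℝ}
    (hp : StableAffine p) {w : σ → ℂ} (hw : ∀ j, 0 ≤ (w j).im) (h0 : aeval w p = 0) {v : σ}
    (hv : 0 < (w v).im) (s : ℂ) : aeval (Function.update w v s) p = 0 := by
  have h := hp.2 (Function.update w v (w v + (-(w v).im : ℝ) * Complex.I)) (fun l => by
      by_cases hj : l = v
      · subst hj; simp
      · simpa [hj] using hw l) v
  rw [aeval_update (hp.1 v), aeval_update_of_pderiv_eq_zero (hp.1 v), add_sub_cancel_left, h0] at h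
  rw [aeval_update (hp.1 v), h0]
  set c := aeval w (MvPolynomial.pderiv v p)
  have hc : c = 0 := by
    simp only [Complex.mul_im, Complex.add_re, Complex.add_im, Complex.mul_re, Complex.conj_re,
      Complex.conj_im, Complex.ofReal_re, Complex.ofReal_im, Complex.I_re, Complex.I_im,
      Complex.zero_re, Complex.zero_im] at h
    have h' : (w v).im * Complex.normSq c ≤ 0 := by
      rw [Complex.normSq_apply]
      linarith
    exact Complex.normSq_eq_zero.1
      (le_antisymm (nonpos_of_mul_nonpos_right h' hv) (Complex.normSq_nonneg c))
  rw [hc]; ring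

theorem StableAffine.aeval_eq_zero_of_aeval_eq_zero [Fintype σ] {p : MvPolynomial σ ℝ}
    (hp : StableAffine p) {w z : σ → ℂ} (hw : ∀ j, 0 ≤ (w j).im) (hz : ∀ j, 0 ≤ (z j).im)
    (h0 : aeval w p = 0) (hwz : ∀ v, (w v).im = 0 → z v = w v) : aeval z p = 0 := by
  classical
  have key : ∀ S : Finset σ, aeval (S.piecewise z w) p = 0 := by
    intro S
    induction S using Finset.induction_on with
    | empty => simpa
    | insert v S hv ih =>
      rw [Finset.piecewise_insert]
      have heq : S.piecewise z w v = w v := by simp [hv]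
      rcases (hw v).eq_or_lt with hv0 | hv0
      · rw [hwz v hv0.symm, ← heq, Function.update_eq_self, ih]
      · refine hp.aeval_update_eq_zero (fun j => ?_) ih (by rwa [heq]) _
        by_cases hj : j ∈ S
        · simpa [hj] using hz j
        · simpa [hj] using hw j
  simpa using key Finset.univ

theorem StableAffine.aeval_ne_zero [Fintype σ] {p : MvPolynomial σ ℝ} (hp : StableAffine p)
    {z : σ → ℝ} (hz : aeval z p ≠ 0) {w : σ → ℂ} (hw : ∀ j, 0 < (w j).im) : aeval w p ≠ 0 := by
  intro h0
  have := hp.aeval_eq_zero_of_aeval_eq_zero (z := fun j => (z j : ℂ)) (fun j => (hw j).le)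
    (fun j => by simp) h0 (fun v hv => absurd hv (hw v).ne')
  rw [aeval_ofReal] at this
  exact hz (by exact_mod_cast this)

protected theorem StableAffine.sum [Fintype σ] {ι : Type*} {s : Finset ι} (hs : s.Nonempty)
    {f : ι → MvPolynomial σ ℝ} (hf : ∀ k ∈ s, StableAffine (f k)) {v : ι → σ}
    {c : MvPolynomial σ ℝ} (hc : ∀ k ∈ s, MvPolynomial.pderiv (v k) (f k) = c) {z : σ → ℝ}
    (hz : aeval z c ≠ 0) : StableAffine (∑ k ∈ s, f k) := by
  classical
  have hcs : StableAffine c := by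
    obtain ⟨k, hk⟩ := hs
    exact hc k hk ▸ (hf k hk).pderiv _
  refine StableAffine.of_ne_zero (SepAffine.sum fun k hk => (hf k hk).1) fun w hw h0 => ?_
  have hcw := hcs.aeval_ne_zero hz hw
  have hneg : ∀ k ∈ s, (aeval w c * (starRingEnd ℂ) (aeval w (f k))).im < 0 := by
    intro k hk
    have h := (hf k hk).2 (Function.update w (v k) (w (v k) + (-(w (v k)).im : ℝ) * Complex.I))
      (fun l => by
        by_cases hj : l = v k
        · subst hj; simp
        · simpa [hj] using (hw l).le) (v k)
    rw [aeval_update ((hf k hk).1 _), aeval_update_of_pderiv_eq_zero ((hf k hk).1 _),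
      add_sub_cancel_left, hc k hk] at h
    have hn := mul_pos (hw (v k)) (Complex.normSq_pos.2 hcw)
    rw [Complex.normSq_apply] at hn
    simp only [Complex.mul_im, Complex.add_re, Complex.add_im, Complex.mul_re, Complex.conj_re,
      Complex.conj_im, Complex.ofReal_re, Complex.ofReal_im, Complex.I_re, Complex.I_im] at h ⊢
    nlinarith [h, hn]
  have := Finset.sum_lt_sum_of_nonempty hs hneg
  rw [← Complex.im_sum, ← Finset.mul_sum, ← map_sum, ← map_sum, h0] at this
  simp at this

end StableAffine

section PartialFractions

open ComplexConjugate

theorem splits_of_aeval_ne_zero {f : ℝ[X]}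
    (h : ∀ t : ℂ, 0 < t.im → Polynomial.aeval t f ≠ 0) : f.Splits := by
  refine Splits.of_splits_map_of_injective (i := algebraMap ℝ ℂ) (algebraMap ℝ ℂ).injective
    (IsAlgClosed.splits _) fun a ha => ?_
  have ha : Polynomial.aeval a f = 0 := by
    rw [Polynomial.mem_roots', IsRoot.def, Polynomial.eval_map_algebraMap] at ha
    exact ha.2
  rcases lt_trichotomy a.im 0 with h0 | h0 | h0
  · refine absurd ?_ (h (conj a) (by simpa using h0))
    rw [Polynomial.aeval_conj, ha, map_zero]
  · exact ⟨a.re, Complex.ext (by simp) (by simp [h0])⟩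
  · exact absurd ha (h a h0)

/-- If the logarithmic-type quotient `A / f` maps the upper half plane to the lower half plane then,
at a root of `f` which is not a root of `A`, the polynomial `f` has a simple zero and `A / f` has a
positive residue. -/
private theorem simple_root_of_im_nonpos {f A u : ℝ[X]} {τ : ℝ} {m : ℕ} (hm : m ≠ 0)
    (hf : f = (Polynomial.X - Polynomial.C τ) ^ m * u) (hu : u.eval τ ≠ 0) (hA : A.eval τ ≠ 0)
    (h : ∀ t : ℂ, 0 < t.im → (Polynomial.aeval t A * conj (Polynomial.aeval t f)).im ≤ 0) :
    m = 1 ∧ 0 < A.eval τ * u.eval τ := by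
  have key : ∀ ω : ℂ, 0 < ω.im → 0 ≤ (A.eval τ * u.eval τ) * (ω ^ m).im := by
    intro ω hω
    have hcont : Continuous fun ε : ℝ => (Polynomial.aeval ((τ : ℂ) + ε * ω) A *
        (conj (ω ^ m) * conj (Polynomial.aeval ((τ : ℂ) + ε * ω) u))).im := by fun_prop
    have ht := (hcont.tendsto 0).mono_left (nhdsWithin_le_nhds (s := Set.Ioi 0))
    have hle := le_of_tendsto ht (b := 0) (by
      filter_upwards [self_mem_nhdsWithin] with ε hε
      have hε : (0 : ℝ) < ε := hε
      have h1 := h (τ + ε * ω) (by simpa using mul_pos hε hω)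
      rw [hf] at h1
      simp only [map_mul, map_pow, map_sub, Polynomial.aeval_X, Polynomial.aeval_C,
        Complex.coe_algebraMap, add_sub_cancel_left, Complex.conj_ofReal] at h1
      rw [mul_pow, ← Complex.ofReal_pow, mul_assoc, mul_left_comm, Complex.im_ofReal_mul] at h1
      rw [map_pow]
      exact nonpos_of_mul_nonpos_right h1 (pow_pos hε m))
    have e1 : Polynomial.aeval (τ : ℂ) A = ((A.eval τ : ℝ) : ℂ) :=
      Polynomial.aeval_algebraMap_apply_eq_algebraMap_eval τ A
    have e2 : Polynomial.aeval (τ : ℂ) u = ((u.eval τ : ℝ) : ℂ) :=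
      Polynomial.aeval_algebraMap_apply_eq_algebraMap_eval τ u
    simp only [Complex.ofReal_zero, zero_mul, add_zero, e1, e2, Complex.conj_ofReal] at hle
    rw [Complex.im_ofReal_mul, Complex.im_mul_ofReal, Complex.conj_im] at hle
    linarith
  have hm' : (0 : ℝ) < m := by positivity
  have hκ : A.eval τ * u.eval τ ≠ 0 := mul_ne_zero hA hu
  have hexp : ∀ θ : ℝ, (Complex.exp ((θ / m : ℝ) * Complex.I)).im = Real.sin (θ / m) ∧
      (Complex.exp ((θ / m : ℝ) * Complex.I) ^ m).im = Real.sin θ := by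
    intro θ
    refine ⟨Complex.exp_ofReal_mul_I_im _, ?_⟩
    rw [← Complex.exp_nat_mul, ← mul_assoc, ← Complex.exp_ofReal_mul_I_im θ]
    congr 3
    push_cast
    field_simp
  have hpi := Real.pi_pos
  have hm1 : (1 : ℝ) ≤ m := by exact_mod_cast Nat.one_le_iff_ne_zero.2 hm
  have hpos : 0 < A.eval τ * u.eval τ := by
    obtain ⟨h1, h2⟩ := hexp (Real.pi / 2)
    have := key (Complex.exp ((Real.pi / 2 / m : ℝ) * Complex.I)) (by
      rw [h1]
      refine Real.sin_pos_of_pos_of_lt_pi (by positivity) ?_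
      rw [div_lt_iff₀ hm']
      nlinarith)
    rw [h2, Real.sin_pi_div_two, mul_one] at this
    exact lt_of_le_of_ne this hκ.symm
  refine ⟨?_, hpos⟩
  by_contra hne
  have hm2 : (2 : ℝ) ≤ m := by exact_mod_cast (by omega : 2 ≤ m)
  obtain ⟨h1, h2⟩ := hexp (Real.pi / 2 + Real.pi)
  have := key (Complex.exp (((Real.pi / 2 + Real.pi) / m : ℝ) * Complex.I)) (by
    rw [h1]
    refine Real.sin_pos_of_pos_of_lt_pi (by positivity) ?_
    rw [div_lt_iff₀ hm']
    nlinarith)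
  rw [h2, Real.sin_add_pi, Real.sin_pi_div_two] at this
  linarith

private theorem eval_divByMonic_root {f : ℝ[X]} {τ : ℝ} (hτ : f.IsRoot τ) :
    (f /ₘ (Polynomial.X - Polynomial.C τ)).eval τ = f.derivative.eval τ := by
  have h := Polynomial.mul_divByMonic_eq_iff_isRoot.2 hτ
  conv_rhs => rw [← h]
  simp

/-- Partial fraction decomposition with nonnegative residues. -/
theorem exists_partialFractions {f A : ℝ[X]} (hf0 : f ≠ 0)
    (hf : ∀ t : ℂ, 0 < t.im → Polynomial.aeval t f ≠ 0) (hdeg : A.degree < f.degree)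
    (h : ∀ t : ℂ, 0 < t.im → (Polynomial.aeval t A * conj (Polynomial.aeval t f)).im ≤ 0) :
    ∃ (T : Finset ℝ) (v : ℝ → ℝ), (∀ τ ∈ T, f.IsRoot τ) ∧ (∀ τ ∈ T, 0 ≤ v τ) ∧
      A = ∑ τ ∈ T, Polynomial.C (v τ) * (f /ₘ (Polynomial.X - Polynomial.C τ)) := by
  induction hn : f.natDegree using Nat.strong_induction_on generalizing f A with
  | _ n ih =>
  by_cases hcommon : ∃ τ, f.IsRoot τ ∧ A.IsRoot τ
  · obtain ⟨τ, hτf, hτA⟩ := hcommon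
    set f₁ := f /ₘ (Polynomial.X - Polynomial.C τ) with hf₁
    set A₁ := A /ₘ (Polynomial.X - Polynomial.C τ) with hA₁
    have ef : (Polynomial.X - Polynomial.C τ) * f₁ = f :=
      Polynomial.mul_divByMonic_eq_iff_isRoot.2 hτf
    have eA : (Polynomial.X - Polynomial.C τ) * A₁ = A :=
      Polynomial.mul_divByMonic_eq_iff_isRoot.2 hτA
    have hf₁0 : f₁ ≠ 0 := by rintro h0; rw [h0, mul_zero] at ef; exact hf0 ef.symm
    have hX : (Polynomial.X - Polynomial.C τ) ≠ 0 := Polynomial.X_sub_C_ne_zero τ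
    have hnd : f.natDegree = 1 + f₁.natDegree := by
      rw [← ef, Polynomial.natDegree_mul hX hf₁0, Polynomial.natDegree_X_sub_C]
    obtain ⟨T, v, hT, hv, hAT⟩ := ih f₁.natDegree (by omega) (f := f₁) (A := A₁) hf₁0
      (fun t ht h0 => hf t ht (by rw [← ef, map_mul, h0, mul_zero]))
      (by
        rw [← ef, ← eA, Polynomial.degree_mul, Polynomial.degree_mul,
          Polynomial.degree_X_sub_C] at hdeg
        exact lt_of_add_lt_add_left hdeg)
      (fun t ht => by
        have h1 := h t ht
        rw [← ef, ← eA, map_mul, map_mul, map_mul, mul_mul_mul_comm, Complex.mul_conj,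
          Complex.im_ofReal_mul] at h1
        refine nonpos_of_mul_nonpos_right h1 (Complex.normSq_pos.2 fun h0 => ?_)
        have : t.im = 0 := by
          have := congrArg Complex.im h0
          simpa using this
        exact ht.ne' this) rfl
    refine ⟨T, v, fun σ hσ => ?_, hv, ?_⟩
    · rw [← ef]
      exact Polynomial.root_mul_left_of_isRoot _ (hT σ hσ)
    · rw [← eA, hAT, Finset.mul_sum]
      refine Finset.sum_congr rfl fun σ hσ => ?_
      rw [mul_left_comm]
      congr 1
      apply mul_left_cancel₀ (Polynomial.X_sub_C_ne_zero σ)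
      rw [mul_left_comm, Polynomial.mul_divByMonic_eq_iff_isRoot.2 (hT σ hσ), ef]
      refine (Polynomial.mul_divByMonic_eq_iff_isRoot.2 ?_).symm
      rw [← ef]
      exact Polynomial.root_mul_left_of_isRoot _ (hT σ hσ)
  · push Not at hcommon
    have hlocal : ∀ τ, f.IsRoot τ →
        f.rootMultiplicity τ = 1 ∧ 0 < A.eval τ * f.derivative.eval τ := by
      intro τ hτ
      obtain ⟨u, hu, hdvd⟩ := Polynomial.exists_eq_pow_rootMultiplicity_mul_and_not_dvd f hf0 τ
      have hm : f.rootMultiplicity τ ≠ 0 := by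
        have := (Polynomial.rootMultiplicity_pos hf0).2 hτ
        omega
      obtain ⟨h1, h2⟩ := simple_root_of_im_nonpos hm hu
        (fun h0 => hdvd (Polynomial.dvd_iff_isRoot.2 h0)) (hcommon τ hτ) h
      refine ⟨h1, ?_⟩
      rw [h1, pow_one] at hu
      rw [hu]
      simpa using h2
    have hsplit := splits_of_aeval_ne_zero hf
    have hnodup : f.roots.Nodup := by
      rw [Multiset.nodup_iff_count_le_one]
      intro a
      rw [Polynomial.count_roots]
      by_cases ha : f.IsRoot a
      · exact (hlocal a ha).1.le
      · rw [Polynomial.rootMultiplicity_eq_zero ha]; exact zero_le_one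
    have hcard : f.roots.toFinset.card = f.natDegree := by
      rw [hsplit.natDegree_eq_card_roots, Multiset.toFinset_card_of_nodup hnodup]
    have hroot : ∀ τ ∈ f.roots.toFinset, f.IsRoot τ := fun τ hτ =>
      (Polynomial.mem_roots'.1 (Multiset.mem_toFinset.1 hτ)).2
    refine ⟨f.roots.toFinset, fun τ => A.eval τ / f.derivative.eval τ, hroot, fun τ hτ => ?_, ?_⟩
    · have := (hlocal τ (hroot τ hτ)).2
      rcases mul_pos_iff.1 this with h1 | h1
      · exact div_nonneg h1.1.le h1.2.le
      · exact div_nonneg_of_nonpos h1.1.le h1.2.le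
    · have hdf : f.degree = f.roots.toFinset.card := by
        rw [hcard, Polynomial.degree_eq_natDegree hf0]
      refine Polynomial.eq_of_degrees_lt_of_eval_finset_eq f.roots.toFinset (hdf ▸ hdeg) ?_ ?_
      · rw [← hdf]
        refine lt_of_le_of_lt (Polynomial.degree_sum_le _ _) ?_
        rw [Finset.sup_lt_iff (bot_lt_iff_ne_bot.2 (by rwa [Ne, Polynomial.degree_eq_bot]))]
        intro τ hτ
        rw [← Polynomial.smul_eq_C_mul]
        refine lt_of_le_of_lt (Polynomial.degree_smul_le _ _) ?_
        exact Polynomial.degree_divByMonic_lt _ _ hf0 (by rw [Polynomial.degree_X_sub_C]; decide)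
      · intro τ hτ
        rw [Polynomial.eval_finsetSum, Finset.sum_eq_single τ]
        · rw [Polynomial.eval_mul, Polynomial.eval_C, eval_divByMonic_root (hroot τ hτ),
            div_mul_cancel₀]
          intro h0
          have := (hlocal τ (hroot τ hτ)).2
          rw [h0, mul_zero] at this
          exact lt_irrefl _ this
        · intro σ hσ hne
          have h1 := congrArg (Polynomial.eval τ)
            (Polynomial.mul_divByMonic_eq_iff_isRoot.2 (hroot σ hσ))
          rw [Polynomial.eval_mul, (hroot τ hτ).eq_zero] at h1
          rcases mul_eq_zero.1 h1 with h2 | h2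
          · simp only [Polynomial.eval_sub, Polynomial.eval_X, Polynomial.eval_C] at h2
            exact absurd (sub_eq_zero.1 h2).symm hne
          · rw [Polynomial.eval_mul, h2, mul_zero]
        · intro h0; exact absurd hτ h0

end PartialFractions

section Above

variable {σ : Type*}

/-- The point `z` lies above the zeros of `p` in the directions of `V`: every mixed derivative of
`p` along a subset of `V` is positive at `z`. -/
def Above (V : Finset σ) (p : MvPolynomial σ ℝ) (z : σ → ℝ) : Prop :=
  ∀ T ⊆ V, 0 < aeval z (iterPderiv T p)

theorem Above.pos {V : Finset σ} {p : MvPolynomial σ ℝ} {z : σ → ℝ} (h : Above V p z) :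
    0 < aeval z p := by
  simpa using h ∅ (Finset.empty_subset V)

variable [DecidableEq σ]

protected theorem Above.iterPderiv {V S W : Finset σ} {p : MvPolynomial σ ℝ} {z : σ → ℝ}
    (h : Above V p z) (hSW : Disjoint S W) (hSV : S ⊆ V) (hWV : W ⊆ V) :
    Above W (iterPderiv S p) z := fun T hT => by
  rw [← iterPderiv_union (Finset.disjoint_of_subset_left hT hSW.symm)]
  exact h _ (Finset.union_subset (hT.trans hWV) hSV)

protected theorem Above.update {V : Finset σ} {p : MvPolynomial σ ℝ} {z : σ → ℝ} (hp : SepAffine p)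
    (h : Above V p z) {v : σ} (hv : v ∈ V) {s : ℝ} (hs : z v ≤ s) :
    Above V p (Function.update z v s) := fun T hT => by
  rw [aeval_update ((hp.iterPderiv T) v)]
  by_cases hvT : v ∈ T
  · rw [hp.iterPderiv_mem hvT, map_zero, mul_zero, add_zero]
    exact h T hT
  · rw [← iterPderiv_insert hvT]
    exact add_pos_of_pos_of_nonneg (h T hT) (mul_nonneg (sub_nonneg.2 hs)
      (h _ (Finset.insert_subset hv hT)).le)

protected theorem Above.piecewise {V : Finset σ} {p : MvPolynomial σ ℝ} {z z' : σ → ℝ}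
    (hp : SepAffine p) (h : Above V p z) {S : Finset σ} (hS : S ⊆ V) (hz : ∀ v ∈ S, z v ≤ z' v) :
    Above V p (S.piecewise z' z) := by
  induction S using Finset.induction_on with
  | empty => simpa
  | insert a S ha ih =>
    rw [Finset.insert_subset_iff] at hS
    rw [Finset.piecewise_insert]
    refine (ih hS.2 fun v hv => hz v (Finset.mem_insert_of_mem hv)).update hp hS.1 ?_
    rw [Finset.piecewise_eq_of_notMem _ _ _ ha]
    exact hz a (Finset.mem_insert_self a S)

theorem Above.insert_of_pderiv {V : Finset σ} {q : MvPolynomial σ ℝ} {z : σ → ℝ} {v : σ}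
    (hq : StableAffine q) (h : Above V (pderiv v q) z) (hpos : 0 < aeval z q) :
    Above (insert v V) q z := by
  have key : ∀ T ⊆ V, 0 < aeval z (_root_.iterPderiv T q) := by
    intro T hT
    induction T using Finset.induction_on with
    | empty => simpa
    | insert a T ha ih =>
      rw [Finset.insert_subset_iff] at hT
      have hray := (hq.iterPderiv T).rayleigh z a v
      rw [← iterPderiv_insert ha, ← iterPderiv_pderiv, ← iterPderiv_insert ha] at hray
      exact pos_of_mul_pos_left ((mul_pos (ih hT.2)
        (h _ (Finset.insert_subset_iff.2 hT))).trans_le hray) (h T hT.2).le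
  intro T hT
  by_cases hvT : v ∈ T
  · rw [← Finset.insert_erase hvT, iterPderiv_insert' (Finset.notMem_erase v T)]
    exact h _ (Finset.subset_insert_iff.1 hT)
  · exact key T ((Finset.subset_insert_iff_of_notMem hvT).1 hT)

theorem StableAffine.neg_of_lt {q : MvPolynomial σ ℝ} (hq : StableAffine q) {v : σ} {O : Finset σ}
    {z : σ → ℝ} {s x t : ℝ} (htx : t < x)
    (hpos : ∀ T ⊆ O, 0 < s * aeval z (iterPderiv T (MvPolynomial.pderiv v q)))
    (hzero : aeval (Function.update z v x) (iterPderiv O q) = 0) {T : Finset σ} (hT : T ⊆ O) :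
    0 < -s * aeval (Function.update z v t) (iterPderiv T q) := by
  have hval : ∀ T y, aeval (Function.update z v y) (MvPolynomial.pderiv v (iterPderiv T q)) =
      aeval z (iterPderiv T (MvPolynomial.pderiv v q)) := fun T y => by
    rw [aeval_update_of_pderiv_eq_zero (hq.1.iterPderiv T v), iterPderiv_pderiv]
  have hnonpos : ∀ U T : Finset σ, Disjoint T U → T ∪ U = O →
      s * aeval (Function.update z v x) (iterPderiv T q) ≤ 0 := by
    intro U
    induction U using Finset.induction_on with
    | empty =>
      intro T _ hTU
      rw [Finset.union_empty] at hTU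
      rw [hTU, hzero, mul_zero]
    | insert a U ha ih =>
      intro T hdisj hTU
      rw [Finset.disjoint_insert_right] at hdisj
      have h1 := ih (insert a T) (Finset.disjoint_insert_left.2 ⟨ha, hdisj.2⟩)
        (by rw [← hTU, Finset.insert_union, Finset.union_insert])
      have hTO : insert a T ⊆ O := by
        rw [← hTU, Finset.insert_subset_iff]
        exact ⟨by simp, Finset.subset_union_left⟩
      have hray := (hq.iterPderiv T).rayleigh (Function.update z v x) a v
      rw [← iterPderiv_pderiv T v q, ← iterPderiv_insert hdisj.1, ← iterPderiv_insert hdisj.1,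
        iterPderiv_pderiv, iterPderiv_pderiv, hval, hval] at hray
      have p1 := hpos _ hTO
      have p2 := hpos T ((Finset.subset_insert a T).trans hTO)
      set B := aeval (Function.update z v x) (iterPderiv T q)
      set B' := aeval (Function.update z v x) (iterPderiv (insert a T) q)
      set C := aeval z (iterPderiv T (MvPolynomial.pderiv v q))
      set C' := aeval z (iterPderiv (insert a T) (MvPolynomial.pderiv v q))
      have : (s * B) * (s * C') ≤ (s * B') * (s * C) := by nlinarith [sq_nonneg s]
      by_contra! hB
      nlinarith [mul_pos hB p1, mul_nonneg (neg_nonneg.2 h1) p2.le]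
  have hB := hnonpos (O \ T) T Finset.disjoint_sdiff (Finset.union_sdiff_of_subset hT)
  have hC := hpos T hT
  have : Function.update z v t = Function.update (Function.update z v x) v t := by simp
  rw [this, aeval_update (hq.1.iterPderiv T v), hval, Function.update_self]
  nlinarith [mul_pos (sub_pos.2 htx) hC]

theorem iterPderiv_X_mul {v : σ} {S : Finset σ} (hv : v ∉ S) (q : MvPolynomial σ ℝ) :
    iterPderiv S (MvPolynomial.X v * q) = MvPolynomial.X v * iterPderiv S q := by
  induction S using Finset.induction_on with
  | empty => simp
  | insert a S ha ih =>
    rw [Finset.mem_insert, not_or] at hv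
    rw [iterPderiv_insert ha, iterPderiv_insert ha, ih hv.2, pderiv_mul, pderiv_X_of_ne hv.1]
    simp

theorem StableAffine.neg_pow_mul_pos {p : MvPolynomial σ ℝ} (hp : StableAffine p)
    {B O : Finset σ} {z : σ → ℝ} {t : ℝ} (ht : t < 0) (hpos : Above O (iterPderiv B p) z)
    (hO : iterPderiv O p = ∏ b ∈ B, MvPolynomial.X b) :
    0 < (-1) ^ B.card * aeval (B.piecewise (fun _ => t) z) p := by
  have key : ∀ M ⊆ B, ∀ T ⊆ O, 0 < (-1) ^ M.card *
      aeval (M.piecewise (fun _ => t) z) (iterPderiv T (iterPderiv (B \ M) p)) := by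
    intro M
    induction M using Finset.induction_on with
    | empty => intro _ T hT; simpa using hpos T hT
    | insert v M hv ih =>
      intro hM T hT
      rw [Finset.insert_subset_iff] at hM
      have hvs : v ∉ B \ insert v M := by simp
      have hins : insert v (B \ insert v M) = B \ M := by
        ext a
        by_cases hav : a = v
        · subst hav; simp [hM.1, hv]
        · simp [hav]
      rw [Finset.piecewise_insert, Finset.card_insert_of_notMem hv, pow_succ, mul_neg_one]
      refine (hp.iterPderiv (B \ insert v M)).neg_of_lt ht (O := O) ?_ ?_ hT
      · rw [← iterPderiv_insert hvs, hins]
        exact ih hM.2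
      · rw [iterPderiv_comm, hO, ← Finset.mul_prod_erase B _ hM.1, iterPderiv_X_mul hvs, map_mul,
          MvPolynomial.aeval_X, Function.update_self, zero_mul]
  simpa using key B subset_rfl ∅ (Finset.empty_subset O)

end Above

section Restriction

variable {σ : Type*} [DecidableEq σ]

theorem aeval_piecewise_of_pderiv_eq_zero {R : Type*} [CommRing R] [Algebra ℝ R]
    {p : MvPolynomial σ ℝ} {B : Finset σ} (h : ∀ b ∈ B, pderiv b p = 0) (w w' : σ → R) :
    aeval (B.piecewise w' w) p = aeval w p := by
  induction B using Finset.induction_on with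
  | empty => simp
  | insert b B hb ih =>
    rw [Finset.piecewise_insert,
      aeval_update_of_pderiv_eq_zero (h b (Finset.mem_insert_self b B)),
      ih fun a ha => h a (Finset.mem_insert_of_mem ha)]

theorem aeval_piecewise_eq_sum {R : Type*} [CommRing R] [Algebra ℝ R] {p : MvPolynomial σ ℝ}
    (hp : SepAffine p) {B : Finset σ} {w : σ → R} (hw : ∀ b ∈ B, w b = 0) (x : R) :
    aeval (B.piecewise (fun _ => x) w) p =
      ∑ S ∈ B.powerset, x ^ S.card * aeval w (iterPderiv S p) := by
  induction B using Finset.induction_on generalizing p with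
  | empty => simp
  | insert b B hb ih =>
    have hw' : ∀ a ∈ B, w a = 0 := fun a ha => hw a (Finset.mem_insert_of_mem ha)
    rw [Finset.piecewise_insert, aeval_update (hp b), Finset.piecewise_eq_of_notMem _ _ _ hb,
      hw b (Finset.mem_insert_self b B), sub_zero, ih hp hw', ih (hp.pderiv b) hw',
      Finset.sum_powerset_insert hb, Finset.mul_sum]
    congr 1
    refine Finset.sum_congr rfl fun S hS => ?_
    have hbS : b ∉ S := fun h => hb (Finset.mem_powerset.1 hS h)
    rw [Finset.card_insert_of_notMem hbS, iterPderiv_insert' hbS, pow_succ']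
    ring

/-- The univariate polynomial obtained from `p` by putting every variable of `B` equal to the
indeterminate and every other variable `a` equal to `z a`. -/
noncomputable def lineRestrict (B : Finset σ) (z : σ → ℝ) (p : MvPolynomial σ ℝ) : ℝ[X] :=
  MvPolynomial.aeval (B.piecewise (fun _ => Polynomial.X) fun a => Polynomial.C (z a)) p

theorem aeval_lineRestrict {R : Type*} [CommRing R] [Algebra ℝ R] (B : Finset σ) (z : σ → ℝ)
    (p : MvPolynomial σ ℝ) (t : R) : Polynomial.aeval t (lineRestrict B z p) =
      MvPolynomial.aeval (B.piecewise (fun _ => t) fun a => algebraMap ℝ R (z a)) p := by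
  rw [lineRestrict, comp_aeval_apply]
  congr 2
  ext a
  by_cases ha : a ∈ B <;> simp [ha]

theorem eval_lineRestrict (B : Finset σ) (z : σ → ℝ) (p : MvPolynomial σ ℝ) (t : ℝ) :
    (lineRestrict B z p).eval t = MvPolynomial.aeval (B.piecewise (fun _ => t) z) p := by
  rw [← Polynomial.coe_aeval_eq_eval, aeval_lineRestrict]
  rfl

theorem coeff_lineRestrict {p : MvPolynomial σ ℝ} (hp : SepAffine p) (B : Finset σ) (z : σ → ℝ)
    (m : ℕ) : (lineRestrict B z p).coeff m =
      ∑ S ∈ B.powersetCard m, aeval (B.piecewise (fun _ => 0) z) (iterPderiv S p) := by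
  have h : lineRestrict B z p = ∑ S ∈ B.powerset, Polynomial.X ^ S.card *
      Polynomial.C (MvPolynomial.aeval (B.piecewise (fun _ => 0) z) (iterPderiv S p)) := by
    have := aeval_piecewise_eq_sum hp (B := B) (R := ℝ[X])
      (w := fun a => Polynomial.C (B.piecewise (fun _ => 0) z a))
      (fun b hb => by simp [hb]) Polynomial.X
    have e : (B.piecewise (fun _ => Polynomial.X)
        fun a => Polynomial.C (B.piecewise (fun _ => 0) z a)) =
        B.piecewise (fun _ => Polynomial.X) fun a => Polynomial.C (z a) := by
      ext1 a
      by_cases ha : a ∈ B <;> simp [ha]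
    rw [e] at this
    rw [lineRestrict, this]
    refine Finset.sum_congr rfl fun S _ => ?_
    congr 1
    exact MvPolynomial.aeval_algebraMap_apply ℝ[X] _ _
  rw [h, Polynomial.finsetSum_coeff, Finset.powersetCard_eq_filter, Finset.sum_filter]
  refine Finset.sum_congr rfl fun S _ => ?_
  rw [Polynomial.coeff_mul_C, Polynomial.coeff_X_pow]
  simp only [eq_comm (a := m), ite_mul, one_mul, zero_mul]

theorem natDegree_lineRestrict_le {p : MvPolynomial σ ℝ} (hp : SepAffine p) (B : Finset σ)
    (z : σ → ℝ) : (lineRestrict B z p).natDegree ≤ B.card := by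
  rw [Polynomial.natDegree_le_iff_coeff_eq_zero]
  intro m hm
  rw [coeff_lineRestrict hp, Finset.powersetCard_eq_empty.2 hm, Finset.sum_empty]

theorem coeff_card_lineRestrict {p : MvPolynomial σ ℝ} (hp : SepAffine p) (B : Finset σ)
    (z : σ → ℝ) : (lineRestrict B z p).coeff B.card = aeval z (iterPderiv B p) := by
  rw [coeff_lineRestrict hp, Finset.powersetCard_self, Finset.sum_singleton]
  exact aeval_piecewise_of_pderiv_eq_zero (fun b hb => hp.iterPderiv_mem hb) _ _

theorem sum_powersetCard_card_sub_one {M : Type*} [AddCommMonoid M] {B : Finset σ}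
    (hB : B.Nonempty) (f : Finset σ → M) :
    ∑ S ∈ B.powersetCard (B.card - 1), f S = ∑ b ∈ B, f (B.erase b) := by
  rw [← Finset.sum_image (g := B.erase) (f := f) (Finset.erase_injOn B)]
  congr 1
  ext S
  rw [Finset.mem_powersetCard, Finset.mem_image]
  constructor
  · rintro ⟨hSB, hc⟩
    have hpos := hB.card_pos
    obtain ⟨a, ha, haS⟩ := Finset.exists_eq_insert_iff.2 ⟨hSB, by omega⟩
    exact ⟨a, by rw [← haS]; simp, by rw [← haS, Finset.erase_insert ha]⟩
  · rintro ⟨b, hb, rfl⟩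
    exact ⟨Finset.erase_subset b B, Finset.card_erase_of_mem hb⟩

theorem coeff_card_sub_one_lineRestrict {p : MvPolynomial σ ℝ} (hp : SepAffine p) {B : Finset σ}
    (hB : B.Nonempty) (z : σ → ℝ) : (lineRestrict B z p).coeff (B.card - 1) =
      aeval (B.piecewise (fun _ => 0) z) (∑ b ∈ B, iterPderiv (B.erase b) p) := by
  rw [coeff_lineRestrict hp, sum_powersetCard_card_sub_one hB, map_sum]

theorem derivative_aeval [Fintype σ] (f : σ → ℝ[X]) (p : MvPolynomial σ ℝ) :
    derivative (MvPolynomial.aeval f p) =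
      ∑ a, derivative (f a) * MvPolynomial.aeval f (pderiv a p) := by
  induction p using MvPolynomial.induction_on with
  | C r => simp
  | add p q hp hq => simp only [map_add, hp, hq, mul_add, Finset.sum_add_distrib]
  | mul_X p i hp =>
    simp only [map_mul, MvPolynomial.aeval_X, Polynomial.derivative_mul, hp, Finset.sum_mul,
      pderiv_mul, map_add, mul_add, Finset.sum_add_distrib]
    congr 1
    · exact Finset.sum_congr rfl fun a _ => by ring
    · rw [Finset.sum_eq_single i]
      · simp; ring
      · intro a _ ha; simp [pderiv_X_of_ne (Ne.symm ha)]
      · simp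

theorem derivative_lineRestrict [Fintype σ] (B : Finset σ) (z : σ → ℝ) (p : MvPolynomial σ ℝ) :
    derivative (lineRestrict B z p) = ∑ b ∈ B, lineRestrict B z (pderiv b p) := by
  rw [lineRestrict, derivative_aeval, ← Finset.sum_subset (Finset.subset_univ B)]
  · refine Finset.sum_congr rfl fun b hb => ?_
    simp [hb, lineRestrict]
  · intro a _ ha
    simp [ha]

theorem StableAffine.im_lineRestrict_nonpos {p : MvPolynomial σ ℝ} (hp : StableAffine p)
    (B : Finset σ) (z : σ → ℝ) (i : σ) {t : ℂ} (ht : 0 < t.im) :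
    (Polynomial.aeval t (lineRestrict B z (MvPolynomial.pderiv i p)) *
      (starRingEnd ℂ) (Polynomial.aeval t (lineRestrict B z p))).im ≤ 0 := by
  rw [aeval_lineRestrict, aeval_lineRestrict]
  refine hp.2 _ (fun j => ?_) i
  by_cases hj : j ∈ B <;> simp [hj, ht.le]

theorem StableAffine.aeval_lineRestrict_ne_zero [Fintype σ] {p : MvPolynomial σ ℝ}
    (hp : StableAffine p) {B : Finset σ} {z : σ → ℝ} (h : lineRestrict B z p ≠ 0) {t : ℂ}
    (ht : 0 < t.im) : Polynomial.aeval t (lineRestrict B z p) ≠ 0 := by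
  intro h0
  refine h (Polynomial.funext fun s => ?_)
  rw [aeval_lineRestrict] at h0
  have := hp.aeval_eq_zero_of_aeval_eq_zero
    (z := fun a => ((B.piecewise (fun _ => s) z a : ℝ) : ℂ)) (fun j => by
      by_cases hj : j ∈ B <;> simp [hj, ht.le]) (fun j => by simp) h0 (fun v hv => by
      by_cases hj : v ∈ B
      · simp [hj, ht.ne'] at hv
      · simp [hj])
  rw [aeval_ofReal] at this
  rw [eval_lineRestrict, Polynomial.eval_zero]
  exact_mod_cast this

end Restriction

section UnivariateBarrier

theorem sub_le_sum_map_sub {b : ℝ} (a : ℝ) {s : Multiset ℝ} (hs : ∀ x ∈ s, x < b) :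
    2 * a * s.card - a ^ 2 * (s.map fun x => 1 / (b - x)).sum ≤ s.card * b - s.sum := by
  induction s using Multiset.induction_on with
  | empty => simp
  | cons x s ih =>
    have h1 := ih fun y hy => hs y (Multiset.mem_cons_of_mem hy)
    have hx : 0 < b - x := sub_pos.2 (hs x (Multiset.mem_cons_self x s))
    have h2 : 2 * a - a ^ 2 * (1 / (b - x)) ≤ b - x := by
      have : (b - x) - (2 * a - a ^ 2 * (1 / (b - x))) = (b - x - a) ^ 2 / (b - x) := by
        field_simp; ring
      have h3 : 0 ≤ (b - x - a) ^ 2 / (b - x) := by positivity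
      linarith
    simp only [Multiset.card_cons, Multiset.map_cons, Multiset.sum_cons, Nat.cast_add, Nat.cast_one]
    linarith

theorem leadingCoeff_mul_sub_root_le {N : ℝ[X]} {r : ℕ} {b φ : ℝ} (hr : 1 ≤ r)
    (hN : N.natDegree = r) (hlc : 0 < N.coeff r) (hsplit : N.Splits)
    (hroots : ∀ x, N.IsRoot x → 0 ≤ x ∧ x < b) (hφ : 1 / b < φ)
    (hder : N.derivative.eval b ≤ φ * N.eval b) (hNb : 0 < N.eval b) {τ : ℝ} (hτ : N.IsRoot τ) :
    N.coeff r * (b - τ) ≤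
      N.coeff (r - 1) + r * (b - (r - 1) ^ 2 / (r * (φ - 1 / b))) * N.coeff r := by
  have hN0 : N ≠ 0 := by rintro rfl; simp at hlc
  have hr' : (0 : ℝ) < r := by exact_mod_cast hr
  have hmem : ∀ x ∈ N.roots, 0 ≤ x ∧ x < b := fun x hx => hroots x (Polynomial.mem_roots'.1 hx).2
  obtain ⟨s, hs⟩ := Multiset.exists_cons_of_mem ((Polynomial.mem_roots hN0).2 hτ)
  have hcard : s.card + 1 = r := by
    rw [← hN, hsplit.natDegree_eq_card_roots, hs, Multiset.card_cons]
  have hcard' : (s.card : ℝ) = r - 1 := by rw [← hcard]; simp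
  have hsum : N.coeff (r - 1) = -N.coeff r * (τ + s.sum) := by
    have h := hsplit.nextCoeff_eq_neg_sum_roots_mul_leadingCoeff
    rwa [Polynomial.nextCoeff_of_natDegree_pos (by omega), Polynomial.leadingCoeff, hN, hs,
      Multiset.sum_cons] at h
  have hinv : (s.map fun x => 1 / (b - x)).sum ≤ φ - 1 / b := by
    have h := hsplit.eval_derivative_div_eval_of_ne_zero hNb.ne'
    rw [hs, Multiset.map_cons, Multiset.sum_cons] at h
    have h1 : N.derivative.eval b / N.eval b ≤ φ := (div_le_iff₀ hNb).2 hder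
    have hτ' := hroots τ hτ
    have h2 : 1 / b ≤ 1 / (b - τ) := one_div_le_one_div_of_le (by linarith) (by linarith)
    linarith
  have hψ : 0 < φ - 1 / b := sub_pos.2 hφ
  set ψ := φ - 1 / b
  have htan := sub_le_sum_map_sub (b := b) ((r - 1) / ψ) (s := s) fun x hx =>
    (hmem x (by rw [hs]; exact Multiset.mem_cons_of_mem hx)).2
  rw [hcard'] at htan
  have hle : ((r - 1) / ψ) ^ 2 * (s.map fun x => 1 / (b - x)).sum ≤ ((r - 1) / ψ) ^ 2 * ψ :=
    mul_le_mul_of_nonneg_left hinv (sq_nonneg _)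
  have e1 : ((r - 1) / ψ) ^ 2 * ψ = ((r : ℝ) - 1) ^ 2 / ψ := by field_simp
  have e2 : 2 * ((r - 1) / ψ) * ((r : ℝ) - 1) = 2 * (((r : ℝ) - 1) ^ 2 / ψ) := by ring
  have e3 : r * (b - (r - 1) ^ 2 / (r * ψ)) = r * b - ((r : ℝ) - 1) ^ 2 / ψ := by field_simp
  rw [e1] at hle
  rw [e2] at htan
  rw [hsum, e3]
  nlinarith

/-- A potential `H / N` does not increase when `N` and `H` are replaced by their polar derivatives
`N_{r-1} + rβ N_r` and `H_{r-1} + rβ H_r`. -/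
theorem polar_mul_eval_le {N H : ℝ[X]} {r : ℕ} {b β : ℝ} (hr : 1 ≤ r) (hN : N.natDegree = r)
    (hlc : 0 < N.coeff r) (hH : H.natDegree ≤ r)
    (hstable : ∀ t : ℂ, 0 < t.im → Polynomial.aeval t N ≠ 0)
    (him : ∀ t : ℂ, 0 < t.im →
      (Polynomial.aeval t H * (starRingEnd ℂ) (Polynomial.aeval t N)).im ≤ 0)
    (hNb : 0 < N.eval b) (hroots : ∀ τ, N.IsRoot τ → τ < b)
    (hbound : ∀ τ, N.IsRoot τ → N.coeff r * (b - τ) ≤ N.coeff (r - 1) + r * β * N.coeff r) :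
    (H.coeff (r - 1) + r * β * H.coeff r) * N.eval b ≤
      H.eval b * (N.coeff (r - 1) + r * β * N.coeff r) := by
  have hN0 : N ≠ 0 := by rintro rfl; simp at hlc
  set α := H.coeff r / N.coeff r with hα
  have hα' : α * N.coeff r = H.coeff r := div_mul_cancel₀ _ hlc.ne'
  have hdeg : (H - Polynomial.C α * N).degree < N.degree := by
    rw [Polynomial.degree_eq_natDegree hN0, hN, Polynomial.degree_lt_iff_coeff_zero]
    intro m hm
    rw [Polynomial.coeff_sub, Polynomial.coeff_C_mul]
    rcases hm.eq_or_lt with rfl | hm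
    · rw [hα', sub_self]
    · rw [Polynomial.coeff_eq_zero_of_natDegree_lt (hH.trans_lt hm),
        Polynomial.coeff_eq_zero_of_natDegree_lt (hN.trans_lt hm), mul_zero, sub_zero]
  obtain ⟨T, v, hT, hv, hA⟩ := exists_partialFractions hN0 hstable hdeg (fun t ht => by
    have h := him t ht
    rw [map_sub, map_mul, sub_mul, Complex.sub_im, mul_assoc, Complex.mul_conj, Polynomial.aeval_C,
      Complex.coe_algebraMap, ← Complex.ofReal_mul, Complex.ofReal_im, sub_zero]
    exact h)
  have hH' : H = Polynomial.C α * N +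
      ∑ τ ∈ T, Polynomial.C (v τ) * (N /ₘ (Polynomial.X - Polynomial.C τ)) := by
    rw [← hA]; ring
  have hcoeff : H.coeff (r - 1) = α * N.coeff (r - 1) + (∑ τ ∈ T, v τ) * N.coeff r := by
    rw [hH', Polynomial.coeff_add, Polynomial.coeff_C_mul, Polynomial.finsetSum_coeff,
      Finset.sum_mul]
    congr 1
    refine Finset.sum_congr rfl fun τ _ => ?_
    rw [Polynomial.coeff_C_mul]
    congr 1
    have h1 := Polynomial.leadingCoeff_divByMonic_X_sub_C N
      (by rw [Polynomial.degree_eq_natDegree hN0, hN]; exact_mod_cast (by omega : r ≠ 0)) τ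
    rwa [Polynomial.leadingCoeff, Polynomial.leadingCoeff, Polynomial.natDegree_divByMonic _
      (Polynomial.monic_X_sub_C τ), Polynomial.natDegree_X_sub_C, hN] at h1
  have heval : H.eval b = α * N.eval b + ∑ τ ∈ T, v τ * (N.eval b / (b - τ)) := by
    rw [hH', Polynomial.eval_add, Polynomial.eval_mul, Polynomial.eval_C,
      Polynomial.eval_finsetSum]
    congr 1
    refine Finset.sum_congr rfl fun τ hτ => ?_
    rw [Polynomial.eval_mul, Polynomial.eval_C]
    congr 1
    have h1 := congrArg (Polynomial.eval b) (Polynomial.mul_divByMonic_eq_iff_isRoot.2 (hT τ hτ))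
    rw [Polynomial.eval_mul, Polynomial.eval_sub, Polynomial.eval_X, Polynomial.eval_C] at h1
    rw [eq_div_iff (sub_pos.2 (hroots τ (hT τ hτ))).ne', mul_comm, h1]
  have hsum : (∑ τ ∈ T, v τ) * N.coeff r * N.eval b ≤
      (∑ τ ∈ T, v τ * (N.eval b / (b - τ))) * (N.coeff (r - 1) + r * β * N.coeff r) := by
    rw [mul_assoc, Finset.sum_mul, Finset.sum_mul]
    refine Finset.sum_le_sum fun τ hτ => ?_
    have hpos := sub_pos.2 (hroots τ (hT τ hτ))
    have h1 := hbound τ (hT τ hτ)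
    rw [mul_assoc]
    refine mul_le_mul_of_nonneg_left ?_ (hv τ hτ)
    rw [div_mul_eq_mul_div, le_div_iff₀ hpos]
    nlinarith
  rw [hcoeff, heval, ← hα']
  linarith

end UnivariateBarrier

section BlockBarrier

variable {σ : Type*} [DecidableEq σ]

/-- The sum of the mixed derivatives of `p` along all subsets of `B` missing exactly one element. -/
noncomputable def polarSum (B : Finset σ) (p : MvPolynomial σ ℝ) : MvPolynomial σ ℝ :=
  ∑ b ∈ B, iterPderiv (B.erase b) p

theorem iterPderiv_polarSum (S B : Finset σ) (p : MvPolynomial σ ℝ) :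
    iterPderiv S (polarSum B p) = polarSum B (iterPderiv S p) := by
  unfold polarSum
  rw [iterPderiv_sum]
  exact Finset.sum_congr rfl fun b _ => iterPderiv_comm _ _ _

theorem pderiv_polarSum_comm (v : σ) (B : Finset σ) (p : MvPolynomial σ ℝ) :
    pderiv v (polarSum B p) = polarSum B (pderiv v p) := by
  simpa using iterPderiv_polarSum {v} B p

theorem pderiv_iterPderiv_erase {B : Finset σ} {b : σ} (hb : b ∈ B) (p : MvPolynomial σ ℝ) :
    pderiv b (iterPderiv (B.erase b) p) = iterPderiv B p := by
  rw [← iterPderiv_insert (Finset.notMem_erase b B), Finset.insert_erase hb]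

theorem SepAffine.pderiv_polarSum {p : MvPolynomial σ ℝ} (hp : SepAffine p) {B : Finset σ} {b : σ}
    (hb : b ∈ B) : MvPolynomial.pderiv b (polarSum B p) = _root_.iterPderiv B p := by
  rw [polarSum, map_sum, Finset.sum_eq_single b]
  · exact pderiv_iterPderiv_erase hb p
  · intro a _ hab
    exact hp.iterPderiv_mem (Finset.mem_erase.2 ⟨hab.symm, hb⟩)
  · exact fun h => absurd hb h

protected theorem SepAffine.polarSum {p : MvPolynomial σ ℝ} (hp : SepAffine p) (B : Finset σ) :
    SepAffine (polarSum B p) :=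
  SepAffine.sum fun _ _ => hp.iterPderiv _

theorem aeval_piecewise_of_pderiv_eq {q c : MvPolynomial σ ℝ} (hq : SepAffine q) {B : Finset σ}
    (hc : ∀ b ∈ B, pderiv b q = c) (w w' : σ → ℝ) :
    MvPolynomial.aeval (B.piecewise w' w) q =
      MvPolynomial.aeval w q + (∑ b ∈ B, (w' b - w b)) * MvPolynomial.aeval w c := by
  induction B using Finset.induction_on with
  | empty => simp
  | insert b B hb ih =>
    have h1 := ih fun a ha => hc a (Finset.mem_insert_of_mem ha)
    have hb' := hc b (Finset.mem_insert_self b B)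
    have h2 : MvPolynomial.aeval (B.piecewise w' w) c = MvPolynomial.aeval w c := by
      refine aeval_piecewise_of_pderiv_eq_zero (fun a ha => ?_) _ _
      rw [← hc a (Finset.mem_insert_of_mem ha), hq a]
    rw [Finset.piecewise_insert, aeval_update (hq b), h1, hb', h2,
      Finset.piecewise_eq_of_notMem _ _ _ hb, Finset.sum_insert hb]
    ring

theorem aeval_polarSum {p : MvPolynomial σ ℝ} (hp : SepAffine p) {B : Finset σ}
    (hB : B.Nonempty) (z : σ → ℝ) (β : ℝ) :
    MvPolynomial.aeval (B.piecewise (fun _ => β) z) (polarSum B p) =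
      (lineRestrict B z p).coeff (B.card - 1) + B.card * β * (lineRestrict B z p).coeff B.card := by
  have h := aeval_piecewise_of_pderiv_eq (hp.polarSum B) (fun b hb => hp.pderiv_polarSum hb)
    (B.piecewise (fun _ => 0) z) (fun _ => β)
  have e : B.piecewise (fun _ => β) (B.piecewise (fun _ => 0) z) = B.piecewise (fun _ => β) z := by
    ext a
    by_cases ha : a ∈ B <;> simp [ha]
  have e1 : ∑ b ∈ B, (β - B.piecewise (fun _ => 0) z b) = B.card * β := by
    rw [Finset.sum_congr rfl fun b hb => by rw [Finset.piecewise_eq_of_mem _ _ _ hb, sub_zero],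
      Finset.sum_const, nsmul_eq_mul]
  rw [e, e1, aeval_piecewise_of_pderiv_eq_zero fun b hb => hp.iterPderiv_mem hb] at h
  rw [h, coeff_card_sub_one_lineRestrict hp hB, coeff_card_lineRestrict hp, polarSum]

theorem StableAffine.iterPderiv_erase_sum [Fintype σ] {p : MvPolynomial σ ℝ} (hp : StableAffine p)
    {B : Finset σ} (hB : B.Nonempty) {z : σ → ℝ} (hz : aeval z (_root_.iterPderiv B p) ≠ 0) :
    StableAffine (polarSum B p) :=
  StableAffine.sum hB (fun b _ => hp.iterPderiv (B.erase b)) (v := id)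
    (fun _ hb => pderiv_iterPderiv_erase hb p) hz

/-- One step of the barrier argument: passing from `p` to its polar derivative along the block `B`
lets the coordinates of the block decrease from `b` to `β`. -/
theorem StableAffine.barrier_step [Fintype σ] {p : MvPolynomial σ ℝ} (hp : StableAffine p)
    {V B : Finset σ} (hBV : B ⊆ V) (hB : B.Nonempty) {z : σ → ℝ} {b β φ : ℝ}
    (hz : ∀ a ∈ B, z a = b) (hV : Above V p z)
    (htop : _root_.iterPderiv (V \ B) p = ∏ a ∈ B, MvPolynomial.X a)
    (hpot : ∑ a ∈ B, aeval z (MvPolynomial.pderiv a p) ≤ φ * aeval z p) (hφ : 1 / b < φ)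
    (hβ : β = b - (B.card - 1) ^ 2 / (B.card * (φ - 1 / b))) :
    StableAffine (polarSum B p) ∧
      (∀ a ∈ B, Above (insert a (V \ B)) (polarSum B p) (B.piecewise (fun _ => β) z)) ∧
      ∀ v, aeval (B.piecewise (fun _ => β) z) (MvPolynomial.pderiv v (polarSum B p)) * aeval z p ≤
        aeval z (MvPolynomial.pderiv v p) *
          aeval (B.piecewise (fun _ => β) z) (polarSum B p) := by
  have hzB : B.piecewise (fun _ => b) z = z := by
    ext a
    by_cases ha : a ∈ B <;> simp [ha, hz]
  have hcard : 1 ≤ B.card := hB.card_pos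
  have hc : 0 < aeval z (_root_.iterPderiv B p) := hV B hBV
  set N := lineRestrict B z p with hN
  have hlc : N.coeff B.card = aeval z (_root_.iterPderiv B p) := coeff_card_lineRestrict hp.1 B z
  have hlc' : 0 < N.coeff B.card := hlc ▸ hc
  have hNdeg : N.natDegree = B.card :=
    Polynomial.natDegree_eq_of_le_of_coeff_ne_zero (natDegree_lineRestrict_le hp.1 B z) hlc'.ne'
  have hN0 : N ≠ 0 := by intro h0; rw [h0] at hlc'; simp at hlc'
  have hNstable : ∀ t : ℂ, 0 < t.im → Polynomial.aeval t N ≠ 0 := fun t ht =>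
    hp.aeval_lineRestrict_ne_zero hN0 ht
  have hsplit := splits_of_aeval_ne_zero hNstable
  have hevalb : ∀ q, (lineRestrict B z q).eval b = aeval z q := fun q => by
    rw [eval_lineRestrict, hzB]
  have hNb : 0 < N.eval b := by rw [hN, hevalb]; exact hV.pos
  have hroots : ∀ x, N.IsRoot x → 0 ≤ x ∧ x < b := by
    intro x hx
    rw [Polynomial.IsRoot, hN, eval_lineRestrict] at hx
    constructor
    · by_contra! hneg
      have := hp.neg_pow_mul_pos hneg (hV.iterPderiv Finset.disjoint_sdiff hBV Finset.sdiff_subset)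
        htop
      rw [hx, mul_zero] at this
      exact lt_irrefl _ this
    · by_contra! hge
      have := (hV.piecewise hp.1 (z' := fun _ => x) hBV
        fun v hv => by rw [hz v hv]; exact hge).pos
      exact this.ne' hx
  have hder : N.derivative.eval b ≤ φ * N.eval b := by
    rw [hN, derivative_lineRestrict, Polynomial.eval_finsetSum, hevalb]
    simpa only [hevalb] using hpot
  have hq : ∀ q : MvPolynomial σ ℝ, SepAffine q →
      aeval (B.piecewise (fun _ => β) z) (_root_.polarSum B q) =
      (lineRestrict B z q).coeff (B.card - 1) + B.card * β * (lineRestrict B z q).coeff B.card :=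
    fun q hq => aeval_polarSum hq hB z β
  have hbound : ∀ τ, N.IsRoot τ → N.coeff B.card * (b - τ) ≤
      N.coeff (B.card - 1) + B.card * β * N.coeff B.card := fun τ hτ => by
    rw [hβ]
    exact leadingCoeff_mul_sub_root_le hcard hNdeg hlc' hsplit hroots hφ hder hNb hτ
  have hqpos : 0 < aeval (B.piecewise (fun _ => β) z) (_root_.polarSum B p) := by
    rw [hq p hp.1]
    obtain ⟨τ, hτ⟩ := hsplit.exists_eval_eq_zero
      (by rw [Polynomial.degree_eq_natDegree hN0, hNdeg]; exact_mod_cast (by omega : B.card ≠ 0))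
    exact (mul_pos hlc' (sub_pos.2 (hroots τ hτ).2)).trans_le (hbound τ hτ)
  have hstab := hp.iterPderiv_erase_sum hB hc.ne'
  refine ⟨hstab, fun a ha => ?_, fun v => ?_⟩
  · refine Above.insert_of_pderiv hstab ?_ hqpos
    rw [hp.1.pderiv_polarSum ha]
    intro T hT
    rw [aeval_piecewise_of_pderiv_eq_zero]
    · exact hV.iterPderiv Finset.disjoint_sdiff hBV Finset.sdiff_subset T hT
    · intro b hb
      rw [iterPderiv_comm]
      exact (hp.1.iterPderiv T).iterPderiv_mem hb
  · rw [pderiv_polarSum_comm, hq p hp.1, hq _ (hp.1.pderiv v), ← hevalb p, ← hevalb (pderiv v p)]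
    exact polar_mul_eval_le hcard hNdeg hlc' (natDegree_lineRestrict_le (hp.1.pderiv v) B z)
      hNstable (fun t ht => hp.im_lineRestrict_nonpos B z v ht) hNb (fun τ hτ => (hroots τ hτ).2)
      hbound

end BlockBarrier

section Columns

variable {r n : ℕ}

/-- The cells of the `r × n` grid in column `i`. -/
def column (r : ℕ) {n : ℕ} (i : Fin n) : Finset (Fin r × Fin n) :=
  Finset.univ.filter fun a => a.2 = i

@[simp] theorem mem_column {i : Fin n} {a : Fin r × Fin n} : a ∈ column r i ↔ a.2 = i := by
  simp [column]

theorem card_column (i : Fin n) : (column r i).card = r := by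
  have : column r i =
      Finset.univ.map ⟨fun k : Fin r => (k, i), fun k l h => congrArg Prod.fst h⟩ := by
    ext ⟨k, j⟩
    simp only [mem_column, Finset.mem_map, Finset.mem_univ, true_and]
    exact ⟨fun h => ⟨k, congrArg (Prod.mk k) h.symm⟩, fun ⟨_, h⟩ => (congrArg Prod.snd h).symm⟩
  rw [this, Finset.card_map, Finset.card_univ, Fintype.card_fin]

/-- The cells outside the columns in `U`, together with one cell `(ρ i, i)` in each column
`i ∈ U`. -/
def activeCells (ρ : Fin n → Fin r) (U : Finset (Fin n)) : Finset (Fin r × Fin n) :=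
  Finset.univ.filter fun a => a.2 ∉ U ∨ a.1 = ρ a.2

@[simp] theorem mem_activeCells {ρ : Fin n → Fin r} {U : Finset (Fin n)} {a : Fin r × Fin n} :
    a ∈ activeCells ρ U ↔ a.2 ∉ U ∨ a.1 = ρ a.2 := by
  simp [activeCells]

theorem activeCells_insert (ρ : Fin n → Fin r) {U : Finset (Fin n)} {i : Fin n} (hi : i ∉ U) :
    activeCells ρ (insert i U) = insert (ρ i, i) (activeCells ρ U \ column r i) := by
  ext ⟨k, j⟩
  by_cases hj : j = i
  · subst hj; simp
  · simp [hj]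

theorem activeCells_update (ρ : Fin n → Fin r) (i : Fin n) (k : Fin r) :
    activeCells (Function.update ρ i k) Finset.univ =
      insert (k, i) (activeCells ρ Finset.univ \ column r i) := by
  ext ⟨l, j⟩
  by_cases hj : j = i
  · subst hj; simp
  · simp [hj]

/-- The result of applying the polar sums along the columns in the list `L`. -/
noncomputable def polarSums (L : List (Fin n)) (p : MvPolynomial (Fin r × Fin n) ℝ) :
    MvPolynomial (Fin r × Fin n) ℝ :=
  L.foldr (fun i q => polarSum (column r i) q) p

@[simp] theorem polarSums_nil (p : MvPolynomial (Fin r × Fin n) ℝ) : polarSums [] p = p := rfl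

@[simp] theorem polarSums_cons (i : Fin n) (L : List (Fin n))
    (p : MvPolynomial (Fin r × Fin n) ℝ) :
    polarSums (i :: L) p = polarSum (column r i) (polarSums L p) := rfl

theorem iterPderiv_polarSums (S : Finset (Fin r × Fin n)) (L : List (Fin n))
    (p : MvPolynomial (Fin r × Fin n) ℝ) :
    iterPderiv S (polarSums L p) = polarSums L (iterPderiv S p) := by
  induction L with
  | nil => rfl
  | cons i L ih => rw [polarSums_cons, iterPderiv_polarSum, ih, polarSums_cons]

/-- The point with coordinate `β` in the columns in `U` and coordinate `b` elsewhere. -/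
def barrierPoint (r : ℕ) (b β : ℝ) (U : Finset (Fin n)) : Fin r × Fin n → ℝ :=
  fun a => if a.2 ∈ U then β else b

/-- The invariant of the barrier argument after the columns in `U` have been treated. -/
structure BarrierInvariant (ρ : Fin n → Fin r) (b β φ : ℝ) (U : Finset (Fin n))
    (p : MvPolynomial (Fin r × Fin n) ℝ) : Prop where
  stable : StableAffine p
  above : Above (activeCells ρ U) p (barrierPoint r b β U)
  potential : ∀ i ∉ U, ∑ a ∈ column r i, aeval (barrierPoint r b β U) (pderiv a p) ≤
    φ * aeval (barrierPoint r b β U) p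
  top : ∀ i ∉ U, iterPderiv (activeCells ρ U \ column r i) p =
    ∏ a ∈ column r i, MvPolynomial.X a

theorem BarrierInvariant.step {ρ : Fin n → Fin r} {b β φ : ℝ} {U : Finset (Fin n)}
    {p : MvPolynomial (Fin r × Fin n) ℝ} (h : BarrierInvariant ρ b β φ U p) (hφ : 1 / b < φ)
    (hβ : β = b - (r - 1) ^ 2 / (r * (φ - 1 / b))) {i : Fin n} (hi : i ∉ U) :
    BarrierInvariant ρ b β φ (insert i U) (polarSum (column r i) p) := by
  have hBV : column r i ⊆ activeCells ρ U := fun a ha => by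
    rw [mem_column] at ha
    simp [ha, hi]
  have hρ : (ρ i, i) ∈ column r i := by simp
  have hpt : barrierPoint r b β (insert i U) =
      (column r i).piecewise (fun _ => β) (barrierPoint r b β U) := by
    ext a
    by_cases ha : a.2 = i <;> simp [barrierPoint, ha]
  obtain ⟨h1, h2, h3⟩ := h.stable.barrier_step hBV ⟨_, hρ⟩ (β := β)
    (fun a ha => by rw [mem_column] at ha; simp [barrierPoint, ha, hi]) h.above (h.top i hi)
    (h.potential i hi) hφ (by rwa [card_column])
  rw [← hpt] at h2 h3
  refine ⟨h1, by rw [activeCells_insert ρ hi]; exact h2 _ hρ, fun j hj => ?_, fun j hj => ?_⟩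
  · rw [Finset.mem_insert, not_or] at hj
    have hp := h.above.pos
    have hq := (h2 _ hρ).pos
    refine le_of_mul_le_mul_right ?_ hp
    rw [Finset.sum_mul]
    calc _ ≤ ∑ a ∈ column r j, aeval (barrierPoint r b β U) (pderiv a p) *
          aeval (barrierPoint r b β (insert i U)) (polarSum (column r i) p) :=
        Finset.sum_le_sum fun a _ => h3 a
      _ ≤ (φ * aeval (barrierPoint r b β U) p) *
          aeval (barrierPoint r b β (insert i U)) (polarSum (column r i) p) := by
        rw [← Finset.sum_mul]
        exact mul_le_mul_of_nonneg_right (h.potential j hj.2) hq.le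
      _ = _ := by ring
  · rw [Finset.mem_insert, not_or] at hj
    have e1 : activeCells ρ (insert i U) \ column r j =
        insert (ρ i, i) ((activeCells ρ U \ column r i) \ column r j) := by
      rw [activeCells_insert ρ hi, Finset.insert_sdiff_of_notMem]
      simpa using Ne.symm hj.1
    have e2 : (activeCells ρ U \ column r i) \ column r j ∪ column r i =
        activeCells ρ U \ column r j := by
      ext ⟨k, l⟩
      by_cases hl : l = i
      · subst hl; simp [hi, Ne.symm hj.1]
      · simp [hl]
    rw [e1, iterPderiv_insert' (by simp), h.stable.1.pderiv_polarSum hρ, ← iterPderiv_union, e2,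
      h.top j hj.2]
    rw [Finset.disjoint_left]
    intro a ha ha'
    simp only [Finset.mem_sdiff] at ha
    exact ha.1.2 ha'

protected theorem BarrierInvariant.polarSums {ρ : Fin n → Fin r} {b β φ : ℝ}
    {p : MvPolynomial (Fin r × Fin n) ℝ} (h : BarrierInvariant ρ b β φ ∅ p) (hφ : 1 / b < φ)
    (hβ : β = b - (r - 1) ^ 2 / (r * (φ - 1 / b))) {L : List (Fin n)} (hL : L.Nodup) :
    BarrierInvariant ρ b β φ L.toFinset (polarSums L p) := by
  induction L with
  | nil => simpa
  | cons i L ih =>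
    rw [List.nodup_cons] at hL
    rw [List.toFinset_cons, polarSums_cons]
    exact (ih hL.2).step hφ hβ (by simpa using hL.1)

/-- If a polynomial obtained by polar sums is positive, together with its derivatives, at a point,
then the same holds for one of the mixed derivatives it is composed of. -/
theorem exists_choice_above {z : Fin r × Fin n → ℝ} {L : List (Fin n)} (hL : L.Nodup)
    {p : MvPolynomial (Fin r × Fin n) ℝ} {ρ : Fin n → Fin r}
    (hp : ∀ L', L' <:+ L → StableAffine (polarSums L' p))
    (h : Above (activeCells ρ Finset.univ) (polarSums L p) z) :
    ∃ ρ' : Fin n → Fin r, (∀ i ∉ L, ρ' i = ρ i) ∧ Above (activeCells ρ' Finset.univ)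
      (iterPderiv (Finset.univ.filter fun a => a.2 ∈ L ∧ a.1 ≠ ρ' a.2) p) z := by
  induction L generalizing p ρ with
  | nil => exact ⟨ρ, fun _ _ => rfl, by simpa using h⟩
  | cons i L ih =>
    rw [List.nodup_cons] at hL
    set q := polarSums L p with hq
    have hqs : StableAffine q := hp L (List.suffix_cons i L)
    rw [polarSums_cons, ← hq] at h
    obtain ⟨a, ha, hpos⟩ : ∃ a ∈ column r i, 0 < aeval z (iterPderiv ((column r i).erase a) q) := by
      by_contra! hneg
      have := h.pos
      rw [polarSum, map_sum] at this
      exact this.not_ge (Finset.sum_nonpos hneg)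
    obtain ⟨k, j⟩ := a
    obtain rfl : j = i := by simpa using ha
    have hρ : (ρ j, j) ∈ column r j := by simp
    have habove : Above (activeCells (Function.update ρ j k) Finset.univ)
        (iterPderiv ((column r j).erase (k, j)) q) z := by
      rw [activeCells_update]
      refine Above.insert_of_pderiv (hqs.iterPderiv _) ?_ hpos
      rw [pderiv_iterPderiv_erase ha, ← hqs.1.pderiv_polarSum hρ, ← iterPderiv_singleton]
      exact h.iterPderiv (by simp) (by simp) Finset.sdiff_subset
    rw [hq, iterPderiv_polarSums] at habove
    obtain ⟨ρ', hρ', h'⟩ := ih hL.2 (fun L' hL' => by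
      rw [← iterPderiv_polarSums]
      exact (hp L' (hL'.trans (List.suffix_cons j L))).iterPderiv _) habove
    have hj : ρ' j = k := by rw [hρ' j hL.1, Function.update_self]
    refine ⟨ρ', fun l hl => ?_, ?_⟩
    · rw [List.mem_cons, not_or] at hl
      rw [hρ' l hl.2, Function.update_of_ne hl.1]
    · rw [← iterPderiv_union] at h'
      · convert h' using 2
        ext ⟨l, m⟩
        by_cases hm : m = j
        · subst hm; simp [hL.1, hj]
        · simp [hm]
      · rw [Finset.disjoint_left]
        rintro ⟨l, m⟩ hlm hlm'
        simp only [Finset.mem_filter, Finset.mem_erase, mem_column] at hlm hlm'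
        exact hL.1 (hlm'.2 ▸ hlm.2.1)

end Columns

section GridProduct

variable {r n : ℕ}

/-- The product of copies of the polynomials `g k`, the `k`-th one in the variables `(k, ·)`. -/
noncomputable def gridProd (g : Fin r → MvPolynomial (Fin n) ℝ) :
    MvPolynomial (Fin r × Fin n) ℝ :=
  ∏ k, rename (Prod.mk k) (g k)

theorem aeval_gridProd {R : Type*} [CommRing R] [Algebra ℝ R]
    (g : Fin r → MvPolynomial (Fin n) ℝ) (w : Fin r × Fin n → R) :
    aeval w (gridProd g) = ∏ k, aeval (fun j => w (k, j)) (g k) := by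
  rw [gridProd, map_prod]
  exact Finset.prod_congr rfl fun k _ => aeval_rename _ _ _

theorem pderiv_rename_of_ne {k l : Fin r} (hkl : l ≠ k) (j : Fin n) (g : MvPolynomial (Fin n) ℝ) :
    pderiv (k, j) (rename (Prod.mk l) g) = 0 := by
  refine pderiv_eq_zero_of_notMem_vars fun h => ?_
  obtain ⟨a, -, ha⟩ := Finset.mem_image.1 (MvPolynomial.vars_rename _ _ h)
  exact hkl (congrArg Prod.fst ha)

theorem pderiv_gridProd (k : Fin r) (j : Fin n) (g : Fin r → MvPolynomial (Fin n) ℝ) :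
    pderiv (k, j) (gridProd g) = gridProd (Function.update g k (pderiv j (g k))) := by
  have hzero : ∀ s : Finset (Fin r), k ∉ s →
      pderiv (k, j) (∏ l ∈ s, rename (Prod.mk l) (g l)) = 0 := by
    intro s
    induction s using Finset.induction_on with
    | empty => simp
    | insert l s hl ih =>
      intro hk
      rw [Finset.mem_insert, not_or] at hk
      rw [Finset.prod_insert hl, pderiv_mul, ih hk.2, pderiv_rename_of_ne (Ne.symm hk.1)]
      simp
  rw [gridProd, gridProd, ← Finset.mul_prod_erase _ _ (Finset.mem_univ k),
    ← Finset.mul_prod_erase _ _ (Finset.mem_univ k), pderiv_mul,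
    hzero _ (Finset.notMem_erase k _), mul_zero, add_zero,
    pderiv_rename (Prod.mk_right_injective k), Function.update_self]
  congr 1
  refine Finset.prod_congr rfl fun l hl => ?_
  rw [Function.update_of_ne (Finset.ne_of_mem_erase hl)]

/-- The set of columns in which `S` has a cell in row `k`. -/
def rowSlice (S : Finset (Fin r × Fin n)) (k : Fin r) : Finset (Fin n) :=
  Finset.univ.filter fun j => (k, j) ∈ S

@[simp] theorem mem_rowSlice {S : Finset (Fin r × Fin n)} {k : Fin r} {j : Fin n} :
    j ∈ rowSlice S k ↔ (k, j) ∈ S := by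
  simp [rowSlice]

theorem iterPderiv_gridProd (S : Finset (Fin r × Fin n)) (g : Fin r → MvPolynomial (Fin n) ℝ) :
    iterPderiv S (gridProd g) = gridProd fun k => iterPderiv (rowSlice S k) (g k) := by
  induction S using Finset.induction_on with
  | empty =>
    have : ∀ k, rowSlice (∅ : Finset (Fin r × Fin n)) k = ∅ := fun k => by ext; simp
    simp [this]
  | insert a S ha ih =>
    obtain ⟨k, j⟩ := a
    rw [iterPderiv_insert ha, ih, pderiv_gridProd]
    congr 1
    ext1 l
    by_cases hl : l = k
    · subst hl
      have : rowSlice (insert (l, j) S) l = insert j (rowSlice S l) := by ext; simp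
      rw [Function.update_self, this, iterPderiv_insert (by simpa using ha)]
    · have : rowSlice (insert (k, j) S) l = rowSlice S l := by ext; simp [hl]
      rw [Function.update_of_ne hl, this]

protected theorem SepAffine.gridProd {g : Fin r → MvPolynomial (Fin n) ℝ}
    (hg : ∀ k, SepAffine (g k)) :
    SepAffine (gridProd g) := fun ⟨k, j⟩ => by
  rw [pderiv_gridProd, pderiv_gridProd, Function.update_self, hg k j, _root_.gridProd]
  exact Finset.prod_eq_zero (Finset.mem_univ k) (by rw [Function.update_self, map_zero])

end GridProduct

section Normalized

variable {n : ℕ}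

/-- A separately affine stable polynomial `∑ c_S z^S` whose coefficients satisfy `c_[n] = 1` and
`c_{[n] \ {i}} = 0`, such that its diagonalization has all its roots in `[-Λ, Λ]`. -/
structure NormalizedStable (Λ : ℝ) (g : MvPolynomial (Fin n) ℝ) : Prop where
  sepAffine : SepAffine g
  ne_zero : ∀ w : Fin n → ℂ, (∀ i, 0 < (w i).im) → aeval w g ≠ 0
  top : aeval (fun _ => (0 : ℝ)) (iterPderiv Finset.univ g) = 1
  subtop : ∀ i, aeval (fun _ => (0 : ℝ)) (iterPderiv (Finset.univ.erase i) g) = 0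
  abs_le : ∀ x : ℝ, aeval (fun _ => x) g = 0 → |x| ≤ Λ

namespace NormalizedStable

variable {Λ : ℝ} {g : MvPolynomial (Fin n) ℝ}

theorem stableAffine (h : NormalizedStable Λ g) : StableAffine g :=
  .of_ne_zero h.sepAffine h.ne_zero

theorem iterPderiv_univ_erase (h : NormalizedStable Λ g) (i : Fin n) :
    iterPderiv (Finset.univ.erase i) g = MvPolynomial.X i := by
  set q := iterPderiv (Finset.univ.erase i) g with hq
  have hqa : SepAffine q := h.sepAffine.iterPderiv _
  have h0 : ∀ b ∈ Finset.univ.erase i, pderiv b q = 0 := fun b hb =>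
    h.sepAffine.iterPderiv_mem hb
  have h1 := aeval_piecewise_of_pderiv_eq_zero h0
    (Function.update 0 i (MvPolynomial.X i) : Fin n → MvPolynomial (Fin n) ℝ) MvPolynomial.X
  have h2 : (Finset.univ.erase i).piecewise MvPolynomial.X
      (Function.update 0 i (MvPolynomial.X i) : Fin n → MvPolynomial (Fin n) ℝ) =
      MvPolynomial.X := by
    ext1 j
    by_cases hj : j = i
    · subst hj; simp
    · simp [hj]
  have h3 : ∀ p : MvPolynomial (Fin n) ℝ, aeval (0 : Fin n → MvPolynomial (Fin n) ℝ) p =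
      MvPolynomial.C (aeval (fun _ => (0 : ℝ)) p) := fun p => by
    have := MvPolynomial.aeval_algebraMap_apply (MvPolynomial (Fin n) ℝ)
      (fun _ : Fin n => (0 : ℝ)) p
    rw [← MvPolynomial.algebraMap_eq, ← this]
    congr 2
    ext1
    simp
  rw [h2, MvPolynomial.aeval_X_left_apply, aeval_update (hqa i), h3, h3, h.subtop,
    pderiv_iterPderiv_erase (Finset.mem_univ i), h.top] at h1
  simpa using h1

private theorem coeff_diag (h : NormalizedStable Λ g) (T : Finset (Fin n)) (m : ℕ) :
    (lineRestrict Finset.univ 0 (iterPderiv T g)).coeff m =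
      ∑ S ∈ Finset.univ.powersetCard m,
        aeval (fun _ => (0 : ℝ)) (iterPderiv S (iterPderiv T g)) := by
  rw [coeff_lineRestrict (h.sepAffine.iterPderiv T), Finset.piecewise_univ]

private theorem iterPderiv_eq_zero_of_not_disjoint (h : NormalizedStable Λ g)
    {S T : Finset (Fin n)} (hST : ¬Disjoint S T) : iterPderiv S (iterPderiv T g) = 0 := by
  obtain ⟨a, haS, haT⟩ := Finset.not_disjoint_iff.1 hST
  rw [← Finset.insert_erase haS, iterPderiv_insert' (Finset.notMem_erase a S),
    h.sepAffine.iterPderiv_mem haT, iterPderiv_zero]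

theorem natDegree_diag_le (h : NormalizedStable Λ g) (T : Finset (Fin n)) :
    (lineRestrict Finset.univ 0 (iterPderiv T g)).natDegree ≤ Tᶜ.card := by
  rw [Polynomial.natDegree_le_iff_coeff_eq_zero]
  intro m hm
  rw [h.coeff_diag]
  refine Finset.sum_eq_zero fun S hS => ?_
  rw [h.iterPderiv_eq_zero_of_not_disjoint, map_zero]
  intro hdisj
  have := Finset.card_le_card (Finset.subset_compl_iff_disjoint_right.2 hdisj)
  rw [(Finset.mem_powersetCard.1 hS).2] at this
  omega

theorem coeff_card_diag (h : NormalizedStable Λ g) (T : Finset (Fin n)) :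
    (lineRestrict Finset.univ 0 (iterPderiv T g)).coeff Tᶜ.card = 1 := by
  rw [h.coeff_diag, Finset.sum_eq_single Tᶜ]
  · rw [← iterPderiv_union disjoint_compl_left, Finset.union_comm, Finset.union_compl, h.top]
  · intro S hS hne
    rw [h.iterPderiv_eq_zero_of_not_disjoint, map_zero]
    intro hdisj
    exact hne (Finset.eq_of_subset_of_card_le (Finset.subset_compl_iff_disjoint_right.2 hdisj)
      (Finset.mem_powersetCard.1 hS).2.ge)
  · intro hn
    exact absurd (Finset.mem_powersetCard.2 ⟨Finset.subset_univ _, rfl⟩) hn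

theorem coeff_card_sub_one_diag (h : NormalizedStable Λ g) {T : Finset (Fin n)} {m : ℕ}
    (hm : m + 1 = Tᶜ.card) : (lineRestrict Finset.univ 0 (iterPderiv T g)).coeff m = 0 := by
  rw [h.coeff_diag]
  refine Finset.sum_eq_zero fun S hS => ?_
  by_cases hdisj : Disjoint S T
  · have hSc : (S ∪ T).card + 1 = (Finset.univ : Finset (Fin n)).card := by
      have := Finset.card_add_card_compl T
      rw [Finset.card_union_of_disjoint hdisj, (Finset.mem_powersetCard.1 hS).2, Finset.card_univ]
      omega
    obtain ⟨a, ha, haS⟩ := Finset.exists_eq_insert_iff.2 ⟨Finset.subset_univ (S ∪ T), hSc⟩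
    rw [← iterPderiv_union hdisj, ← Finset.erase_insert ha, haS, h.subtop]
  · rw [h.iterPderiv_eq_zero_of_not_disjoint hdisj, map_zero]

theorem eval_diag (p : MvPolynomial (Fin n) ℝ) (x : ℝ) :
    (lineRestrict Finset.univ 0 p).eval x = aeval (fun _ => x) p := by
  rw [eval_lineRestrict, Finset.piecewise_univ]

theorem monic_diag (h : NormalizedStable Λ g) (T : Finset (Fin n)) :
    (lineRestrict Finset.univ 0 (iterPderiv T g)).Monic :=
  monic_of_natDegree_le_of_coeff_eq_one _ (h.natDegree_diag_le T) (h.coeff_card_diag T)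

theorem natDegree_diag (h : NormalizedStable Λ g) (T : Finset (Fin n)) :
    (lineRestrict Finset.univ 0 (iterPderiv T g)).natDegree = Tᶜ.card :=
  natDegree_eq_of_le_of_coeff_ne_zero (h.natDegree_diag_le T) (by simp [h.coeff_card_diag T])

/-- The logarithmic partial derivative of a mixed derivative of `g` on the diagonal is the Stieltjes
transform of a centred probability measure. -/
theorem exists_eval_eq_mul_sum (h : NormalizedStable Λ g) {T : Finset (Fin n)} {i : Fin n}
    (hi : i ∉ T) : ∃ (R : Finset ℝ) (v : ℝ → ℝ),
      (∀ τ ∈ R, aeval (fun _ => τ) (iterPderiv T g) = 0) ∧ (∀ τ ∈ R, 0 ≤ v τ) ∧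
      ∑ τ ∈ R, v τ = 1 ∧ ∑ τ ∈ R, v τ * τ = 0 ∧
      ∀ x, (∀ τ ∈ R, τ < x) → aeval (fun _ => x) (iterPderiv (insert i T) g) =
        aeval (fun _ => x) (iterPderiv T g) * ∑ τ ∈ R, v τ / (x - τ) := by
  have hS := h.stableAffine.iterPderiv T
  obtain ⟨m, hm⟩ : ∃ m, m + 1 = Tᶜ.card := by
    have : 0 < Tᶜ.card := Finset.card_pos.2 ⟨i, by simpa using hi⟩
    exact ⟨Tᶜ.card - 1, by omega⟩
  have hm' : (insert i T)ᶜ.card = m := by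
    rw [Finset.compl_insert, Finset.card_erase_of_mem (by simpa using hi)]
    omega
  have hA := h.natDegree_diag (insert i T)
  have hA1 := h.coeff_card_diag (insert i T)
  have hA2 := fun k => h.coeff_card_sub_one_diag (T := insert i T) (m := k)
  have hf := h.natDegree_diag T
  have hfm := h.monic_diag T
  have hf2 := h.coeff_card_sub_one_diag hm
  rw [hm'] at hA hA1 hA2
  rw [← hm] at hf
  have hPA := @StableAffine.im_lineRestrict_nonpos _ _ _ hS Finset.univ 0 i
  rw [← iterPderiv_insert hi] at hPA
  have heA := eval_diag (iterPderiv (insert i T) g)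
  have hef := eval_diag (iterPderiv T g)
  have hne := @StableAffine.aeval_lineRestrict_ne_zero _ _ _ _ hS Finset.univ 0 hfm.ne_zero
  set A := lineRestrict Finset.univ 0 (iterPderiv (insert i T) g)
  set f := lineRestrict Finset.univ 0 (iterPderiv T g)
  have hAm : A ≠ 0 := fun h0 => by simp [h0] at hA1
  obtain ⟨R, v, hR, hv, hsum⟩ := exists_partialFractions hfm.ne_zero (fun t ht => hne ht)
    (Polynomial.degree_lt_degree (by omega)) (fun t ht => hPA ht)
  have hq : ∀ τ ∈ R, (Polynomial.X - Polynomial.C τ) * (f /ₘ (Polynomial.X - Polynomial.C τ)) = f :=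
    fun τ hτ => mul_divByMonic_eq_iff_isRoot.2 (hR τ hτ)
  have hqm : ∀ τ ∈ R, (f /ₘ (Polynomial.X - Polynomial.C τ)).coeff m = 1 := fun τ hτ => by
    have h1 : (f /ₘ (Polynomial.X - Polynomial.C τ)).Monic :=
      (monic_X_sub_C τ).of_mul_monic_left (by rw [hq τ hτ]; exact hfm)
    have h2 : (f /ₘ (Polynomial.X - Polynomial.C τ)).natDegree = m := by
      rw [natDegree_divByMonic _ (monic_X_sub_C τ), natDegree_X_sub_C, hf]
      omega
    rw [← h2]
    exact h1
  have hqX : ∀ τ ∈ R, (Polynomial.X * (f /ₘ (Polynomial.X - Polynomial.C τ))).coeff m = τ :=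
    fun τ hτ => by
      have h1 := congrArg (fun p => Polynomial.coeff p m) (hq τ hτ)
      simp only [sub_mul, Polynomial.coeff_sub, Polynomial.coeff_C_mul, hqm τ hτ, hf2] at h1
      linarith
  refine ⟨R, v, fun τ hτ => ?_, hv, ?_, ?_, fun x hx => ?_⟩
  · rw [← hef]
    exact hR τ hτ
  · rw [← hA1, hsum, finsetSum_coeff]
    exact Finset.sum_congr rfl fun τ hτ => by rw [Polynomial.coeff_C_mul, hqm τ hτ, mul_one]
  · have h1 : (Polynomial.X * A).coeff m = 0 := by
      cases m with
      | zero => simp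
      | succ k => rw [Polynomial.coeff_X_mul, hA2 k rfl]
    rw [← h1, hsum, Finset.mul_sum, finsetSum_coeff]
    refine Finset.sum_congr rfl fun τ hτ => ?_
    rw [mul_left_comm, Polynomial.coeff_C_mul, hqX τ hτ]
  · rw [← heA, ← hef, hsum, eval_finsetSum, Finset.mul_sum]
    refine Finset.sum_congr rfl fun τ hτ => ?_
    have h1 := congrArg (Polynomial.eval x) (hq τ hτ)
    simp only [Polynomial.eval_mul, Polynomial.eval_sub, Polynomial.eval_X,
      Polynomial.eval_C] at h1 ⊢
    have h2 : x - τ ≠ 0 := (sub_pos.2 (hx τ hτ)).ne'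
    rw [← h1]
    field_simp

theorem aeval_pos (h : NormalizedStable Λ g) (T : Finset (Fin n)) {x : ℝ} (hx : Λ < x) :
    0 < aeval (fun _ => x) (iterPderiv T g) := by
  induction T using Finset.induction_on generalizing x with
  | empty =>
    have hm := h.monic_diag ∅
    have he := eval_diag (iterPderiv ∅ g)
    have hs := splits_of_aeval_ne_zero fun t =>
      @StableAffine.aeval_lineRestrict_ne_zero _ _ _ _ (h.stableAffine.iterPderiv ∅) Finset.univ 0
        hm.ne_zero t
    rw [← he, hs.eval_eq_prod_roots_of_monic hm]
    refine Multiset.prod_pos fun y hy => ?_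
    obtain ⟨a, ha, rfl⟩ := Multiset.mem_map.1 hy
    have ha := (Polynomial.mem_roots'.1 ha).2
    rw [IsRoot.def, he, iterPderiv_empty] at ha
    have := (le_abs_self a).trans (h.abs_le a ha)
    linarith
  | insert i T hi ih =>
    obtain ⟨R, v, hR, hv, hv1, -, hx'⟩ := h.exists_eval_eq_mul_sum hi
    have hlt : ∀ τ ∈ R, τ < x := fun τ hτ => by
      by_contra! hle
      exact (ih (hx.trans_le hle)).ne' (hR τ hτ)
    rw [hx' x hlt]
    refine mul_pos (ih hx) ?_
    obtain ⟨τ, hτ, hpos⟩ := Finset.exists_lt_of_sum_lt (s := R) (f := fun _ => (0 : ℝ)) (g := v)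
      (by simp [hv1])
    exact Finset.sum_pos' (fun τ hτ => div_nonneg (hv τ hτ) (sub_pos.2 (hlt τ hτ)).le)
      ⟨τ, hτ, div_pos hpos (sub_pos.2 (hlt τ hτ))⟩

theorem aeval_pderiv_le (h : NormalizedStable Λ g) (i : Fin n) {b : ℝ} (hΛ : 0 ≤ Λ) (hb : Λ < b) :
    aeval (fun _ => b) (pderiv i g) ≤ b / (b ^ 2 - Λ ^ 2) * aeval (fun _ => b) g := by
  obtain ⟨R, v, hR, hv, hv1, hv2, hx'⟩ := h.exists_eval_eq_mul_sum (Finset.notMem_empty i)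
  have hlt : ∀ τ ∈ R, |τ| ≤ Λ := fun τ hτ => h.abs_le τ (by simpa using hR τ hτ)
  have hx := hx' b fun τ hτ => ((le_abs_self τ).trans (hlt τ hτ)).trans_lt hb
  have hpos := h.aeval_pos ∅ hb
  rw [insert_empty_eq, iterPderiv_singleton] at hx
  rw [iterPderiv_empty] at hx hpos
  have hd : 0 < b ^ 2 - Λ ^ 2 := by nlinarith
  rw [hx, mul_comm]
  refine mul_le_mul_of_nonneg_right ?_ hpos.le
  calc ∑ τ ∈ R, v τ / (b - τ) ≤ ∑ τ ∈ R, v τ * ((b + τ) / (b ^ 2 - Λ ^ 2)) := by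
        refine Finset.sum_le_sum fun τ hτ => ?_
        rw [div_eq_mul_inv]
        refine mul_le_mul_of_nonneg_left ?_ (hv τ hτ)
        have h1 := _root_.abs_le.1 (hlt τ hτ)
        have h2 : 0 < b - τ := by linarith
        rw [inv_eq_one_div, div_le_div_iff₀ h2 hd]
        nlinarith
    _ = (∑ τ ∈ R, v τ) * (b / (b ^ 2 - Λ ^ 2)) + (∑ τ ∈ R, v τ * τ) / (b ^ 2 - Λ ^ 2) := by
        rw [Finset.sum_mul, Finset.sum_div, ← Finset.sum_add_distrib]
        exact Finset.sum_congr rfl fun τ _ => by ring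
    _ = b / (b ^ 2 - Λ ^ 2) := by rw [hv1, hv2]; ring

theorem barrierInvariant (h : NormalizedStable Λ g) {r : ℕ} (ρ : Fin n → Fin r) (β : ℝ) {b : ℝ}
    (hΛ : 0 ≤ Λ) (hb : Λ < b) :
    BarrierInvariant ρ b β (r * (b / (b ^ 2 - Λ ^ 2))) ∅ (gridProd fun _ => g) := by
  have hpt : barrierPoint r b β (∅ : Finset (Fin n)) = fun _ => b := by
    ext a
    simp [barrierPoint]
  have hpos := h.aeval_pos ∅ hb
  rw [iterPderiv_empty] at hpos
  refine ⟨.of_ne_zero (.gridProd fun _ => h.sepAffine) fun w hw => ?_, fun T _ => ?_, fun i _ => ?_,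
    fun i _ => ?_⟩
  · rw [aeval_gridProd]
    exact Finset.prod_ne_zero_iff.2 fun k _ => h.ne_zero _ fun j => hw _
  · rw [hpt, iterPderiv_gridProd, aeval_gridProd]
    exact Finset.prod_pos fun k _ => h.aeval_pos _ hb
  · have hle : ∀ a ∈ column r i, aeval (fun _ => b) (pderiv a (gridProd fun _ => g)) ≤
        b / (b ^ 2 - Λ ^ 2) * aeval (fun _ => b) (gridProd fun _ : Fin r => g) := by
      rintro ⟨k, j⟩ -
      rw [pderiv_gridProd, aeval_gridProd, aeval_gridProd,
        ← Finset.mul_prod_erase _ _ (Finset.mem_univ k),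
        ← Finset.mul_prod_erase _ _ (Finset.mem_univ k), Function.update_self, ← mul_assoc,
        Finset.prod_congr rfl fun l hl => by
          rw [Function.update_of_ne (Finset.ne_of_mem_erase hl)]]
      exact mul_le_mul_of_nonneg_right (h.aeval_pderiv_le j hΛ hb)
        (Finset.prod_nonneg fun _ _ => hpos.le)
    rw [hpt]
    refine (Finset.sum_le_sum hle).trans_eq ?_
    rw [Finset.sum_const, card_column, nsmul_eq_mul, mul_assoc]
  · have hslice : ∀ k, rowSlice (activeCells ρ ∅ \ column r i) k = Finset.univ.erase i :=
      fun k => by ext; simp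
    have hcol : column r i = Finset.univ.image fun k : Fin r => (k, i) := by
      ext ⟨k, j⟩
      simp [eq_comm]
    rw [iterPderiv_gridProd]
    simp only [hslice, h.iterPderiv_univ_erase, gridProd, rename_X]
    rw [hcol, Finset.prod_image fun k _ l _ hkl => congrArg Prod.fst hkl]

/-- One-sided paving: the index set can be divided into `r` classes such that the restriction of
`g` to any subset of a class has no zero on the diagonal at or above `β`. -/
theorem exists_paving_above (h : NormalizedStable Λ g) {r : ℕ} (hr : 0 < r) {b β : ℝ} (hΛ : 0 ≤ Λ)
    (hb : Λ < b) (hφ : 1 / b < r * (b / (b ^ 2 - Λ ^ 2)))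
    (hβ : β = b - (r - 1) ^ 2 / (r * (r * (b / (b ^ 2 - Λ ^ 2)) - 1 / b))) :
    ∃ s : Fin n → Fin r, ∀ k, ∀ R : Finset (Fin n), (∀ j ∈ R, s j = k) → ∀ x, β ≤ x →
      aeval (fun _ => x) (iterPderiv Rᶜ g) ≠ 0 := by
  have hinv := h.barrierInvariant (fun _ => (⟨0, hr⟩ : Fin r)) β hΛ hb
  have hL := Finset.nodup_toList (Finset.univ : Finset (Fin n))
  have habove := (hinv.polarSums hφ hβ hL).above
  rw [Finset.toList_toFinset] at habove
  obtain ⟨s, -, hs⟩ := exists_choice_above hL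
    (fun L' hL' => (hinv.polarSums hφ hβ (hL.sublist hL'.sublist)).stable) habove
  refine ⟨s, fun k R hR x hx => ?_⟩
  set W := Finset.univ.filter fun a : Fin r × Fin n =>
    a.2 ∈ (Finset.univ : Finset (Fin n)).toList ∧ a.1 ≠ s a.2 with hW
  set P := Finset.univ.filter fun a : Fin r × Fin n => a.1 = k ∧ a.2 ∈ R with hP
  set T := Finset.univ.filter fun a : Fin r × Fin n => a.1 = k ∧ s a.2 = k ∧ a.2 ∉ R with hT
  have hPV : P ⊆ activeCells s Finset.univ := by
    rintro ⟨l, j⟩ ha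
    simp only [hP, Finset.mem_filter, Finset.mem_univ, true_and] at ha
    simp [ha.1, hR j ha.2]
  have hTV : T ⊆ activeCells s Finset.univ := by
    rintro ⟨l, j⟩ ha
    simp only [hT, Finset.mem_filter, Finset.mem_univ, true_and] at ha
    simp [ha.1, ha.2.1]
  have hTW : Disjoint T W := by
    rw [Finset.disjoint_left]
    rintro ⟨l, j⟩ ha ha'
    simp only [hT, hW, Finset.mem_filter, Finset.mem_univ, true_and] at ha ha'
    exact ha'.2 (ha.1.trans ha.2.1.symm)
  have hpos := (hs.piecewise ((SepAffine.gridProd fun _ => h.sepAffine).iterPderiv W) hPV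
    (z' := fun _ => x) fun a _ => by simpa [barrierPoint] using hx) T hTV
  rw [← iterPderiv_union hTW, iterPderiv_gridProd, aeval_gridProd] at hpos
  have hk := Finset.prod_ne_zero_iff.1 hpos.ne' k (Finset.mem_univ k)
  have hslice : rowSlice (T ∪ W) k = Rᶜ := by
    ext j
    simp only [mem_rowSlice, hT, hW, Finset.mem_union, Finset.mem_filter, Finset.mem_univ, true_and,
      Finset.mem_toList, Finset.mem_compl]
    constructor
    · rintro (hj | hj) hjR
      · exact hj.2 hjR
      · exact hj (hR j hjR).symm
    · intro hj
      by_cases hjk : s j = k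
      · exact Or.inl ⟨hjk, hj⟩
      · exact Or.inr (Ne.symm hjk)
  have hpt : (fun j => P.piecewise (fun _ => x) (barrierPoint r b β Finset.univ) (k, j)) =
      Rᶜ.piecewise (fun _ => β) fun _ => x := by
    ext j
    by_cases hj : j ∈ R <;> simp [hP, hj, barrierPoint]
  rwa [hslice, hpt, aeval_piecewise_of_pderiv_eq_zero
    fun b hb => h.sepAffine.iterPderiv_mem hb] at hk

end NormalizedStable

end Normalized

section Reflection

variable {n : ℕ}

/-- The polynomial `(-1) ^ n * g (-z)`. -/
noncomputable def reflection (g : MvPolynomial (Fin n) ℝ) : MvPolynomial (Fin n) ℝ :=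
  MvPolynomial.C ((-1) ^ n) *
    MvPolynomial.aeval (fun i => -(MvPolynomial.X i : MvPolynomial (Fin n) ℝ)) g

theorem pderiv_aeval_neg_X (i : Fin n) (g : MvPolynomial (Fin n) ℝ) :
    pderiv i (MvPolynomial.aeval (fun j => -(MvPolynomial.X j : MvPolynomial (Fin n) ℝ)) g) =
      -MvPolynomial.aeval (fun j => -(MvPolynomial.X j : MvPolynomial (Fin n) ℝ)) (pderiv i g) := by
  induction g using MvPolynomial.induction_on with
  | C r => simp
  | add p q hp hq => simp only [map_add, hp, hq, neg_add]
  | mul_X p j hp =>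
    rw [map_mul, pderiv_mul, hp, pderiv_mul, map_add, map_mul, map_mul,
      MvPolynomial.aeval_X, map_neg]
    by_cases hj : j = i
    · subst hj; simp; ring
    · simp [pderiv_X_of_ne hj]

theorem iterPderiv_reflection (S : Finset (Fin n)) (g : MvPolynomial (Fin n) ℝ) :
    iterPderiv S (reflection g) = MvPolynomial.C ((-1) ^ (n + S.card)) *
      MvPolynomial.aeval (fun i => -(MvPolynomial.X i : MvPolynomial (Fin n) ℝ))
        (iterPderiv S g) := by
  induction S using Finset.induction_on with
  | empty => simp [reflection]
  | insert i S hi ih =>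
    rw [iterPderiv_insert hi, ih, pderiv_C_mul, pderiv_aeval_neg_X, iterPderiv_insert hi,
      Finset.card_insert_of_notMem hi, ← add_assoc, pow_succ, map_mul]
    simp

theorem aeval_iterPderiv_reflection {R : Type*} [CommRing R] [Algebra ℝ R] (S : Finset (Fin n))
    (g : MvPolynomial (Fin n) ℝ) (w : Fin n → R) : aeval w (iterPderiv S (reflection g)) =
      (-1) ^ (n + S.card) * aeval (fun i => -w i) (iterPderiv S g) := by
  rw [iterPderiv_reflection, map_mul, comp_aeval_apply]
  simp

namespace NormalizedStable

variable {Λ : ℝ} {g : MvPolynomial (Fin n) ℝ}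

protected theorem reflection (h : NormalizedStable Λ g) : NormalizedStable Λ (reflection g) := by
  have hw : ∀ (w : Fin n → ℂ), aeval w (_root_.reflection g) =
      (-1) ^ n * aeval (fun i => -w i) g := fun w => by
    simpa using aeval_iterPderiv_reflection ∅ g w
  have hx : ∀ x : ℝ, aeval (fun _ => x) (_root_.reflection g) =
      (-1) ^ n * aeval (fun _ => -x) g := fun x => by
    simpa using aeval_iterPderiv_reflection ∅ g fun _ => x
  refine ⟨fun i => ?_, fun w hw' => ?_, ?_, fun i => ?_, fun x h0 => ?_⟩
  · rw [_root_.reflection, pderiv_C_mul, pderiv_aeval_neg_X, pderiv_C_mul, map_neg,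
      pderiv_aeval_neg_X, h.sepAffine i]
    simp
  · rw [hw]
    refine mul_ne_zero (by simp) fun h0 => h.ne_zero (fun i => (starRingEnd ℂ) (-w i))
      (fun i => by simpa using hw' i) ?_
    rw [← map_zero (starRingEnd ℂ), ← h0, MvPolynomial.aeval_def, MvPolynomial.aeval_def,
      MvPolynomial.hom_eval₂]
    congr 1
    ext x
    simp
  · rw [aeval_iterPderiv_reflection]
    simp [h.top, ← two_mul]
  · rw [aeval_iterPderiv_reflection]
    simp [h.subtop]
  · rw [hx] at h0
    simpa using h.abs_le (-x) (by simpa using h0)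

/-- Two-sided paving. -/
theorem exists_paving (h : NormalizedStable Λ g) {r : ℕ} (hr : 0 < r) {b β : ℝ} (hΛ : 0 ≤ Λ)
    (hb : Λ < b) (hφ : 1 / b < r * (b / (b ^ 2 - Λ ^ 2)))
    (hβ : β = b - (r - 1) ^ 2 / (r * (r * (b / (b ^ 2 - Λ ^ 2)) - 1 / b))) :
    ∃ S : Fin (r ^ 2) → Finset (Fin n), (∀ i j, i ≠ j → Disjoint (S i) (S j)) ∧
      (∀ k, ∃ i, k ∈ S i) ∧
      ∀ i, ∀ x : ℝ, aeval (fun _ => x) (iterPderiv (S i)ᶜ g) = 0 → |x| ≤ β := by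
  obtain ⟨s, hs⟩ := h.exists_paving_above hr hΛ hb hφ hβ
  obtain ⟨t, ht⟩ := h.reflection.exists_paving_above hr hΛ hb hφ hβ
  let e : Fin (r ^ 2) ≃ Fin r × Fin r := (finCongr (pow_two r)).trans finProdFinEquiv.symm
  refine ⟨fun i => Finset.univ.filter fun j => (s j, t j) = e i, fun i j hij => ?_,
    fun k => ⟨e.symm (s k, t k), by simp⟩, fun i x hx => ?_⟩
  · rw [Finset.disjoint_left]
    intro k hk hk'
    simp only [Finset.mem_filter, Finset.mem_univ, true_and] at hk hk'
    exact hij (e.injective (hk.symm.trans hk'))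
  · set R := Finset.univ.filter fun j => (s j, t j) = e i
    refine _root_.abs_le.2 ⟨?_, ?_⟩
    · by_contra! hlt
      refine ht (e i).2 R (fun j hj => ?_) (-x) (by linarith) ?_
      · exact congrArg Prod.snd (Finset.mem_filter.1 hj).2
      · rw [aeval_iterPderiv_reflection]
        simp only [neg_neg]
        exact mul_eq_zero_of_right _ hx
    · by_contra! hlt
      exact hs (e i).1 R (fun j hj => congrArg Prod.fst (Finset.mem_filter.1 hj).2) x hlt.le hx

end NormalizedStable

end Reflection

section Coefficients

variable {n : ℕ}

theorem MultiAffine.sepAffine {g : MvPolynomial (Fin n) ℝ} (hg : MultiAffine g) :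
    SepAffine g := fun i => by
  ext m
  rw [coeff_pderiv, coeff_pderiv, MvPolynomial.coeff_zero, MvPolynomial.notMem_support_iff.1,
    zero_mul, zero_mul]
  intro hm
  have := (monomial_le_degreeOf i hm).trans (hg i)
  simp at this

theorem coeff_iterPderiv (S : Finset (Fin n)) (g : MvPolynomial (Fin n) ℝ) {m : Fin n →₀ ℕ}
    (hm : ∀ i ∈ S, m i = 0) :
    MvPolynomial.coeff m (iterPderiv S g) = MvPolynomial.coeff (m + expOf S) g := by
  induction S using Finset.induction_on generalizing m with
  | empty => simp [expOf]
  | insert i S hi ih =>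
    rw [iterPderiv_insert hi, coeff_pderiv, ih, hm i (Finset.mem_insert_self i S), expOf, expOf,
      Finset.sum_insert hi, add_assoc]
    · simp
    · intro j hj
      have hij : i ≠ j := fun h => hi (h ▸ hj)
      simp [hm j (Finset.mem_insert_of_mem hj), hij]

theorem aeval_zero_iterPderiv (S : Finset (Fin n)) (g : MvPolynomial (Fin n) ℝ) :
    aeval (fun _ => (0 : ℝ)) (iterPderiv S g) = MvPolynomial.coeff (expOf S) g := by
  rw [← zero_add (expOf S), ← coeff_iterPderiv S g (fun _ _ => rfl), ← constantCoeff_eq]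
  exact aeval_zero' _

theorem isRoot_diagPoly_iff {p : MvPolynomial (Fin n) ℝ} {x : ℝ} :
    (diagPoly p).IsRoot x ↔ aeval (fun _ => x) p = 0 := by
  rw [IsRoot.def, diagPoly, ← Polynomial.coe_aeval_eq_eval, comp_aeval_apply]
  simp

end Coefficients

theorem paving_bound {r Λ b : ℝ} (hr : 4 ≤ r) (hΛ : 0 < Λ) (hb : b = Real.sqrt (r - 1) * Λ) :
    Λ < b ∧ 1 / b < r * (b / (b ^ 2 - Λ ^ 2)) ∧
    b - (r - 1) ^ 2 / (r * (r * (b / (b ^ 2 - Λ ^ 2)) - 1 / b)) ≤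
      ((r - 2) / (r * (r - 1)) + 2 * Real.sqrt ((r - 2) / (r * (r - 1)))) * Λ := by
  have hq : 0 < Real.sqrt (r - 1) := Real.sqrt_pos.2 (by linarith)
  have hq2 : Real.sqrt (r - 1) ^ 2 = r - 1 := Real.sq_sqrt (by linarith)
  set q := Real.sqrt (r - 1)
  have hq1 : 1 < q := by nlinarith
  have hbpos : 0 < b := by rw [hb]; positivity
  have hden : b ^ 2 - Λ ^ 2 = (r - 2) * Λ ^ 2 := by rw [hb, mul_pow, hq2]; ring
  have hφ : r * (b / (b ^ 2 - Λ ^ 2)) = r * q / ((r - 2) * Λ) := by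
    have : r - 2 ≠ 0 := by linarith
    rw [hden, hb]
    field_simp
  have hdiff : r * q / ((r - 2) * Λ) - 1 / b = (r ^ 2 - 2 * r + 2) / ((r - 2) * q * Λ) := by
    have : r - 2 ≠ 0 := by linarith
    rw [hb]
    field_simp
    rw [hq2]
    ring
  have hr2 : 0 < r - 2 := by linarith
  have hr1 : 0 < r - 1 := by linarith
  have hr0 : 0 < r := by linarith
  have hp : 0 < r ^ 2 - 2 * r + 2 := by nlinarith
  refine ⟨by rw [hb]; nlinarith, ?_, ?_⟩
  · rw [← sub_pos, hφ, hdiff]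
    positivity
  · have hval : b - (r - 1) ^ 2 / (r * (r * (b / (b ^ 2 - Λ ^ 2)) - 1 / b)) =
        q * (2 * r ^ 2 - 3 * r + 2) / (r * (r ^ 2 - 2 * r + 2)) * Λ := by
      rw [hφ, hdiff, hb]
      field_simp
      ring
    rw [hval]
    refine mul_le_mul_of_nonneg_right ?_ hΛ.le
    set c := (r - 2) / (r * (r - 1)) with hc
    have hcpos : 0 < c := by positivity
    have hs2 : Real.sqrt c ^ 2 = c := Real.sq_sqrt hcpos.le
    have hs : 3 / (2 * r) ≤ Real.sqrt c := by
      refine Real.le_sqrt_of_sq_le ?_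
      rw [hc, div_pow, div_le_div_iff₀ (by positivity) (by positivity)]
      nlinarith [mul_nonneg (mul_nonneg hr0.le hr0.le) (sub_nonneg.2 hr),
        mul_nonneg hr0.le (sub_nonneg.2 hr)]
    have hsq : c ^ 2 + 4 * c + 6 * c / r ≤ (c + 2 * Real.sqrt c) ^ 2 := by
      have h1 : (c + 2 * Real.sqrt c) ^ 2 = c ^ 2 + 4 * c + 4 * c * Real.sqrt c := by
        linear_combination 4 * hs2
      have h2 := mul_le_mul_of_nonneg_left hs (by positivity : 0 ≤ 4 * c)
      have h3 : 4 * c * (3 / (2 * r)) = 6 * c / r := by field_simp; ring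
      linarith
    refine le_of_sq_le_sq ?_ (by positivity)
    refine le_trans ?_ hsq
    have hL : (q * (2 * r ^ 2 - 3 * r + 2) / (r * (r ^ 2 - 2 * r + 2))) ^ 2 =
        (r - 1) * (2 * r ^ 2 - 3 * r + 2) ^ 2 / (r * (r ^ 2 - 2 * r + 2)) ^ 2 := by
      rw [div_pow, mul_pow q, hq2]
    have hR : c ^ 2 + 4 * c + 6 * c / r =
        ((r - 2) ^ 2 + 4 * (r - 2) * r * (r - 1) + 6 * (r - 2) * (r - 1)) / (r * (r - 1)) ^ 2 := by
      rw [hc]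
      field_simp
    rw [hL, hR, div_le_div_iff₀ (by positivity) (by positivity), mul_pow, mul_pow]
    suffices h : (r - 1) ^ 3 * (2 * r ^ 2 - 3 * r + 2) ^ 2 ≤
        ((r - 2) ^ 2 + 4 * (r - 2) * r * (r - 1) + 6 * (r - 2) * (r - 1)) *
          (r ^ 2 - 2 * r + 2) ^ 2 by
      linear_combination r ^ 2 * h
    obtain ⟨s, rfl⟩ : ∃ s, r = s + 4 := ⟨r - 4, by ring⟩
    have hs0 : 0 ≤ s := by linarith
    rw [← sub_nonneg]
    ring_nf
    positivity

theorem isRoot_diagPoly_pderivs_iff {n : ℕ} {S : Finset (Fin n)} {g : MvPolynomial (Fin n) ℝ}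
    {x : ℝ} : (diagPoly (pderivs S g)).IsRoot x ↔ aeval (fun _ => x) (iterPderiv S g) = 0 :=
  isRoot_diagPoly_iff

theorem stmt6 (r : ℕ) (hr : 4 ≤ r) (Λ : ℝ) (hΛ : 0 < Λ)
    (n : ℕ) (g : MvPolynomial (Fin n) ℝ)
    (hstable : RealStable g) (hma : MultiAffine g)
    (hroots : ∀ x : ℝ, (diagPoly g).IsRoot x → x ∈ Set.Icc (-Λ) Λ)
    (ha0 : MvPolynomial.coeff (expOf (Finset.univ : Finset (Fin n))) g = 1)
    (hai : ∀ i : Fin n, MvPolynomial.coeff (expOf ({i} : Finset (Fin n))ᶜ) g = 0) :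
    ∃ S : Fin (r ^ 2) → Finset (Fin n),
      (∀ i j, i ≠ j → Disjoint (S i) (S j)) ∧ (∀ k, ∃ i, k ∈ S i) ∧
      ∀ i, ∀ x : ℝ, (diagPoly (pderivs (S i)ᶜ g)).IsRoot x →
        |x| ≤ (((r : ℝ) - 2) / ((r : ℝ) * ((r : ℝ) - 1)) +
          2 * Real.sqrt (((r : ℝ) - 2) / ((r : ℝ) * ((r : ℝ) - 1)))) * Λ := by
  have h : NormalizedStable Λ g := by
    refine ⟨hma.sepAffine, fun w hw => ?_, ?_, fun i => ?_, fun x hx => ?_⟩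
    · have := hstable w hw
      rwa [MvPolynomial.eval_map, ← MvPolynomial.aeval_def] at this
    · rw [aeval_zero_iterPderiv, ha0]
    · rw [aeval_zero_iterPderiv, ← Finset.compl_singleton, hai]
    · exact abs_le.2 (hroots x (isRoot_diagPoly_iff.2 hx))
  obtain ⟨hb, hφ, hβ⟩ := paving_bound (r := r) (by exact_mod_cast hr) hΛ rfl
  obtain ⟨S, hdisj, hcover, hS⟩ := h.exists_paving (by omega) hΛ.le hb hφ rfl
  exact ⟨S, hdisj, hcover, fun i x hx => (hS i x (isRoot_diagPoly_pderivs_iff.1 hx)).trans hβ⟩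
end

section
/- Let p ∈ ℝ[z_1,…,z_n] be real stable, let u be above the roots of p, and let v ∈ ℝ^n have non-negative coordinates. If p(u − tv) ≠ 0 for all t ∈ [0,1], then u − v is above the roots of p. -/
open MvPolynomial Polynomial

/-- `u` is above the roots of `p`: `p(w) ≠ 0` for every `w ≥ u` coordinatewise. -/
def AboveRoots {n : ℕ} (p : MvPolynomial (Fin n) ℝ) (u : Fin n → ℝ) : Prop :=
  ∀ w : Fin n → ℝ, (∀ i, u i ≤ w i) → MvPolynomial.eval w p ≠ 0

/-- The modulus of a complex polynomial whose roots are all real and nonpositive is minimized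
over the nonnegative reals at `0`. -/
lemma norm_eval_zero_le_of_roots_nonpos (Q : Polynomial ℂ)
    (hQ : ∀ z ∈ Q.roots, z.im = 0 ∧ z.re ≤ 0) {s : ℝ} (hs : 0 ≤ s) :
    ‖Q.eval 0‖ ≤ ‖Q.eval (s : ℂ)‖ := by
  have key : ∀ m : Multiset ℂ, (∀ z ∈ m, z.im = 0 ∧ z.re ≤ 0) →
      ‖((m.map fun a => Polynomial.X - Polynomial.C a).prod).eval 0‖ ≤
        ‖((m.map fun a => Polynomial.X - Polynomial.C a).prod).eval (s : ℂ)‖ := by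
    intro m
    induction m using Multiset.induction_on with
    | empty => simp
    | cons a m ih =>
      intro hm
      have h1 := ih fun z hz => hm z (Multiset.mem_cons_of_mem hz)
      obtain ⟨him, hre⟩ := hm a (Multiset.mem_cons_self a m)
      have ha : a = (a.re : ℂ) := Complex.ext rfl (by simpa using him)
      simp only [Multiset.map_cons, Multiset.prod_cons, Polynomial.eval_mul, norm_mul,
        Polynomial.eval_sub, Polynomial.eval_X, Polynomial.eval_C]
      refine mul_le_mul ?_ h1 (norm_nonneg _) (norm_nonneg _)
      rw [ha, ← Complex.ofReal_zero, ← Complex.ofReal_sub, ← Complex.ofReal_sub,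
        Complex.norm_real, Complex.norm_real, Real.norm_eq_abs, Real.norm_eq_abs,
        abs_of_nonneg (by linarith), abs_of_nonneg (by linarith)]
      linarith
  have hsplit := (IsAlgClosed.splits Q).eq_prod_roots
  rw [hsplit, Polynomial.eval_mul, Polynomial.eval_mul, norm_mul, norm_mul,
    Polynomial.eval_C, Polynomial.eval_C]
  exact mul_le_mul_of_nonneg_left (key _ hQ) (norm_nonneg _)

lemma RealStable.aeval_ne_zero_of_im_pos {n : ℕ} {p : MvPolynomial (Fin n) ℝ}
    (hp : RealStable p) (z : Fin n → ℂ) (hz : ∀ i, 0 < (z i).im) :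
    MvPolynomial.aeval z p ≠ 0 := by
  have := hp z hz
  rwa [MvPolynomial.eval_map, ← MvPolynomial.aeval_def] at this

lemma RealStable.aeval_ne_zero_of_im_neg {n : ℕ} {p : MvPolynomial (Fin n) ℝ}
    (hp : RealStable p) (z : Fin n → ℂ) (hz : ∀ i, (z i).im < 0) :
    MvPolynomial.aeval z p ≠ 0 := by
  intro h0
  refine hp.aeval_ne_zero_of_im_pos (fun i => Complex.conjAe (z i)) (fun i => by
    simpa using hz i) ?_
  have := MvPolynomial.comp_aeval_apply (f := z) (Complex.conjAe : ℂ →ₐ[ℝ] ℂ) p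
  rw [h0, map_zero] at this
  exact this.symm

lemma MvPolynomial.aeval_ofReal {n : ℕ} (p : MvPolynomial (Fin n) ℝ) (x : Fin n → ℝ) :
    MvPolynomial.aeval (fun i => (x i : ℂ)) p = ((MvPolynomial.eval x p : ℝ) : ℂ) := by
  have := MvPolynomial.aeval_algebraMap_apply ℂ x p
  rw [MvPolynomial.aeval_eq_eval] at this
  exact this

lemma exists_polynomial_eval_eq_aeval_line {n : ℕ} (p : MvPolynomial (Fin n) ℝ)
    (a d : Fin n → ℝ) : ∃ Q : Polynomial ℂ, ∀ z : ℂ,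
      Q.eval z = MvPolynomial.aeval (fun i => (a i : ℂ) + z * (d i : ℂ)) p := by
  refine ⟨MvPolynomial.eval₂ (Polynomial.C.comp (algebraMap ℝ ℂ))
    (fun i => Polynomial.C (a i : ℂ) + Polynomial.X * Polynomial.C (d i : ℂ)) p, fun z => ?_⟩
  rw [← Polynomial.coe_evalRingHom, MvPolynomial.hom_eval₂, MvPolynomial.aeval_def]
  congr 1
  · ext r
    simp
  · funext i
    simp only [Polynomial.coe_evalRingHom, Polynomial.eval_add, Polynomial.eval_mul,
      Polynomial.eval_C, Polynomial.eval_X]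

/-- If a real stable polynomial has no zero on a ray in a positive direction, its absolute value
on that ray is minimized at the starting point. -/
lemma RealStable.abs_eval_le_of_ray_ne_zero {n : ℕ} {p : MvPolynomial (Fin n) ℝ}
    (hp : RealStable p) (a d : Fin n → ℝ) (hd : ∀ i, 0 < d i)
    (h : ∀ s : ℝ, 0 ≤ s → MvPolynomial.eval (a + s • d) p ≠ 0) {s : ℝ} (hs : 0 ≤ s) :
    |MvPolynomial.eval a p| ≤ |MvPolynomial.eval (a + s • d) p| := by
  obtain ⟨Q, hev⟩ := exists_polynomial_eval_eq_aeval_line p a d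
  have hreal : ∀ r : ℝ, Q.eval (r : ℂ) = ((MvPolynomial.eval (a + r • d) p : ℝ) : ℂ) := by
    intro r
    rw [hev, ← MvPolynomial.aeval_ofReal]
    simp
  have hroots : ∀ z ∈ Q.roots, z.im = 0 ∧ z.re ≤ 0 := by
    intro z hz
    have h0 : Q.eval z = 0 := (Polynomial.mem_roots'.1 hz).2
    have him : z.im = 0 := by
      rcases lt_trichotomy z.im 0 with hlt | heq | hgt
      · rw [hev] at h0
        exact absurd h0 (hp.aeval_ne_zero_of_im_neg _ fun i => by
          simpa using mul_neg_of_neg_of_pos hlt (hd i))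
      · exact heq
      · rw [hev] at h0
        exact absurd h0 (hp.aeval_ne_zero_of_im_pos _ fun i => by
          simpa using mul_pos hgt (hd i))
    refine ⟨him, ?_⟩
    by_contra! hpos
    have hz' : z = (z.re : ℂ) := Complex.ext rfl (by simpa using him)
    rw [hz', hreal] at h0
    exact h z.re hpos.le (by exact_mod_cast h0)
  have hle := norm_eval_zero_le_of_roots_nonpos Q hroots hs
  rw [← Complex.ofReal_zero, hreal, hreal, Complex.norm_real, Complex.norm_real] at hle
  simpa using hle

/-- A continuity argument: zeros of a family of functions on `[0, ∞)` cannot appear if they stay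
bounded, avoid `0`, and each zero-free member is minimized in absolute value at `0`. -/
lemma ne_zero_of_abs_minimized_at_zero {F : ℝ → ℝ → ℝ} (hF : Continuous fun q : ℝ × ℝ => F q.1 q.2) {S : ℝ}
    (hfar : ∀ t ∈ Set.Icc (0 : ℝ) 1, ∀ s, S ≤ s → F t s ≠ 0)
    (hinit : ∀ s, 0 ≤ s → F 0 s ≠ 0)
    (hbase : ∀ t ∈ Set.Icc (0 : ℝ) 1, F t 0 ≠ 0)
    (hmin : ∀ t, (∀ s, 0 ≤ s → F t s ≠ 0) → ∀ s, 0 ≤ s → |F t 0| ≤ |F t s|) :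
    ∀ t ∈ Set.Icc (0 : ℝ) 1, ∀ s, 0 ≤ s → F t s ≠ 0 := by
  have hleft : ∀ s : ℝ, Continuous fun t : ℝ => F t s :=
    fun s => hF.comp (by fun_prop : Continuous fun t : ℝ => (t, s))
  have hclosed : IsClosed {t : ℝ | ∀ s : ℝ, 0 ≤ s → |F t 0| ≤ |F t s|} := by
    simp only [Set.ofPred_forall]
    exact isClosed_iInter fun s => isClosed_iInter fun _ =>
      isClosed_le (hleft 0).abs (hleft s).abs
  have hne : ∀ t ∈ Set.Icc (0 : ℝ) 1, (∀ s : ℝ, 0 ≤ s → |F t 0| ≤ |F t s|) →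
      ∀ s, 0 ≤ s → F t s ≠ 0 := fun t ht hle s hs =>
    abs_pos.1 ((abs_pos.2 (hbase t ht)).trans_le (hle s hs))
  have hsub : Set.Icc (0 : ℝ) 1 ⊆ {t : ℝ | ∀ s : ℝ, 0 ≤ s → |F t 0| ≤ |F t s|} := by
    refine (hclosed.inter isClosed_Icc).Icc_subset_of_forall_mem_nhdsWithin (hmin 0 hinit) ?_
    rintro t ⟨htA, ht⟩
    have hev : ∀ᶠ r in nhds t, ∀ s ∈ Set.Icc (0 : ℝ) S, F r s ≠ 0 :=
      isCompact_Icc.eventually_forall_of_forall_eventually fun s hs =>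
        hF.continuousAt.eventually_ne (hne t ⟨ht.1, ht.2.le⟩ htA s hs.1)
    filter_upwards [hev.filter_mono nhdsWithin_le_nhds, Ioo_mem_nhdsGT ht.2] with r hr hrt
    refine hmin r fun s hs => ?_
    rcases le_total s S with hsS | hsS
    · exact hr s ⟨hs, hsS⟩
    · exact hfar r ⟨ht.1.trans hrt.1.le, hrt.2.le⟩ s hsS
  exact fun t ht => hne t ht (hsub ht)

lemma RealStable.eval_ne_zero_of_segment {n : ℕ} {p : MvPolynomial (Fin n) ℝ}
    (hp : RealStable p) {u v d : Fin n → ℝ} (hu : AboveRoots p u) (hv : ∀ i, 0 ≤ v i)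
    (hd : ∀ i, 0 < d i)
    (h : ∀ t : ℝ, t ∈ Set.Icc (0 : ℝ) 1 → MvPolynomial.eval (u - t • v) p ≠ 0) :
    MvPolynomial.eval (u - v + d) p ≠ 0 := by
  obtain ⟨S, hS⟩ : ∃ S : ℝ, ∀ i, v i / d i ≤ S :=
    ⟨∑ i, v i / d i, fun i => Finset.single_le_sum
      (f := fun i => v i / d i) (fun j _ => div_nonneg (hv j) (hd j).le) (Finset.mem_univ i)⟩
  have hcont : Continuous fun q : ℝ × ℝ => MvPolynomial.eval (u - q.1 • v + q.2 • d) p :=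
    (MvPolynomial.continuous_eval p).comp (by fun_prop)
  have hne := ne_zero_of_abs_minimized_at_zero
    (F := fun t s => MvPolynomial.eval (u - t • v + s • d) p) hcont (S := S) ?_ ?_ ?_ ?_ 1
    ⟨zero_le_one, le_rfl⟩ 1 zero_le_one
  · rwa [one_smul, one_smul] at hne
  · intro t ht s hs
    refine hu _ fun i => ?_
    have h1 : v i ≤ s * d i := (div_le_iff₀ (hd i)).1 ((hS i).trans hs)
    have h2 : t * v i ≤ v i := mul_le_of_le_one_left (hv i) ht.2
    simp only [Pi.add_apply, Pi.sub_apply, Pi.smul_apply, smul_eq_mul]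
    linarith
  · intro s hs
    refine hu _ fun i => ?_
    simpa using mul_nonneg hs (hd i).le
  · intro t ht
    simpa only [zero_smul, add_zero] using h t ht
  · intro t ht s hs
    simpa only [zero_smul, add_zero] using hp.abs_eval_le_of_ray_ne_zero _ d hd ht hs

theorem stmt7 (n : ℕ) (p : MvPolynomial (Fin n) ℝ) (hp : RealStable p)
    (u v : Fin n → ℝ) (hu : AboveRoots p u) (hv : ∀ i, 0 ≤ v i)
    (h : ∀ t : ℝ, t ∈ Set.Icc (0 : ℝ) 1 → MvPolynomial.eval (u - t • v) p ≠ 0) :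
    AboveRoots p (u - v) := by
  intro w hw
  have hcont : Continuous fun q : ℝ × ℝ =>
      MvPolynomial.eval (u - q.2 • (v + q.1 • (1 : Fin n → ℝ))) p :=
    (MvPolynomial.continuous_eval p).comp (by fun_prop)
  have hev : ∀ᶠ δ in nhds (0 : ℝ), ∀ t ∈ Set.Icc (0 : ℝ) 1,
      MvPolynomial.eval (u - t • (v + δ • (1 : Fin n → ℝ))) p ≠ 0 :=
    isCompact_Icc.eventually_forall_of_forall_eventually fun t ht =>
      hcont.continuousAt.eventually_ne (by simpa using h t ht)
  obtain ⟨δ, hδ, hδ_pos⟩ :=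
    ((hev.filter_mono nhdsWithin_le_nhds).and (self_mem_nhdsWithin (s := Set.Ioi (0 : ℝ)))).exists
  have hδ_pos' : 0 < δ := hδ_pos
  have hne := hp.eval_ne_zero_of_segment (v := v + δ • (1 : Fin n → ℝ))
    (d := w - (u - (v + δ • (1 : Fin n → ℝ)))) hu
    (fun i => by simpa using add_nonneg (hv i) hδ_pos'.le)
    (fun i => by
      have := hw i
      simp only [Pi.sub_apply, Pi.add_apply, Pi.smul_apply, Pi.one_apply, smul_eq_mul,
        mul_one] at this ⊢
      linarith) hδ
  rwa [add_sub_cancel] at hne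
end

section
/- Let r ≥ 2 be an integer, 0 < α ≤ (r-1)²/r², and let g ∈ ℝ[z_1,…,z_n] be a multi-affine real stable polynomial, g(z) = Σ_{A ⊆ [n]} a_A z^{A^c}, such that all roots of the diagonalization ḡ lie in [0,1], a_∅ = 1, and |a_{{i}}| ≤ α for every i ∈ [n]. Set p = g^r and let u be above the roots of g. Then for every tuple (i_1,…,i_n) of integers with 0 ≤ i_k ≤ r−1 for all k ∈ [n], and every i ∈ [n], all real roots of the univariate polynomial q(z_i) = [(Π_{k=1}^n ∂_k^{i_k}) p](u_1,…,u_{i−1}, z_i, u_{i+1},…,u_n) are non-negative. -/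
open MvPolynomial Polynomial

/-- The barrier function `Φ_p^i(u) = (∂_i p)(u) / p(u)`. -/
noncomputable def barrier {n : ℕ} (i : Fin n) (p : MvPolynomial (Fin n) ℝ)
    (u : Fin n → ℝ) : ℝ :=
  MvPolynomial.eval u (MvPolynomial.pderiv i p) / MvPolynomial.eval u p

/-- `∂_i (q/p)(u)`, written out via the quotient rule:
`(p(u)·(∂_i q)(u) − q(u)·(∂_i p)(u)) / p(u)²`. -/
noncomputable def dQuot {n : ℕ} (i : Fin n) (q p : MvPolynomial (Fin n) ℝ)
    (u : Fin n → ℝ) : ℝ :=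
  (MvPolynomial.eval u p * MvPolynomial.eval u (MvPolynomial.pderiv i q) -
    MvPolynomial.eval u q * MvPolynomial.eval u (MvPolynomial.pderiv i p)) /
    (MvPolynomial.eval u p) ^ 2

/-- `∂_j^m p`. -/
noncomputable def pderivPow {n : ℕ} (j : Fin n) (m : ℕ) (p : MvPolynomial (Fin n) ℝ) :
    MvPolynomial (Fin n) ℝ :=
  (fun q => MvPolynomial.pderiv j q)^[m] p

/-- The univariate polynomial `z_j ↦ p(u_1,…,u_{j-1},z_j,u_{j+1},…,u_n)`. -/
noncomputable def restrictAt {n : ℕ} (p : MvPolynomial (Fin n) ℝ) (u : Fin n → ℝ)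
    (j : Fin n) : Polynomial ℝ :=
  MvPolynomial.aeval (fun k => if k = j then Polynomial.X else Polynomial.C (u k)) p

/-- `(∏_k ∂_k^{m k}) p`. -/
noncomputable def pderivsMulti {n : ℕ} (m : Fin n → ℕ) (p : MvPolynomial (Fin n) ℝ) :
    MvPolynomial (Fin n) ℝ :=
  (List.finRange n).foldr (fun k q => pderivPow k (m k) q) p

section RayleighFamilies

variable {ι : Type*} [Fintype ι] [DecidableEq ι]

/-- The derivatives `c S = ∂^S f` of a multi-affine polynomial function `f` with leading
coefficient `1` that satisfies the strong Rayleigh inequalities. -/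
structure RayleighFamily (c : Finset ι → (ι → ℝ) → ℝ) : Prop where
  continuous : ∀ S, Continuous (c S)
  update_of_mem : ∀ S w k s, k ∈ S → c S (Function.update w k s) = c S w
  update_of_notMem : ∀ S w k s, k ∉ S →
    c S (Function.update w k s) = c S w + (s - w k) * c (insert k S) w
  univ_eq_one : ∀ w, c Finset.univ w = 1
  rayleigh : ∀ S w i k, i ∉ S → k ∉ S → i ≠ k →
    c S w * c (insert i (insert k S)) w ≤ c (insert i S) w * c (insert k S) w

/-- Moving from `w` to `w'` one coordinate at a time. -/
theorem update_induction {P : (ι → ℝ) → Prop} (w w' : ι → ℝ)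
    (step : ∀ v k, v k = w k → P v → P (Function.update v k (w' k))) (hw : P w) : P w' := by
  suffices h : ∀ T : Finset ι, P (T.piecewise w' w) by simpa using h Finset.univ
  intro T
  induction T using Finset.induction_on with
  | empty => simpa using hw
  | insert k T hk ih =>
    rw [Finset.piecewise_insert]
    exact step _ k (by simp [hk]) ih

theorem nonneg_of_forall_pos {f : ℝ → ℝ} (hf : Continuous f) (h : ∀ t, 0 < t → 0 ≤ f t) :
    0 ≤ f 0 := by
  have hlim : Filter.Tendsto f (nhdsWithin 0 (Set.Ioi 0)) (nhds (f 0)) :=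
    hf.continuousWithinAt
  exact ge_of_tendsto hlim (by filter_upwards [self_mem_nhdsWithin] with t ht using h t ht)

theorem mul_nonneg_of_forall_add_mul_ne_zero {a b : ℝ} (h : ∀ t : ℝ, 0 ≤ t → a + t * b ≠ 0) :
    0 ≤ a * b := by
  by_contra! hab
  have hb : b ≠ 0 := by rintro rfl; simp at hab
  refine h (-(a / b)) ?_ (by field_simp; ring)
  rw [← mul_div_mul_right a b hb, ← neg_div]
  exact div_nonneg (by linarith) (mul_self_nonneg b)

namespace RayleighFamily

variable {c : Finset ι → (ι → ℝ) → ℝ}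

theorem reflect (hc : RayleighFamily c) :
    RayleighFamily fun S w => (-1) ^ (Fintype.card ι + S.card) * c S (-w) where
  continuous S := by
    have := hc.continuous S
    fun_prop
  update_of_mem S w k s hk := by
    have h : -Function.update w k s = Function.update (-w) k (-s) := by
      ext j; by_cases hj : j = k <;> simp [hj]
    simp only [h, hc.update_of_mem S _ k _ hk]
  update_of_notMem S w k s hk := by
    have h : -Function.update w k s = Function.update (-w) k (-s) := by
      ext j; by_cases hj : j = k <;> simp [hj]
    simp only [h, hc.update_of_notMem S _ k _ hk, Finset.card_insert_of_notMem hk, Pi.neg_apply]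
    ring
  univ_eq_one w := by
    simp [hc.univ_eq_one, ← two_mul]
  rayleigh S w i k hi hk hik := by
    have h := hc.rayleigh S (-w) i k hi hk hik
    have hik' : i ∉ insert k S := by simp [hik, hi]
    simp only [Finset.card_insert_of_notMem hk, Finset.card_insert_of_notMem hi,
      Finset.card_insert_of_notMem hik']
    have hsq : ((-1 : ℝ) ^ (Fintype.card ι + S.card)) ^ 2 = 1 := by
      rw [← pow_mul, mul_comm, pow_mul]; simp
    simp only [← add_assoc, pow_succ _ (_ + _)]
    generalize ((-1 : ℝ) ^ (Fintype.card ι + S.card)) = e at hsq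
    calc _ = e ^ 2 * (c S (-w) * c (insert i (insert k S)) (-w)) := by ring
      _ ≤ e ^ 2 * (c (insert i S) (-w) * c (insert k S) (-w)) := by rw [hsq]; linarith
      _ = _ := by ring

omit [Fintype ι] in
theorem le_update {w u : ι → ℝ} {k : ι} {s : ℝ} (h : ∀ j, u j ≤ w j) (hs : w k ≤ s) (j : ι) :
    u j ≤ Function.update w k s j := by
  by_cases hj : j = k
  · subst hj; simpa using (h j).trans hs
  · simpa [hj] using h j

theorem mul_insert_nonneg (hc : RayleighFamily c) {S : Finset ι} {u : ι → ℝ}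
    (hS : ∀ w, (∀ j, u j ≤ w j) → c S w ≠ 0) {w : ι → ℝ} (hw : ∀ j, u j ≤ w j) {k : ι}
    (hk : k ∉ S) : 0 ≤ c S w * c (insert k S) w := by
  refine mul_nonneg_of_forall_add_mul_ne_zero fun t ht => ?_
  have h := hS (Function.update w k (w k + t)) (le_update hw (by linarith))
  rw [hc.update_of_notMem S _ k _ hk] at h
  simpa using h

theorem ne_zero_of_above (hc : RayleighFamily c) {u : ι → ℝ}
    (h0 : ∀ w, (∀ j, u j ≤ w j) → c ∅ w ≠ 0) (S : Finset ι) :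
    ∀ w, (∀ j, u j ≤ w j) → c S w ≠ 0 := by
  induction S using Finset.induction_on with
  | empty => exact h0
  | insert k S hk ih =>
    intro w hw hzero
    -- a zero of `c (insert k S)` at `w` propagates to the whole orthant above `w`
    have key : ∀ w', (∀ j, w j ≤ w' j) → c (insert k S) w' = 0 := by
      intro w' hw'
      refine (update_induction (P := fun v => (∀ j, w j ≤ v j) ∧ c (insert k S) v = 0) w w' ?_
        ⟨fun _ => le_rfl, hzero⟩).2
      rintro v l hvl ⟨hv, hv0⟩
      refine ⟨le_update hv (hvl ▸ hw' l), ?_⟩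
      by_cases hl : l ∈ insert k S
      · rw [hc.update_of_mem _ _ _ _ hl, hv0]
      have huv : ∀ j, u j ≤ v j := fun j => (hw j).trans (hv j)
      have hl' : l ≠ k ∧ l ∉ S := by simpa using hl
      have hle : c S v * c (insert l (insert k S)) v ≤ 0 := by
        simpa [hv0] using hc.rayleigh S v l k hl'.2 hk hl'.1
      have hge : 0 ≤ c S v * c (insert l (insert k S)) v := by
        suffices h : ∀ t : ℝ, 0 < t →
            0 ≤ (c S v + t * c (insert l S) v) * c (insert l (insert k S)) v by
          simpa using nonneg_of_forall_pos (by fun_prop) h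
        intro t ht
        have h := hc.mul_insert_nonneg ih
          (le_update (k := l) (s := v l + t) huv (by linarith)) hk
        rw [hc.update_of_notMem S _ l _ hl'.2, hc.update_of_notMem _ _ l _ hl, hv0] at h
        refine nonneg_of_mul_nonneg_right (a := t) ?_ ht
        calc (0 : ℝ) ≤ _ := h
          _ = _ := by ring
      have hz : c (insert l (insert k S)) v = 0 :=
        (mul_eq_zero.1 (le_antisymm hle hge)).resolve_left (ih v huv)
      rw [hc.update_of_notMem _ _ _ _ hl, hv0, hz]
      simp
    have key' : ∀ T : Finset ι, ∀ w', (∀ j, w j ≤ w' j) → c (T ∪ insert k S) w' = 0 := by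
      intro T
      induction T using Finset.induction_on with
      | empty => simpa using key
      | insert l T hl ihT =>
        intro w' hw'
        rw [Finset.insert_union]
        by_cases hmem : l ∈ T ∪ insert k S
        · rw [Finset.insert_eq_of_mem hmem]
          exact ihT w' hw'
        have h := hc.update_of_notMem _ w' l (w' l + 1) hmem
        rw [ihT w' hw', ihT _ (le_update hw' (by linarith))] at h
        linarith
    have h1 := key' Finset.univ w fun _ => le_rfl
    rw [Finset.union_eq_left.2 (Finset.subset_univ _), hc.univ_eq_one] at h1
    exact one_ne_zero h1

omit [Fintype ι] in
/-- Downward induction on the subsets of a finite set. -/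
theorem downward_induction {P : Finset ι → Prop} {U : Finset ι} (top : P U)
    (step : ∀ S k, k ∈ U → k ∉ S → P (insert k S) → P S) {S : Finset ι} (hS : S ⊆ U) : P S := by
  suffices h : ∀ T : Finset ι, P (U \ T) by
    simpa [Finset.inter_eq_right.2 hS] using h (U \ S)
  intro T
  induction T using Finset.induction_on with
  | empty => simpa using top
  | insert k T hk ih =>
    by_cases hkU : k ∈ U
    · refine step _ k hkU (by simp) ?_
      have : insert k (U \ insert k T) = U \ T := by
        ext j; by_cases hj : j = k <;> simp [hj, hk, hkU]
      rwa [this]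
    · rwa [Finset.sdiff_insert_of_notMem hkU]

theorem pos_of_above (hc : RayleighFamily c) {u : ι → ℝ}
    (h0 : ∀ w, (∀ j, u j ≤ w j) → c ∅ w ≠ 0) (S : Finset ι) : 0 < c S u := by
  refine downward_induction (P := fun S => 0 < c S u) (by simp [hc.univ_eq_one]) ?_
    (Finset.subset_univ S)
  intro S k _ hk ih
  have h1 := hc.mul_insert_nonneg (hc.ne_zero_of_above h0 S) (fun _ => le_rfl) hk
  have h2 := hc.ne_zero_of_above h0 S u fun _ => le_rfl
  exact lt_of_le_of_ne (nonneg_of_mul_nonneg_left h1 ih) h2.symm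

theorem pos_of_nonneg (hc : RayleighFamily c) {u : ι → ℝ} (h : ∀ S, 0 ≤ c S u) (h0 : c ∅ u ≠ 0)
    (S : Finset ι) : 0 < c S u := by
  refine hc.pos_of_above (fun w hw => ?_) S
  refine (update_induction (P := fun v => (∀ S, 0 ≤ c S v) ∧ c ∅ v ≠ 0) u w ?_ ⟨h, h0⟩).2
  rintro v k hvk ⟨hv, hv0⟩
  have hs : 0 ≤ w k - v k := by rw [hvk]; linarith [hw k]
  constructor
  · intro S
    by_cases hk : k ∈ S
    · rw [hc.update_of_mem _ _ _ _ hk]; exact hv S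
    · rw [hc.update_of_notMem _ _ _ _ hk]
      exact add_nonneg (hv S) (mul_nonneg hs (hv _))
  · rw [hc.update_of_notMem _ _ _ _ (by simp)]
    exact (add_pos_of_pos_of_nonneg (lt_of_le_of_ne (hv ∅) hv0.symm)
      (mul_nonneg hs (hv _))).ne'

theorem pos_of_le (hc : RayleighFamily c) {u w : ι → ℝ} (h : ∀ S, 0 < c S u)
    (hw : ∀ j, u j ≤ w j) (S : Finset ι) : 0 < c S w := by
  refine update_induction (P := fun v => ∀ S, 0 < c S v) u w ?_ h S
  intro v k hvk hv S
  have hs : 0 ≤ w k - v k := by rw [hvk]; linarith [hw k]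
  by_cases hk : k ∈ S
  · rw [hc.update_of_mem _ _ _ _ hk]; exact hv S
  · rw [hc.update_of_notMem _ _ _ _ hk]
    exact add_pos_of_pos_of_nonneg (hv S) (mul_nonneg hs (hv _).le)

theorem exists_pos (hc : RayleighFamily c) : ∃ u : ι → ℝ, ∀ S, 0 < c S u := by
  suffices h : ∀ T : Finset ι, ∃ u : ι → ℝ, ∀ S, Tᶜ ⊆ S → 0 < c S u by
    simpa using h Finset.univ
  intro T
  induction T using Finset.induction_on with
  | empty =>
    refine ⟨0, fun S hS => ?_⟩
    have : S = Finset.univ := by simpa [Finset.univ_subset_iff] using hS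
    simp [this, hc.univ_eq_one]
  | insert k T hk ih =>
    obtain ⟨u, hu⟩ := ih
    have hins : ∀ S, (insert k T)ᶜ ⊆ S → Tᶜ ⊆ insert k S := by
      intro S hS j hj
      by_cases hjk : j = k
      · simp [hjk]
      · exact Finset.mem_insert_of_mem (hS (by simpa [hjk] using hj))
    have hev : ∀ᶠ s : ℝ in Filter.atTop, ∀ S, (insert k T)ᶜ ⊆ S →
        0 < c S u + (s - u k) * c (insert k S) u := by
      rw [Filter.eventually_all]
      intro S
      by_cases hS : (insert k T)ᶜ ⊆ S
      · have hpos := hu _ (hins S hS)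
        filter_upwards [Filter.eventually_gt_atTop (u k - c S u / c (insert k S) u)] with s hs _
        have h1 : -(c S u / c (insert k S) u) < s - u k := by linarith
        have h2 := mul_lt_mul_of_pos_right h1 hpos
        rw [neg_mul, div_mul_cancel₀ _ hpos.ne'] at h2
        linarith
      · exact Filter.Eventually.of_forall fun s h => absurd h hS
    obtain ⟨s, hs⟩ := hev.exists
    refine ⟨Function.update u k s, fun S hS => ?_⟩
    by_cases hkS : k ∈ S
    · rw [hc.update_of_mem _ _ _ _ hkS]
      exact hu S (by simpa [Finset.insert_eq_of_mem hkS] using hins S hS)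
    · rw [hc.update_of_notMem _ _ _ _ hkS]
      exact hs S hS

theorem pos_of_diag_ne_zero (hc : RayleighFamily c)
    (h : ∀ t : ℝ, 0 < t → c ∅ (fun _ => t) ≠ 0) {t : ℝ} (ht : 0 < t) (S : Finset ι) :
    0 < c S fun _ => t := by
  obtain ⟨u, hu⟩ := hc.exists_pos
  obtain ⟨b, hb⟩ : ∃ b : ℝ, t ≤ b ∧ ∀ j, u j ≤ b :=
    ((Filter.eventually_ge_atTop t).and
      (Filter.eventually_all.2 fun j => Filter.eventually_ge_atTop (u j))).exists
  have hcont : ∀ S, Continuous fun x : ℝ => c S fun _ => b - x := fun S =>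
    (hc.continuous S).comp (by fun_prop)
  have hstrict : ∀ x : ℝ, x < b → (∀ S, 0 ≤ c S fun _ => b - x) →
      ∀ S, 0 < c S fun _ => b - x := fun x hx hx0 =>
    hc.pos_of_nonneg hx0 (h _ (by linarith))
  have hsub : Set.Icc 0 (b - t) ⊆ {x : ℝ | ∀ S, 0 ≤ c S fun _ => b - x} := by
    refine IsClosed.Icc_subset_of_forall_mem_nhdsWithin ?_ ?_ ?_
    · refine IsClosed.inter ?_ isClosed_Icc
      simp only [Set.ofPred_forall]
      exact isClosed_iInter fun S => isClosed_le continuous_const (hcont S)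
    · intro S
      exact (hc.pos_of_le hu (w := fun _ => b - 0) (by simpa using hb.2) S).le
    · rintro x ⟨hx, hx'⟩
      have hpos := hstrict x (by linarith [hx'.2]) hx
      refine mem_nhdsWithin_of_mem_nhds (Filter.eventually_all.2 fun S => ?_)
      filter_upwards [(hcont S).continuousAt.eventually_const_lt (hpos S)] with y hy using hy.le
  have hmem := hsub (Set.right_mem_Icc.2 (by linarith [hb.1]))
  have := hstrict (b - t) (by linarith) hmem S
  simpa using this

theorem compl_singleton_nonpos (hc : RayleighFamily c)
    (h : ∀ t : ℝ, t < 0 → c ∅ (fun _ => t) ≠ 0) (i : ι) : c {i}ᶜ 0 ≤ 0 := by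
  have hr := hc.reflect
  have hpos := fun t ht => hr.pos_of_diag_ne_zero (t := t) (fun s hs => by
    have := h (-s) (by linarith)
    simpa [Pi.neg_def] using this) ht {i}ᶜ
  have hcard : Fintype.card ι + ({i}ᶜ : Finset ι).card + 1 = 2 * Fintype.card ι := by
    have := Finset.card_add_card_compl ({i} : Finset ι)
    simp only [Finset.card_singleton] at this
    omega
  have hsign : (-1 : ℝ) ^ (Fintype.card ι + ({i}ᶜ : Finset ι).card) = -1 := by
    have : (-1 : ℝ) ^ (Fintype.card ι + ({i}ᶜ : Finset ι).card + 1) = 1 := by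
      rw [hcard, pow_mul]; simp
    rw [pow_succ] at this
    linarith
  have hcont : Continuous fun t : ℝ => -c {i}ᶜ (-fun _ => t) :=
    ((hc.continuous _).comp (by fun_prop)).neg
  have h0 : (-fun _ => (0 : ℝ) : ι → ℝ) = 0 := by ext; simp
  have := nonneg_of_forall_pos hcont fun t ht => by
    have := hpos t ht
    rw [hsign] at this
    linarith
  rw [h0] at this
  linarith

theorem update_zero_nonpos (hc : RayleighFamily c) {u : ι → ℝ}
    (h0 : ∀ w, (∀ j, u j ≤ w j) → c ∅ w ≠ 0) {i : ι} (hi : c {i}ᶜ 0 ≤ 0) (S : Finset ι)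
    (hS : i ∉ S) : c S (Function.update u i 0) ≤ 0 := by
  have hbase : c {i}ᶜ (Function.update u i 0) = c {i}ᶜ 0 := by
    refine update_induction (P := fun v => c {i}ᶜ v = c {i}ᶜ 0) 0 _ ?_ rfl
    intro v k hvk hv
    by_cases hk : k = i
    · subst hk
      rw [← hv]
      congr 1
      rw [Function.update_self, ← Pi.zero_apply (M := fun _ : ι => ℝ) k, ← hvk,
        Function.update_eq_self]
    · rw [hc.update_of_mem _ _ _ _ (by simpa using hk), hv]
  have hpos : ∀ S, i ∈ S → 0 < c S (Function.update u i 0) := fun S hi => by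
    rw [hc.update_of_mem _ _ _ _ hi]; exact hc.pos_of_above h0 S
  refine downward_induction (P := fun S => i ∉ S → c S (Function.update u i 0) ≤ 0)
    (U := {i}ᶜ) (fun _ => hbase ▸ hi) ?_ (by simpa using hS) hS
  intro S k hk hkS ih hiS
  have hik : i ≠ k := by simpa [eq_comm] using hk
  have h1 := hc.rayleigh S (Function.update u i 0) i k hiS hkS hik
  have h2 := mul_nonpos_of_nonneg_of_nonpos
    (hpos _ (Finset.mem_insert_self i S)).le (ih (by simp [hik, hiS]))
  exact nonpos_of_mul_nonpos_left (h1.trans h2) (hpos _ (Finset.mem_insert_self i _))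

theorem sign_update (hc : RayleighFamily c) {u : ι → ℝ}
    (h0 : ∀ w, (∀ j, u j ≤ w j) → c ∅ w ≠ 0) {i : ι} (hi : c {i}ᶜ 0 ≤ 0) {x : ℝ} (hx : x < 0)
    (S : Finset ι) : 0 < (if i ∈ S then 1 else -1) * c S (Function.update u i x) := by
  split_ifs with h
  · rw [hc.update_of_mem _ _ _ _ h, one_mul]
    exact hc.pos_of_above h0 S
  · have h1 := hc.update_zero_nonpos h0 hi S h
    have h2 := hc.update_of_notMem S (Function.update u i 0) i x h
    rw [Function.update_idem, hc.update_of_mem _ _ _ _ (Finset.mem_insert_self i S)] at h2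
    have h3 := mul_neg_of_neg_of_pos hx (hc.pos_of_above h0 (insert i S))
    simp only [Function.update_self, sub_zero] at h2
    linarith

end RayleighFamily

end RayleighFamilies

section MultiAffinePolynomials

variable {n : ℕ}

theorem pderiv_comm (i j : Fin n) (p : MvPolynomial (Fin n) ℝ) :
    pderiv i (pderiv j p) = pderiv j (pderiv i p) := by
  ext d
  by_cases hij : i = j
  · rw [hij]
  · simp only [coeff_pderiv, Finsupp.add_apply, Finsupp.single_eq_of_ne hij,
      Finsupp.single_eq_of_ne (Ne.symm hij), add_zero, add_right_comm d]
    ring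

@[simp]
theorem pderivs_empty (p : MvPolynomial (Fin n) ℝ) : pderivs ∅ p = p := by
  simp [pderivs]

theorem pderivs_insert {S : Finset (Fin n)} {k : Fin n} (hk : k ∉ S)
    (p : MvPolynomial (Fin n) ℝ) : pderivs (insert k S) p = pderiv k (pderivs S p) := by
  have : LeftCommutative fun (i : Fin n) (q : MvPolynomial (Fin n) ℝ) => pderiv i q :=
    ⟨fun i j q => pderiv_comm i j q⟩
  exact (Finset.toList_insert hk).foldr_eq p

theorem degreeOf_le_one_iff {p : MvPolynomial (Fin n) ℝ} {k : Fin n} :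
    p.degreeOf k ≤ 1 ↔ ∀ d, 1 < d k → p.coeff d = 0 := by
  rw [degreeOf_le_iff]
  exact forall_congr' fun d => by rw [MvPolynomial.mem_support_iff, ← not_lt, not_imp_not]

theorem MultiAffine.pderiv {p : MvPolynomial (Fin n) ℝ} (hp : MultiAffine p) (l : Fin n) :
    MultiAffine (MvPolynomial.pderiv l p) := fun k => by
  rw [degreeOf_le_one_iff]
  intro d hd
  rw [coeff_pderiv, degreeOf_le_one_iff.1 (hp k) _ (by simp only [Finsupp.add_apply]; omega),
    zero_mul]

theorem MultiAffine.pderivs {p : MvPolynomial (Fin n) ℝ} (hp : MultiAffine p)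
    (S : Finset (Fin n)) : MultiAffine (pderivs S p) := by
  induction S using Finset.induction_on with
  | empty => simpa using hp
  | insert k S hk ih => rw [pderivs_insert hk]; exact ih.pderiv k

theorem MultiAffine.pderiv_pderiv {p : MvPolynomial (Fin n) ℝ} (hp : MultiAffine p)
    (k : Fin n) : MvPolynomial.pderiv k (MvPolynomial.pderiv k p) = 0 := by
  ext d
  rw [coeff_pderiv, coeff_pderiv, degreeOf_le_one_iff.1 (hp k) _ (by simp)]
  simp

theorem MultiAffine.pderiv_pderivs {p : MvPolynomial (Fin n) ℝ} (hp : MultiAffine p)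
    {S : Finset (Fin n)} {k : Fin n} (hk : k ∈ S) :
    MvPolynomial.pderiv k (_root_.pderivs S p) = 0 := by
  rw [← Finset.insert_erase hk, pderivs_insert (Finset.notMem_erase k S)]
  exact (hp.pderivs _).pderiv_pderiv k

/-- A multi-affine polynomial is affine in each variable. -/
theorem MultiAffine.aeval_update {K : Type*} [CommRing K] [Algebra ℝ K]
    {p : MvPolynomial (Fin n) ℝ} (hp : MultiAffine p) (w : Fin n → K) (k : Fin n) (s : K) :
    aeval (Function.update w k s) p =
      aeval w p + (s - w k) * aeval w (MvPolynomial.pderiv k p) := by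
  rw [p.as_sum]
  simp only [map_sum, Finset.mul_sum, ← Finset.sum_add_distrib]
  refine Finset.sum_congr rfl fun d hd => ?_
  have hdk : d k ≤ 1 := degreeOf_le_iff.1 (hp k) d hd
  have hprod : ∀ (e : Fin n →₀ ℕ) (v : Fin n → K), (e.prod fun j a => v j ^ a) =
      v k ^ e k * ∏ j ∈ Finset.univ.erase k, v j ^ e j := fun e v => by
    rw [Finsupp.prod_fintype _ _ (by simp), 
      ← Finset.mul_prod_erase _ (fun j => v j ^ e j) (Finset.mem_univ k)]
  have hupd : ∏ j ∈ Finset.univ.erase k, Function.update w k s j ^ d j =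
      ∏ j ∈ Finset.univ.erase k, w j ^ d j :=
    Finset.prod_congr rfl fun j hj => by rw [Function.update_of_ne (Finset.ne_of_mem_erase hj)]
  have hsub : ∏ j ∈ Finset.univ.erase k, w j ^ (d - Finsupp.single k 1 : Fin n →₀ ℕ) j =
      ∏ j ∈ Finset.univ.erase k, w j ^ d j :=
    Finset.prod_congr rfl fun j hj => by
      simp [Finsupp.single_eq_of_ne (Finset.ne_of_mem_erase hj)]
  rw [pderiv_monomial, MvPolynomial.aeval_monomial, MvPolynomial.aeval_monomial,
    MvPolynomial.aeval_monomial, hprod, hprod, hprod, hupd,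
    hsub]
  obtain h | h : d k = 0 ∨ d k = 1 := by omega
  · simp [h]
  · simp only [Function.update_self, h, Finsupp.coe_tsub, Pi.sub_apply, Finsupp.single_eq_same,
      Nat.cast_one, mul_one, pow_one, Nat.sub_self, pow_zero, one_mul]
    ring

theorem coeff_pderivs (p : MvPolynomial (Fin n) ℝ) (S : Finset (Fin n)) :
    ∀ d : Fin n →₀ ℕ, (∀ k ∈ S, d k = 0) → coeff d (pderivs S p) = coeff (d + expOf S) p := by
  induction S using Finset.induction_on with
  | empty => simp [expOf]
  | insert k S hk ih =>
    intro d hd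
    rw [pderivs_insert hk, coeff_pderiv, ih, hd k (Finset.mem_insert_self k S)]
    · simp [expOf, Finset.sum_insert hk, add_assoc]
    · intro l hl
      have hlk : l ≠ k := fun h => hk (h ▸ hl)
      simp [hd l (Finset.mem_insert_of_mem hl), Finsupp.single_eq_of_ne hlk]

theorem eval_zero_pderivs (p : MvPolynomial (Fin n) ℝ) (S : Finset (Fin n)) :
    eval 0 (pderivs S p) = coeff (expOf S) p := by
  rw [MvPolynomial.eval_zero, constantCoeff_eq, coeff_pderivs p S 0 (by simp), zero_add]

theorem RealStable.aeval_ne_zero {p : MvPolynomial (Fin n) ℝ} (hp : RealStable p)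
    {z : Fin n → ℂ} (hz : ∀ i, 0 < (z i).im) : aeval z p ≠ 0 := by
  have := hp z hz
  rwa [MvPolynomial.eval_map, ← MvPolynomial.aeval_def] at this

theorem aeval_coe_real (w : Fin n → ℝ) (p : MvPolynomial (Fin n) ℝ) :
    aeval (fun j => (w j : ℂ)) p = (eval w p : ℂ) :=
  aeval_algebraMap_apply ℂ w p

/-- The strong Rayleigh inequality for real stable multi-affine polynomials. -/
theorem RealStable.rayleigh {p : MvPolynomial (Fin n) ℝ} (hp : RealStable p)
    (hma : MultiAffine p) (w : Fin n → ℝ) {i k : Fin n} (hik : i ≠ k) :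
    eval w p * eval w (pderiv i (pderiv k p)) ≤ eval w (pderiv i p) * eval w (pderiv k p) := by
  by_contra! hlt
  let z : ℝ → Fin n → ℂ := fun ε =>
    Function.update (fun j => (w j : ℂ) + ε * Complex.I) i ((w i : ℂ) + Complex.I)
  have hzc : Continuous z := by
    refine continuous_pi fun j => ?_
    by_cases hj : j = i
    · subst hj; simpa [z] using continuous_const
    · simp only [z, Function.update_of_ne hj]; fun_prop
  have hz0 : z 0 = Function.update (fun j => (w j : ℂ)) i ((w i : ℂ) + Complex.I) := by
    simp [z]
  let φ : ℝ → ℝ := fun ε => (aeval (z ε) p).re * (aeval (z ε) (pderiv k p)).im -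
    (aeval (z ε) p).im * (aeval (z ε) (pderiv k p)).re
  have hcont : ∀ q : MvPolynomial (Fin n) ℝ, Continuous fun ε => aeval (z ε) q := fun q => by
    simp only [MvPolynomial.aeval_def, ← MvPolynomial.eval_map]
    exact (MvPolynomial.continuous_eval _).comp hzc
  have hφc : Continuous φ :=
    ((Complex.continuous_re.comp (hcont _)).mul (Complex.continuous_im.comp (hcont _))).sub
      ((Complex.continuous_im.comp (hcont _)).mul (Complex.continuous_re.comp (hcont _)))
  have hφ0 : 0 < φ 0 := by
    simp only [φ, hz0, hma.aeval_update, (hma.pderiv k).aeval_update, aeval_coe_real,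
      add_sub_cancel_left]
    simp only [Complex.add_re, Complex.add_im, Complex.mul_re, Complex.mul_im, Complex.I_re,
      Complex.I_im, Complex.ofReal_re, Complex.ofReal_im]
    linarith
  obtain ⟨ε, hε, hφε⟩ : ∃ ε : ℝ, 0 < ε ∧ 0 < φ ε := by
    have h1 := hφc.continuousAt.eventually_const_lt hφ0
    have h2 : ∀ᶠ ε : ℝ in nhdsWithin 0 (Set.Ioi 0), 0 < φ ε := nhdsWithin_le_nhds h1
    obtain ⟨ε, h⟩ := (h2.and self_mem_nhdsWithin).exists
    exact ⟨ε, h.2, h.1⟩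
  have hP : aeval (z ε) (pderiv k p) ≠ 0 := fun h => by simp [φ, h] at hφε
  let y : ℂ := z ε k - aeval (z ε) p / aeval (z ε) (pderiv k p)
  have hy : aeval (Function.update (z ε) k y) p = 0 := by
    rw [hma.aeval_update]
    simp only [y]
    field_simp
    ring
  have hdiv : 0 < (-(aeval (z ε) p / aeval (z ε) (pderiv k p))).im := by
    rw [Complex.neg_im, Complex.div_im, ← sub_div, ← neg_div]
    exact div_pos (by linarith) (Complex.normSq_pos.2 hP)
  refine hp.aeval_ne_zero (z := Function.update (z ε) k y) (fun j => ?_) hy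
  by_cases hj : j = k
  · subst hj
    have : z ε j = (w j : ℂ) + ε * Complex.I := by simp [z, hik.symm]
    simp only [Function.update_self, y, this, sub_eq_add_neg, Complex.add_im]
    simp only [Complex.ofReal_im, Complex.mul_im, Complex.ofReal_re, Complex.I_im, Complex.I_re]
    linarith
  · rw [Function.update_of_ne hj]
    by_cases hji : j = i
    · subst hji; simp [z]
    · simp [z, hji, hε]

theorem eval_update_pderivs {p : MvPolynomial (Fin n) ℝ} (hma : MultiAffine p)
    {S : Finset (Fin n)} (w : Fin n → ℝ) {k : Fin n} (s : ℝ) (hk : k ∉ S) :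
    eval (Function.update w k s) (pderivs S p) =
      eval w (pderivs S p) + (s - w k) * eval w (pderivs (insert k S) p) := by
  have := (hma.pderivs S).aeval_update w k s
  rw [pderivs_insert hk]
  simpa only [aeval_eq_eval] using this

theorem leading_coeff_nonneg {a b c : ℝ} (h : ∀ t : ℝ, 0 ≤ a + t * b + t ^ 2 * c) : 0 ≤ c := by
  suffices h' : ∀ t : ℝ, 0 < t → 0 ≤ t ^ 2 * a + t * b + c by
    simpa using nonneg_of_forall_pos (by fun_prop) h'
  intro t ht
  have := mul_nonneg (sq_nonneg t) (h t⁻¹)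
  field_simp at this
  linarith

theorem RealStable.rayleighFamily {p : MvPolynomial (Fin n) ℝ} (hp : RealStable p)
    (hma : MultiAffine p) (hlead : coeff (expOf (Finset.univ : Finset (Fin n))) p = 1) :
    RayleighFamily fun S w => eval w (pderivs S p) where
  continuous S := MvPolynomial.continuous_eval _
  update_of_mem S w k s hk := by
    have := (hma.pderivs S).aeval_update w k s
    rw [hma.pderiv_pderivs hk] at this
    simpa [aeval_eq_eval] using this
  update_of_notMem S w k s hk := eval_update_pderivs hma w s hk
  univ_eq_one w := by
    rw [← hlead, ← eval_zero_pderivs]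
    refine update_induction
      (P := fun v => eval v (pderivs Finset.univ p) = eval 0 (pderivs Finset.univ p)) 0 w ?_ rfl
    intro v k _ hv
    have := (hma.pderivs Finset.univ).aeval_update v k (w k)
    rw [hma.pderiv_pderivs (Finset.mem_univ k)] at this
    simpa [aeval_eq_eval, hv] using this
  rayleigh S w i k hi hk hik := by
    induction S using Finset.induction_on generalizing w with
    | empty =>
      have hik' : i ∉ insert k (∅ : Finset (Fin n)) := by simpa using hik
      rw [pderivs_insert hik', pderivs_insert hi, pderivs_insert hk, pderivs_empty]
      exact hp.rayleigh hma w hik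
    | insert l S hl ih =>
      simp only [Finset.mem_insert, not_or] at hi hk
      have hli : l ∉ insert i S := by simp [Ne.symm hi.1, hl]
      have hlk : l ∉ insert k S := by simp [Ne.symm hk.1, hl]
      have hlik : l ∉ insert i (insert k S) := by simp [Ne.symm hi.1, Ne.symm hk.1, hl]
      rw [Finset.insert_comm i l, Finset.insert_comm k l, Finset.insert_comm i l, ← sub_nonneg]
      refine leading_coeff_nonneg
        (a := eval w (pderivs (insert i S) p) * eval w (pderivs (insert k S) p) -
          eval w (pderivs S p) * eval w (pderivs (insert i (insert k S)) p))
        (b := eval w (pderivs (insert i S) p) * eval w (pderivs (insert l (insert k S)) p) +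
          eval w (pderivs (insert l (insert i S)) p) * eval w (pderivs (insert k S) p) -
          eval w (pderivs S p) * eval w (pderivs (insert l (insert i (insert k S))) p) -
          eval w (pderivs (insert l S) p) * eval w (pderivs (insert i (insert k S)) p))
        fun t => ?_
      have h := ih (Function.update w l (w l + t)) hi.2 hk.2
      rw [eval_update_pderivs hma w _ hl, eval_update_pderivs hma w _ hli,
        eval_update_pderivs hma w _ hlk, eval_update_pderivs hma w _ hlik] at h
      simp only [add_sub_cancel_left] at h
      linarith

end MultiAffinePolynomials

section MixedDerivatives

variable {n : ℕ}

/-- The nonempty sums of products `∏ l, ∂^(S l) g` of `r` factors in which each variable `k`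
occurs in exactly `d k` of the sets `S l`. -/
noncomputable def derivativeProducts (g : MvPolynomial (Fin n) ℝ) (r : ℕ) (d : Fin n → ℕ) :
    AddSubsemigroup (MvPolynomial (Fin n) ℝ) :=
  AddSubsemigroup.closure {f | ∃ S : Fin r → Finset (Fin n),
    (∀ k, (Finset.univ.filter fun l => k ∈ S l).card = d k) ∧ f = ∏ l, pderivs (S l) g}

theorem pow_mem_derivativeProducts (g : MvPolynomial (Fin n) ℝ) (r : ℕ) :
    g ^ r ∈ derivativeProducts g r 0 :=
  AddSubsemigroup.subset_closure ⟨fun _ => ∅, by simp, by simp⟩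

theorem pderiv_prod {κ : Type*} [DecidableEq κ] (k : Fin n) (s : Finset κ)
    (f : κ → MvPolynomial (Fin n) ℝ) :
    pderiv k (∏ l ∈ s, f l) =
      ∑ l ∈ s, ∏ l' ∈ s, Function.update f l (pderiv k (f l)) l' := by
  induction s using Finset.induction_on with
  | empty => simp
  | insert a s ha ih =>
    rw [Finset.prod_insert ha, pderiv_mul, ih, Finset.sum_insert ha, Finset.prod_insert ha,
      Function.update_self, Finset.mul_sum]
    congr 1
    · congr 1
      exact Finset.prod_congr rfl fun l hl => by
        rw [Function.update_of_ne (ne_of_mem_of_not_mem hl ha)]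
    · refine Finset.sum_congr rfl fun l hl => ?_
      rw [Finset.prod_insert ha, Function.update_of_ne (ne_of_mem_of_not_mem hl ha).symm]

theorem pderiv_mem_derivativeProducts {g : MvPolynomial (Fin n) ℝ} (hma : MultiAffine g)
    {r : ℕ} {d : Fin n → ℕ} {k : Fin n} (hk : d k < r) {f : MvPolynomial (Fin n) ℝ}
    (hf : f ∈ derivativeProducts g r d) :
    pderiv k f ∈ derivativeProducts g r (Function.update d k (d k + 1)) := by
  induction hf using AddSubsemigroup.closure_induction with
  | add f₁ f₂ _ _ h₁ h₂ => rw [map_add]; exact add_mem h₁ h₂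
  | mem f hf =>
    obtain ⟨S, hS, rfl⟩ := hf
    have hzero : ∀ l ∈ Finset.univ, ∏ l', Function.update (fun l => pderivs (S l) g) l
        (pderiv k (pderivs (S l) g)) l' ≠ 0 → k ∉ S l := by
      intro l _ hne hmem
      exact hne (Finset.prod_eq_zero (Finset.mem_univ l)
        (by rw [Function.update_self, hma.pderiv_pderivs hmem]))
    rw [pderiv_prod, ← Finset.sum_filter_of_ne hzero]
    refine Finset.sum_induction_nonempty _ (· ∈ derivativeProducts g r _)
      (fun _ _ => add_mem) ?_ ?_
    · rw [← Finset.card_pos]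
      have := Finset.card_filter_add_card_filter_not (s := (Finset.univ : Finset (Fin r)))
        (fun l => k ∈ S l)
      rw [hS k, Finset.card_univ, Fintype.card_fin] at this
      omega
    · intro l hl
      have hkl : k ∉ S l := (Finset.mem_filter.1 hl).2
      refine AddSubsemigroup.subset_closure
        ⟨Function.update S l (insert k (S l)), fun k' => ?_, ?_⟩
      · by_cases hkk : k' = k
        · subst hkk
          have : (Finset.univ.filter fun l' => k' ∈ Function.update S l (insert k' (S l)) l') =
              insert l (Finset.univ.filter fun l' => k' ∈ S l') := by
            ext l'; by_cases hl' : l' = l <;> simp [hl', Function.update_apply]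
          rw [this, Finset.card_insert_of_notMem (by simpa using hkl), hS, Function.update_self]
        · rw [Function.update_of_ne hkk, ← hS k']
          congr 1
          ext l'
          by_cases hl' : l' = l
          · subst hl'; simp [hkk]
          · simp [hl']
      · refine Finset.prod_congr rfl fun l' _ => ?_
        by_cases hl' : l' = l
        · subst hl'; simp [pderivs_insert hkl]
        · simp [hl']

theorem pderivPow_mem_derivativeProducts {g : MvPolynomial (Fin n) ℝ} (hma : MultiAffine g)
    {r : ℕ} {d : Fin n → ℕ} {k : Fin n} {f : MvPolynomial (Fin n) ℝ}
    (hf : f ∈ derivativeProducts g r d) {j : ℕ} (hj : d k + j ≤ r) :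
    pderivPow k j f ∈ derivativeProducts g r (Function.update d k (d k + j)) := by
  induction j with
  | zero => simpa [pderivPow] using hf
  | succ j ih =>
    have h := pderiv_mem_derivativeProducts hma (k := k) (by rw [Function.update_self]; omega)
      (ih (by omega))
    rw [Function.update_self, Function.update_idem] at h
    simpa only [pderivPow, Function.iterate_succ_apply', ← add_assoc] using h

theorem pderivsMulti_pow_mem_derivativeProducts {g : MvPolynomial (Fin n) ℝ}
    (hma : MultiAffine g) {r : ℕ} {m : Fin n → ℕ} (hm : ∀ k, m k ≤ r) :
    pderivsMulti m (g ^ r) ∈ derivativeProducts g r m := by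
  suffices h : ∀ L : List (Fin n), L.Nodup →
      L.foldr (fun k q => pderivPow k (m k) q) (g ^ r) ∈
        derivativeProducts g r fun k => if k ∈ L then m k else 0 by
    simpa [pderivsMulti] using h (List.finRange n) (List.nodup_finRange n)
  intro L hL
  induction L with
  | nil => simpa [Pi.zero_def] using pow_mem_derivativeProducts g r
  | cons a L ih =>
    rw [List.nodup_cons] at hL
    have h := pderivPow_mem_derivativeProducts hma (k := a) (ih hL.2) (j := m a)
      (by simpa [hL.1] using hm a)
    rw [List.foldr_cons]
    convert h using 2
    ext k
    by_cases hk : k = a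
    · subst hk; simp [hL.1]
    · simp [hk]

/-- If the signs of the derivatives `∂^S g` at `v` only depend on whether `i ∈ S`, then the
derivatives of `g ^ r` do not vanish at `v`. -/
theorem eval_ne_zero_of_mem_derivativeProducts {g : MvPolynomial (Fin n) ℝ} {r : ℕ}
    {d : Fin n → ℕ} {f : MvPolynomial (Fin n) ℝ} (hf : f ∈ derivativeProducts g r d)
    {v : Fin n → ℝ} {i : Fin n}
    (hv : ∀ S, 0 < (if i ∈ S then 1 else -1) * eval v (pderivs S g)) : eval v f ≠ 0 := by
  suffices h : 0 < (-1) ^ (r - d i) * eval v f from right_ne_zero_of_mul h.ne'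
  induction hf using AddSubsemigroup.closure_induction with
  | add f₁ f₂ _ _ h₁ h₂ => rw [map_add, mul_add]; exact add_pos h₁ h₂
  | mem f hf =>
    obtain ⟨S, hS, rfl⟩ := hf
    have h := Finset.prod_pos fun l (_ : l ∈ Finset.univ) => hv (S l)
    have hcard := Finset.card_filter_add_card_filter_not (s := (Finset.univ : Finset (Fin r)))
      (fun l => i ∈ S l)
    rw [hS i, Finset.card_univ, Fintype.card_fin] at hcard
    rw [Finset.prod_mul_distrib, Finset.prod_ite, Finset.prod_const_one, one_mul,
      Finset.prod_const, Nat.eq_sub_of_add_eq' hcard] at h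
    rwa [map_prod]

theorem eval_restrictAt (p : MvPolynomial (Fin n) ℝ) (u : Fin n → ℝ) (i : Fin n) (x : ℝ) :
    (restrictAt p u i).eval x = eval (Function.update u i x) p := by
  rw [restrictAt, ← Polynomial.coe_aeval_eq_eval, MvPolynomial.comp_aeval_apply,
    ← MvPolynomial.aeval_eq_eval]
  congr 2
  ext k
  by_cases hk : k = i <;> simp [hk]

theorem eval_diagPoly (p : MvPolynomial (Fin n) ℝ) (t : ℝ) :
    (diagPoly p).eval t = eval (fun _ => t) p := by
  rw [diagPoly, ← Polynomial.coe_aeval_eq_eval, MvPolynomial.comp_aeval_apply,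
    ← MvPolynomial.aeval_eq_eval]
  simp

end MixedDerivatives

theorem stmt10 (r : ℕ) (hr : 2 ≤ r) (α : ℝ) (hα0 : 0 < α)
    (hα1 : α ≤ ((r : ℝ) - 1) ^ 2 / (r : ℝ) ^ 2)
    (n : ℕ) (g : MvPolynomial (Fin n) ℝ)
    (hstable : RealStable g) (hma : MultiAffine g)
    (hroots : ∀ x : ℝ, (diagPoly g).IsRoot x → x ∈ Set.Icc (0 : ℝ) 1)
    (ha0 : MvPolynomial.coeff (expOf (Finset.univ : Finset (Fin n))) g = 1)
    (hai : ∀ i : Fin n, |MvPolynomial.coeff (expOf ({i} : Finset (Fin n))ᶜ) g| ≤ α)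
    (u : Fin n → ℝ) (hu : AboveRoots g u)
    (m : Fin n → ℕ) (hm : ∀ k, m k ≤ r - 1) (i : Fin n) :
    ∀ x : ℝ, (restrictAt (pderivsMulti m (g ^ r)) u i).IsRoot x → 0 ≤ x := by
  have hc := hstable.rayleighFamily hma ha0
  have hi : eval 0 (pderivs {i}ᶜ g) ≤ 0 := by
    refine hc.compl_singleton_nonpos (fun t ht h => ?_) i
    rw [pderivs_empty, ← eval_diagPoly] at h
    exact absurd (hroots t h).1 (not_le.2 ht)
  have habove : ∀ w : Fin n → ℝ, (∀ j, u j ≤ w j) → eval w (pderivs ∅ g) ≠ 0 := by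
    rw [pderivs_empty]; exact hu
  intro x hx
  by_contra! hneg
  rw [Polynomial.IsRoot, eval_restrictAt] at hx
  exact eval_ne_zero_of_mem_derivativeProducts
    (pderivsMulti_pow_mem_derivativeProducts hma fun k => (hm k).trans (Nat.sub_le r 1))
    (fun S => hc.sign_update habove hi hneg S) hx
end

section
/- Let g ∈ ℝ[z_1,…,z_n] be a multi-affine real stable polynomial, g(z) = Σ_{A ⊆ [n]} a_A z^{A^c}, such that all roots of the diagonalization ḡ lie in [0,1] and a_∅ = 1. If u is above the roots of g, then the univariate polynomial z_n ↦ g(u_1,…,u_{n−1}, z_n) has degree exactly 1, positive leading coefficient, and its unique root is non-negative. -/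
open MvPolynomial Polynomial

theorem wronskian_nonneg_of_halfPlane {A B : ℝ[X]}
    (h : ∀ s t : ℂ, 0 < s.im → 0 < t.im → t * Polynomial.aeval s A + Polynomial.aeval s B ≠ 0)
    (x : ℝ) :
    0 ≤ B.derivative.eval x * A.eval x - B.eval x * A.derivative.eval x := by
  have him : ∀ s : ℂ, 0 < s.im →
      0 ≤ (Polynomial.aeval s B * (starRingEnd ℂ) (Polynomial.aeval s A)).im := by
    intro s hs
    by_contra! hneg
    have hA : Polynomial.aeval s A ≠ 0 := by
      intro h0
      simp [h0] at hneg
    have hpos : 0 < Complex.normSq (Polynomial.aeval s A) := Complex.normSq_pos.2 hA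
    refine h s (-Polynomial.aeval s B / Polynomial.aeval s A) hs ?_ (by field_simp; ring)
    rw [div_eq_mul_inv, Complex.inv_def, neg_mul, ← mul_assoc, ← neg_mul, Complex.im_mul_ofReal,
      Complex.neg_im]
    exact mul_pos (by linarith) (inv_pos.2 hpos)
  set F : ℝ → ℂ := fun e => Polynomial.aeval ((x : ℂ) + e * Complex.I) B *
    (starRingEnd ℂ) (Polynomial.aeval ((x : ℂ) + e * Complex.I) A) with hF
  have hline : HasDerivAt (fun e : ℝ => (x : ℂ) + e * Complex.I) Complex.I 0 := by
    simpa using ((Complex.ofRealCLM.hasDerivAt (x := (0 : ℝ))).mul_const Complex.I).const_add (x : ℂ)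
  have hp : ∀ P : ℝ[X], HasDerivAt (fun e : ℝ => Polynomial.aeval ((x : ℂ) + e * Complex.I) P)
      ((P.derivative.eval x : ℝ) * Complex.I) 0 := by
    intro P
    have h1 := P.hasDerivAt_aeval ((x : ℂ) + (0 : ℝ) * Complex.I)
    have h2 := h1.comp (0 : ℝ) hline
    have h3 : Polynomial.aeval ((x : ℂ) + (0 : ℝ) * Complex.I) P.derivative
        = ((P.derivative.eval x : ℝ) : ℂ) := by
      simpa using Polynomial.aeval_algebraMap_apply_eq_algebraMap_eval (A := ℂ) x P.derivative
    rwa [h3] at h2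
  have hv : ∀ P : ℝ[X], Polynomial.aeval ((x : ℂ) + (0 : ℝ) * Complex.I) P
      = ((P.eval x : ℝ) : ℂ) := fun P => by
    simpa using Polynomial.aeval_algebraMap_apply_eq_algebraMap_eval (A := ℂ) x P
  have hconj : HasDerivAt (fun e : ℝ => (starRingEnd ℂ)
      (Polynomial.aeval ((x : ℂ) + e * Complex.I) A))
      ((starRingEnd ℂ) ((A.derivative.eval x : ℝ) * Complex.I)) 0 := (hp A).star
  have hFd := (hp B).mul hconj
  have hd : HasDerivAt (fun e => (F e).im)
      (B.derivative.eval x * A.eval x - B.eval x * A.derivative.eval x) 0 := by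
    have := Complex.imCLM.hasFDerivAt.comp_hasDerivAt (0 : ℝ) hFd
    rw [hv, hv] at this
    refine HasDerivAt.congr_deriv this ?_
    simp
    ring
  have h0 : (F 0).im = 0 := by
    simp only [hF]
    rw [hv, hv]
    simp
  have hs := hd.hasDerivWithinAt (s := Set.Ioi 0)
  rw [hasDerivWithinAt_iff_tendsto_slope' (by simp)] at hs
  refine ge_of_tendsto hs ?_
  filter_upwards [self_mem_nhdsWithin] with e he
  rw [slope_def_field, h0, sub_zero, sub_zero]
  refine div_nonneg (him _ ?_) (le_of_lt he)
  simpa using he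

theorem Polynomial.Monic.eventually_eval_pos {P : ℝ[X]} (hP : P.Monic) :
    ∀ᶠ s in Filter.atTop, 0 < P.eval s := by
  rcases Nat.eq_zero_or_pos P.natDegree with h0 | h0
  · rw [Polynomial.eq_one_of_monic_natDegree_zero hP h0]
    simp
  · exact (P.tendsto_atTop_of_leadingCoeff_nonneg (Polynomial.natDegree_pos_iff_degree_pos.1 h0)
      (by rw [hP.leadingCoeff]; exact zero_le_one)).eventually_gt_atTop 0

theorem Polynomial.Monic.exists_eval_eq_zero_of_eval_nonpos {P : ℝ[X]} (hP : P.Monic) {s : ℝ}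
    (hs : P.eval s ≤ 0) : ∃ r, s ≤ r ∧ P.eval r = 0 := by
  obtain ⟨y, hy, hsy⟩ := (hP.eventually_eval_pos.and (Filter.eventually_ge_atTop s)).exists
  obtain ⟨r, hr, hr0⟩ := intermediate_value_Icc hsy P.continuous.continuousOn
    (show (0 : ℝ) ∈ Set.Icc _ _ from ⟨hs, hy.le⟩)
  exact ⟨r, hr.1, hr0⟩

theorem le_coeff_of_wronskian_nonneg {A B : ℝ[X]} {n : ℕ} {s₀ τ : ℝ}
    (hA : A.natDegree ≤ n) (hA1 : A.coeff n = 1) (hB : B.natDegree ≤ n)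
    (hW : ∀ x, 0 ≤ B.derivative.eval x * A.eval x - B.eval x * A.derivative.eval x)
    (hne : ∀ s, s₀ ≤ s → (s + τ) * A.eval s + B.eval s ≠ 0) :
    0 < A.eval s₀ ∧ B.eval s₀ ≤ B.coeff n * A.eval s₀ ∧
      0 < (s₀ + τ) * A.eval s₀ + B.eval s₀ := by
  have hAm : A.Monic := Polynomial.monic_of_natDegree_le_of_coeff_eq_one n hA hA1
  have hAd : A.natDegree = n :=
    le_antisymm hA (Polynomial.le_natDegree_of_ne_zero (by simp [hA1]))
  have hAdeg : A.degree = n := by rw [Polynomial.degree_eq_natDegree hAm.ne_zero, hAd]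
  have hQm : ((Polynomial.X + Polynomial.C τ) * A + B).Monic := by
    refine ((Polynomial.monic_X_add_C τ).mul hAm).add_of_left ?_
    rw [Polynomial.degree_mul, Polynomial.degree_X_add_C, hAdeg]
    refine (Polynomial.natDegree_le_iff_degree_le.1 hB).trans_lt ?_
    rw [add_comm]
    exact_mod_cast Nat.lt_succ_self n
  have hQpos : ∀ s, s₀ ≤ s → 0 < (s + τ) * A.eval s + B.eval s := by
    intro s hs
    by_contra! hle
    obtain ⟨r, hr, hr0⟩ := hQm.exists_eval_eq_zero_of_eval_nonpos (s := s) (by simpa using hle)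
    exact hne r (hs.trans hr) (by simpa using hr0)
  have hmono : ∀ r, (∀ s, r < s → 0 < A.eval s) →
      MonotoneOn (fun s => B.eval s / A.eval s) (Set.Ioi r) := by
    intro r hr
    have hd : ∀ s ∈ Set.Ioi r, HasDerivAt (fun s => B.eval s / A.eval s)
        ((B.derivative.eval s * A.eval s - B.eval s * A.derivative.eval s) / A.eval s ^ 2) s :=
      fun s hs => (B.hasDerivAt s).div (A.hasDerivAt s) (hr s hs).ne'
    refine monotoneOn_of_deriv_nonneg (convex_Ioi r)
      (fun s hs => (hd s hs).continuousAt.continuousWithinAt) ?_ ?_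
    · rw [interior_Ioi]
      exact fun s hs => (hd s hs).differentiableAt.differentiableWithinAt
    · rw [interior_Ioi]
      intro s hs
      rw [(hd s hs).deriv]
      exact div_nonneg (hW s) (sq_nonneg _)
  have hApos : ∀ s, s₀ ≤ s → 0 < A.eval s := by
    intro s hs
    by_contra! hle
    obtain ⟨r, hr, hr0⟩ := hAm.exists_eval_eq_zero_of_eval_nonpos hle
    have hmem : r ∈ A.roots.toFinset := by simpa [hAm.ne_zero] using hr0
    obtain ⟨m, hm, hmax⟩ := A.roots.toFinset.exists_max_image id ⟨r, hmem⟩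
    have hm0 : A.eval m = 0 := by simpa [hAm.ne_zero] using hm
    have hsm : s₀ ≤ m := hs.trans (hr.trans (hmax r hmem))
    have hpos : ∀ q, m < q → 0 < A.eval q := by
      intro q hq
      by_contra! hle
      obtain ⟨r, hr, hr0⟩ := hAm.exists_eval_eq_zero_of_eval_nonpos hle
      have := hmax r (by simpa [hAm.ne_zero] using hr0)
      simp only [id] at this
      linarith
    have hBm : 0 < B.eval m := by simpa [hm0] using hQpos m hsm
    set K := B.eval (m + 1) / A.eval (m + 1)
    have hle : ∀ᶠ q in nhdsWithin m (Set.Ioi m), B.eval q ≤ K * A.eval q := by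
      filter_upwards [Ioo_mem_nhdsGT (show m < m + 1 by linarith)] with q hq
      rw [← div_le_iff₀ (hpos q hq.1)]
      exact hmono m hpos hq.1 (by simp) hq.2.le
    have hlim := le_of_tendsto_of_tendsto
      (B.continuous.continuousWithinAt (s := Set.Ioi m) (x := m))
      ((A.continuous.const_mul K |>.continuousWithinAt (s := Set.Ioi m) (x := m))) hle
    simp only [hm0, mul_zero] at hlim
    linarith
  refine ⟨hApos s₀ le_rfl, ?_, hQpos s₀ le_rfl⟩
  have hex : ∃ r < s₀, ∀ s, r < s → 0 < A.eval s := by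
    have : ∀ᶠ q in nhds s₀, 0 < A.eval q :=
      A.continuous.continuousAt.eventually (lt_mem_nhds (hApos s₀ le_rfl))
    obtain ⟨l, hl, hl'⟩ := exists_Ioc_subset_of_mem_nhds this (exists_lt s₀)
    refine ⟨l, hl, fun s hs => ?_⟩
    rcases le_total s s₀ with h | h
    · exact hl' ⟨hs, h⟩
    · exact hApos s h
  obtain ⟨r, hr, hrpos⟩ := hex
  have hlim : Filter.Tendsto (fun s => B.eval s / A.eval s) Filter.atTop (nhds (B.coeff n)) := by
    have hdeg : (B - Polynomial.C (B.coeff n) * A).degree < A.degree := by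
      rw [hAdeg]
      refine (Polynomial.degree_lt_iff_coeff_zero _ _).2 fun k hk => ?_
      rcases hk.eq_or_lt with rfl | hk
      · simp [hA1]
      · simp [Polynomial.coeff_eq_zero_of_natDegree_lt (hB.trans_lt hk),
          Polynomial.coeff_eq_zero_of_natDegree_lt (hA.trans_lt hk)]
    have h0 := (Polynomial.div_tendsto_atTop_zero_of_degree_lt _ _ hdeg).add_const (B.coeff n)
    rw [zero_add] at h0
    refine h0.congr' ?_
    filter_upwards [hAm.eventually_eval_pos] with s hs
    simp only [Polynomial.eval_sub, Polynomial.eval_mul, Polynomial.eval_C]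
    field_simp
    ring
  rw [← div_le_iff₀ (hApos s₀ le_rfl)]
  refine ge_of_tendsto hlim ?_
  filter_upwards [Filter.eventually_ge_atTop s₀] with s hs
  exact hmono r hrpos hr (hr.trans_le hs) hs

/-- The value `∑_T a_T ∏_{i ∈ T} v_i` of the multi-affine polynomial with coefficients `a`. -/
noncomputable def multiAffineEval {ι R : Type} [Fintype ι] [CommRing R] [Algebra ℝ R]
    (a : Finset ι → ℝ) (v : ι → R) : R :=
  ∑ T, algebraMap ℝ R (a T) * ∏ i ∈ T, v i

section multiAffineEval

variable {ι R : Type} [Fintype ι] [CommRing R] [Algebra ℝ R]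

theorem aeval_multiAffineEval (a : Finset ι → ℝ) (x : ι → ℝ) (s : R) :
    Polynomial.aeval s (multiAffineEval a fun k => Polynomial.X + Polynomial.C (x k)) =
      multiAffineEval a fun k => s + algebraMap ℝ R (x k) := by
  simp [multiAffineEval, map_sum, map_prod]

theorem natDegree_multiAffineEval_le (a : Finset ι → ℝ) (x : ι → ℝ) :
    (multiAffineEval a fun k => Polynomial.X + Polynomial.C (x k)).natDegree ≤
      Fintype.card ι := by
  refine Polynomial.natDegree_sum_le_of_forall_le _ _ fun T _ => ?_
  refine (Polynomial.natDegree_C_mul_le _ _).trans ?_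
  refine (Polynomial.natDegree_prod_le _ _).trans ?_
  simpa using T.card_le_univ

theorem coeff_multiAffineEval (a : Finset ι → ℝ) (x : ι → ℝ) :
    (multiAffineEval a fun k => Polynomial.X + Polynomial.C (x k)).coeff (Fintype.card ι) =
      a Finset.univ := by
  have hdeg : ∀ T : Finset ι,
      (∏ k ∈ T, (Polynomial.X + Polynomial.C (x k))).natDegree = T.card := fun T => by
    rw [Polynomial.natDegree_prod_of_monic _ _ fun k _ => Polynomial.monic_X_add_C _]
    simp
  rw [multiAffineEval, Polynomial.finsetSum_coeff, Finset.sum_eq_single Finset.univ]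
  · have hm := Polynomial.monic_prod_of_monic Finset.univ
      (fun k => Polynomial.X + Polynomial.C (x k)) fun k _ => Polynomial.monic_X_add_C _
    have h1 := hm.coeff_natDegree
    rw [hdeg, Finset.card_univ] at h1
    rw [Polynomial.algebraMap_eq, Polynomial.coeff_C_mul, h1, mul_one]
  · intro T _ hT
    rw [Polynomial.algebraMap_eq, Polynomial.coeff_C_mul,
      Polynomial.coeff_eq_zero_of_natDegree_lt, mul_zero]
    rw [hdeg]
    exact (Finset.card_lt_iff_ne_univ T).2 hT
  · simp

end multiAffineEval

theorem expOf_apply {n : ℕ} (A : Finset (Fin n)) (i : Fin n) :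
    expOf A i = if i ∈ A then 1 else 0 := by
  simp [expOf, Finsupp.finsetSum_apply, Finsupp.single_apply]

theorem MultiAffine.expOf_support {n : ℕ} {g : MvPolynomial (Fin n) ℝ} (hg : MultiAffine g)
    {m : Fin n →₀ ℕ} (hm : m ∈ g.support) : expOf m.support = m := by
  ext i
  have h1 : m i ≤ 1 := (MvPolynomial.monomial_le_degreeOf i hm).trans (hg i)
  rw [expOf_apply]
  simp only [Finsupp.mem_support_iff]
  split_ifs <;> omega

theorem MultiAffine.aeval_eq {n : ℕ} {g : MvPolynomial (Fin n) ℝ} (hg : MultiAffine g)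
    {R : Type} [CommRing R] [Algebra ℝ R] (v : Fin n → R) :
    MvPolynomial.aeval v g = multiAffineEval (fun S => MvPolynomial.coeff (expOf S) g) v := by
  rw [MvPolynomial.aeval_def, MvPolynomial.eval₂_eq, multiAffineEval]
  refine Finset.sum_of_injOn (fun m => m.support) ?_ (fun _ _ => by simp) ?_ ?_
  · intro m hm m' hm' h
    rw [← hg.expOf_support hm, ← hg.expOf_support hm']
    exact congrArg expOf h
  · intro S _ hS
    have : MvPolynomial.coeff (expOf S) g = 0 := by
      by_contra h
      refine hS ⟨expOf S, by simpa using h, ?_⟩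
      ext i
      simp [expOf_apply]
    simp [this]
  · intro m hm
    simp only [hg.expOf_support hm]
    congr 1
    refine Finset.prod_congr rfl fun i hi => ?_
    rw [← hg.expOf_support hm, expOf_apply, if_pos hi, pow_one]

theorem MultiAffine.exists_aeval_eq {n : ℕ} {g : MvPolynomial (Fin (n + 1)) ℝ}
    (hg : MultiAffine g) :
    ∃ a b : Finset (Fin n) → ℝ,
      a Finset.univ = MvPolynomial.coeff (expOf Finset.univ) g ∧
      ∀ {R : Type} [CommRing R] [Algebra ℝ R] (v : Fin (n + 1) → R),
        MvPolynomial.aeval v g =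
          v (Fin.last n) * multiAffineEval a (fun k => v k.castSucc) +
            multiAffineEval b (fun k => v k.castSucc) := by
  refine ⟨fun T => MvPolynomial.coeff
      (expOf (Finset.cons (Fin.last n) (T.map Fin.castSuccEmb) (by simp))) g,
    fun T => MvPolynomial.coeff (expOf (T.map Fin.castSuccEmb)) g, ?_, ?_⟩
  · simp only [← Fin.univ_castSuccEmb]
  · intro R _ _ v
    rw [hg.aeval_eq, multiAffineEval, ← Finset.powerset_univ, Fin.univ_castSuccEmb,
      Finset.cons_eq_insert, Finset.sum_powerset_insert (by simp), Finset.map_eq_image,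
      Finset.powerset_image, Finset.sum_image
        (fun _ _ _ _ h => Finset.image_injective (Fin.castSuccEmb (n := n)).injective h),
      Finset.sum_image
        (fun _ _ _ _ h => Finset.image_injective (Fin.castSuccEmb (n := n)).injective h),
      add_comm, Finset.powerset_univ, multiAffineEval, multiAffineEval, Finset.mul_sum]
    congr 1
    · refine Finset.sum_congr rfl fun T _ => ?_
      rw [← Finset.map_eq_image, ← Finset.cons_eq_insert _ _ (by simp), Finset.prod_cons,
        Finset.prod_map]
      simp only [Fin.coe_castSuccEmb]
      ring
    · refine Finset.sum_congr rfl fun T _ => ?_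
      rw [← Finset.map_eq_image, Finset.prod_map]
      simp only [Fin.coe_castSuccEmb]

theorem stmt11 (n : ℕ) (g : MvPolynomial (Fin (n + 1)) ℝ)
    (hstable : RealStable g) (hma : MultiAffine g)
    (hroots : ∀ x : ℝ, (diagPoly g).IsRoot x → x ∈ Set.Icc (0 : ℝ) 1)
    (ha0 : MvPolynomial.coeff (expOf (Finset.univ : Finset (Fin (n + 1)))) g = 1)
    (u : Fin (n + 1) → ℝ) (hu : AboveRoots g u) :
    (restrictAt g u (Fin.last n)).natDegree = 1 ∧
    0 < (restrictAt g u (Fin.last n)).leadingCoeff ∧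
    ∀ x : ℝ, (restrictAt g u (Fin.last n)).IsRoot x → 0 ≤ x := by
  obtain ⟨a, b, ha, hab⟩ := hma.exists_aeval_eq
  rw [ha0] at ha
  set P : (Finset (Fin n) → ℝ) → (Fin n → ℝ) → ℝ[X] := fun c x =>
    multiAffineEval c fun k => Polynomial.X + Polynomial.C (x k) with hP
  have hPdeg : ∀ c x, (P c x).natDegree ≤ n := fun c x => by
    simpa using natDegree_multiAffineEval_le c x
  have hPcoeff : ∀ c x, (P c x).coeff n = c Finset.univ := fun c x => by
    simpa using coeff_multiAffineEval c x
  have hPeval : ∀ c x s, (P c x).eval s = multiAffineEval c fun k => s + x k := fun c x s => by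
    simpa [Polynomial.coe_aeval_eq_eval] using aeval_multiAffineEval (R := ℝ) c x s
  have hW : ∀ x y, 0 ≤ (P b x).derivative.eval y * (P a x).eval y -
      (P b x).eval y * (P a x).derivative.eval y := by
    intro x
    refine wronskian_nonneg_of_halfPlane fun s t hs ht => ?_
    have h := hstable (Fin.snoc (α := fun _ => ℂ) (fun k => s + algebraMap ℝ ℂ (x k)) t) ?_
    · rw [MvPolynomial.eval_map, ← MvPolynomial.aeval_def, hab] at h
      simpa [hP, aeval_multiAffineEval] using h
    · refine Fin.lastCases (by simpa using ht) fun k => ?_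
      simpa using hs
  -- Reflect `z ↦ -z` and compare the value at `ε` with the limit at infinity.
  have hb : b Finset.univ ≤ 0 := by
    refine le_of_forall_pos_lt_add fun ε hε => ?_
    set σ : ℝ := (-1) ^ n with hσ
    have hσ2 : σ * σ = 1 := by rw [hσ, ← mul_pow]; simp
    have hdeg : ∀ (r : ℝ) (Q : ℝ[X]), Q.natDegree ≤ n →
        (Polynomial.C r * Q.comp (-Polynomial.X)).natDegree ≤ n := fun r Q hQ =>
      (Polynomial.natDegree_C_mul_le _ _).trans (by simpa [Polynomial.natDegree_comp] using hQ)
    have hcoeff : ∀ (r : ℝ) (c : Finset (Fin n) → ℝ),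
        (Polynomial.C r * (P c 0).comp (-Polynomial.X)).coeff n = r * σ * c Finset.univ := by
      intro r c
      rw [Polynomial.coeff_C_mul, show (-Polynomial.X : ℝ[X]) = Polynomial.C (-1) * Polynomial.X by
        simp, Polynomial.comp_C_mul_X_coeff, hPcoeff]
      ring
    set A := Polynomial.C σ * (P a 0).comp (-Polynomial.X) with hA
    set B := Polynomial.C (-σ) * (P b 0).comp (-Polynomial.X) with hB
    have hWAB : ∀ x, 0 ≤ B.derivative.eval x * A.eval x - B.eval x * A.derivative.eval x := by
      intro x
      have := mul_nonneg (mul_self_nonneg σ) (hW 0 (-x))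
      simp only [hA, hB, Polynomial.derivative_C_mul, Polynomial.derivative_comp,
        Polynomial.derivative_neg, Polynomial.derivative_X, Polynomial.eval_mul, Polynomial.eval_C,
        Polynomial.eval_comp, Polynomial.eval_neg, Polynomial.eval_X, Polynomial.eval_one]
      linear_combination this
    have hne : ∀ s, ε ≤ s → (s + 0) * A.eval s + B.eval s ≠ 0 := by
      intro s hs h0
      have hroot : (diagPoly g).IsRoot (-s) := by
        rw [Polynomial.IsRoot, diagPoly, hab]
        have h4 : ∀ c, (P c 0).eval (-s) =
            (multiAffineEval c fun _ => (Polynomial.X : ℝ[X])).eval (-s) := fun c => by simp [hP]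
        simp only [hA, hB, Polynomial.eval_mul, Polynomial.eval_add, Polynomial.eval_C,
          Polynomial.eval_comp, Polynomial.eval_neg, Polynomial.eval_X] at h0 ⊢
        rw [← h4, ← h4]
        linear_combination (-σ) * h0 + (s * (P a 0).eval (-s) - (P b 0).eval (-s)) * hσ2
      have := (hroots _ hroot).1
      linarith
    obtain ⟨h1, h2, h3⟩ := le_coeff_of_wronskian_nonneg (hdeg _ _ (hPdeg _ _))
      (by rw [hcoeff, ha, hσ2, mul_one]) (hdeg _ _ (hPdeg _ _)) hWAB hne
    rw [hcoeff, neg_mul, hσ2] at h2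
    rw [add_zero] at h3
    have := h3.trans_le (add_le_add_right h2 _)
    rw [← add_mul] at this
    have := pos_of_mul_pos_left this h1.le
    linarith
  set x : Fin n → ℝ := fun k => u k.castSucc with hx
  obtain ⟨hA, hB, -⟩ := le_coeff_of_wronskian_nonneg (s₀ := 0) (τ := u (Fin.last n))
    (hPdeg a x) ((hPcoeff a x).trans ha) (hPdeg b x) (hW x) (by
      intro s hs
      have h := hu (fun i => s + u i) fun i => by linarith
      rw [← MvPolynomial.coe_aeval_eq_eval, RingHom.coe_coe, hab] at h
      rwa [hPeval, hPeval])
  rw [hPcoeff] at hB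
  have hres : restrictAt g u (Fin.last n) =
      Polynomial.C ((P a x).eval 0) * Polynomial.X + Polynomial.C ((P b x).eval 0) := by
    have hC : ∀ c, multiAffineEval c (fun k => Polynomial.C (x k)) =
        Polynomial.C ((P c x).eval 0) := fun c => by
      simp [hPeval, multiAffineEval]
    rw [restrictAt, hab]
    simp only [if_true, Fin.castSucc_ne_last, if_false]
    rw [hC, hC, mul_comm]
  rw [hres]
  refine ⟨Polynomial.natDegree_linear hA.ne', ?_, fun y hy => ?_⟩
  · rwa [Polynomial.leadingCoeff_linear hA.ne']
  · simp only [Polynomial.IsRoot, Polynomial.eval_add, Polynomial.eval_mul, Polynomial.eval_C,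
      Polynomial.eval_X] at hy
    have := mul_nonpos_of_nonpos_of_nonneg hb hA.le
    exact nonneg_of_mul_nonneg_right (by linarith : 0 ≤ (P a x).eval 0 * y) hA
end
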